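/- There is an absolute constant c₂ > 0 with the following property. Let K be an isotropic convex body in ℝ^n (n ≥ 2) and set r_n = vol_n(B₂ⁿ)^{−1/n}. Then for every t > 0, max{ N(r_n·B₂ⁿ, t·K), N(r_n·K°, t·B₂ⁿ) } ≤ exp( c₂²·(log n)²·n / t² ), where N(A,B) denotes the covering number of A by translates of B. -/

import Mathlib

open MeasureTheory Metric Set
open scoped ENNReal RealInnerProductSpace Pointwise

noncomputable section

/-- The polar body of `K`. -/
def polarBody {n : ℕ} (K : Set (EuclideanSpace ℝ (Fin n))) : Set (EuclideanSpace ℝ (Fin n)) :=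
  {x | ∀ y ∈ K, ⟪x, y⟫ ≤ 1}

/-- `K` is isotropic: volume one, barycenter at the origin, and the quadratic form
`ξ ↦ ∫_K ⟨x, ξ⟩² dx` is constant (`= L_K²`) on the unit sphere. -/
def IsIsotropic {n : ℕ} (K : Set (EuclideanSpace ℝ (Fin n))) : Prop :=
  volume K = 1 ∧ (∫ x in K, x) = (0 : EuclideanSpace ℝ (Fin n)) ∧
    ∃ L : ℝ, 0 < L ∧ ∀ ξ : EuclideanSpace ℝ (Fin n), ‖ξ‖ = 1 →
      (∫ x in K, (⟪x, ξ⟫) ^ 2) = L ^ 2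

/-- The covering number `N(A, B)`: the least number of translates of `B` needed to cover `A`. -/
def covN {n : ℕ} (A B : Set (EuclideanSpace ℝ (Fin n))) : ℕ∞ :=
  sInf ((fun s : Finset (EuclideanSpace ℝ (Fin n)) => (s.card : ℕ∞)) ''
    {s | A ⊆ ⋃ x ∈ s, (fun b => x + b) '' B})

/-- `r_n = vol_n(B₂ⁿ)^{−1/n}`. -/
def rn (n : ℕ) : ℝ :=
  (volume (closedBall (0 : EuclideanSpace ℝ (Fin n)) 1)).toReal ^ (-(1:ℝ) / n)

namespace GridB
open Finset Filter Topology Matrix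
open Real (exp exp_pos exp_add exp_le_exp exp_zero log sqrt_pos)
lemma mlL {a b c : ℝ} (h : b ≤ c) (k : 0 ≤ a) : a * b ≤ a * c := mul_le_mul_of_nonneg_left h k
lemma mlR {a b c : ℝ} (h : b ≤ c) (k : 0 ≤ a) : b * a ≤ c * a := mul_le_mul_of_nonneg_right h k
section
variable {ι : Type} [Fintype ι] [DecidableEq ι]
def bx (ι : Type) [Fintype ι] [DecidableEq ι] (N : ℕ) : Finset (ι → ℤ) :=
  Fintype.piFinset fun _ => Finset.Icc (-(N:ℤ)) N
def ee (i : ι) : ι → ℤ := Pi.single i 1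
def D (N : ℕ) (h : ℝ) (i : ι) (f : (ι → ℤ) → ℝ) (x : ι → ℤ) : ℝ :=
  if x + ee i ∈ bx ι N then (f (x + ee i) - f x) / h else 0
def rr (N : ℕ) (w : (ι → ℤ) → ℝ) (i : ι) (x : ι → ℤ) : ℝ :=
  if x - ee i ∈ bx ι N then w (x - ee i) / w x else 0
def Ds (N : ℕ) (h : ℝ) (w : (ι → ℤ) → ℝ) (i : ι) (g : (ι → ℤ) → ℝ) (x : ι → ℤ) : ℝ :=
  (rr N w i x * g (x - ee i) - (if x + ee i ∈ bx ι N then g x else 0)) / h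
def ip (N : ℕ) (w f g : (ι → ℤ) → ℝ) : ℝ := ∑ x ∈ bx ι N, w x * f x * g x
def cc (N : ℕ) (h : ℝ) (w : (ι → ℤ) → ℝ) (i j : ι) (x : ι → ℤ) : ℝ :=
  (rr N w i (x + ee j) - rr N w i x) / h ^ 2
variable {N : ℕ} {h : ℝ} {w : (ι → ℤ) → ℝ}
lemma mem_bx {x : ι → ℤ} : x ∈ bx ι N ↔ ∀ i, -(N:ℤ) ≤ x i ∧ x i ≤ N := by
  simp [bx, Fintype.mem_piFinset]
lemma mem_add {x : ι → ℤ} (hx : x ∈ bx ι N) (i : ι) : x + ee i ∈ bx ι N ↔ x i + 1 ≤ N := by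
  rw [mem_bx] at *
  constructor
  · intro H; have := (H i).2; simpa [ee] using this
  · intro H j
    by_cases hj : j = i
    · subst hj; have := hx j; simp [ee]; omega
    · have := hx j; simp [ee, hj]; omega
lemma mem_sub {x : ι → ℤ} (hx : x ∈ bx ι N) (i : ι) : x - ee i ∈ bx ι N ↔ -(N:ℤ) ≤ x i - 1 := by
  rw [mem_bx] at *
  constructor
  · intro H; have := (H i).1; simpa [ee] using this
  · intro H j
    by_cases hj : j = i
    · subst hj; have := hx j; simp [ee]; omega
    · have := hx j; simp [ee, hj]; omega
lemma sum_shift (F : (ι → ℤ) → (ι → ℤ) → ℝ) (i : ι) :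
    ∑ x ∈ bx ι N, (if x + ee i ∈ bx ι N then F x (x + ee i) else 0)
    = ∑ x ∈ bx ι N, (if x - ee i ∈ bx ι N then F (x - ee i) x else 0) := by
  rw [← Finset.sum_filter, ← Finset.sum_filter]
  refine Finset.sum_bij' (fun x _ => x + ee i) (fun x _ => x - ee i) ?_ ?_ ?_ ?_ ?_ <;>
    simp +contextual [Finset.mem_filter]
lemma adj (hw : ∀ x, 0 < w x) (i : ι) (f g : (ι → ℤ) → ℝ) :
    ip N w (D N h i f) g = ip N w f (Ds N h w i g) := by
  unfold ip
  have h1 := sum_shift (N := N) (fun x y => w x * f y * g x / h) i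
  have e1 : ∑ x ∈ bx ι N, w x * D N h i f x * g x
      = ∑ x ∈ bx ι N, (if x + ee i ∈ bx ι N then w x * f (x + ee i) * g x / h else 0)
        - ∑ x ∈ bx ι N, (if x + ee i ∈ bx ι N then w x * f x * g x / h else 0) := by
    rw [← sum_sub_distrib]
    refine sum_congr rfl fun x _ => ?_
    unfold D; split_ifs <;> ring
  rw [e1, h1, ← sum_sub_distrib]
  refine sum_congr rfl fun x _ => ?_
  unfold Ds rr
  have := (hw x).ne'
  split_ifs <;> field_simp <;> ring
lemma comm (i j : ι) (g : (ι → ℤ) → ℝ) (hg : ∀ y, y + ee i ∉ bx ι N → g y = 0)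
    {x : ι → ℤ} (hx : x ∈ bx ι N) (hj : x + ee j ∈ bx ι N) :
    D N h j (Ds N h w i g) x = Ds N h w i (D N h j g) x + cc N h w i j x * g (x + ee j - ee i) := by
  by_cases hij : i = j
  · subst hij
    have e1 : x + ee i - ee i = x := by abel
    have e2 : x - ee i + ee i = x := by abel
    have e3 : g (x + ee i) = if x + ee i + ee i ∈ bx ι N then g (x + ee i) else 0 := by
      split_ifs with H
      · rfl
      · exact hg _ H
    unfold D Ds cc
    simp only [e1, e2, hx, hj, if_true]
    rw [← e3]
    ring
  · have e1 : x + ee j - ee i = x - ee i + ee j := by abel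
    have s1 : x + ee j + ee i ∈ bx ι N ↔ x + ee i ∈ bx ι N := by
      rw [mem_add hj, mem_add hx]; simp [ee, hij]
    have s2 : x + ee j - ee i ∈ bx ι N ↔ x - ee i ∈ bx ι N := by
      rw [mem_sub hj, mem_sub hx]; simp [ee, hij]
    unfold D Ds cc
    rw [if_pos hj, e1]
    simp only [hj, if_true, s1]
    by_cases hi : x - ee i ∈ bx ι N
    · have : x - ee i + ee j ∈ bx ι N := by rw [← e1]; exact s2.2 hi
      simp only [this, if_true]
      split_ifs <;> ring
    · have : x - ee i + ee j ∉ bx ι N := by rw [← e1]; exact fun H => hi (s2.1 H)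
      have r1 : rr N w i x = 0 := by simp [rr, hi]
      have r2 : rr N w i (x + ee j) = 0 := by simp [rr, s2, hi]
      rw [r1, r2]
      split_ifs <;> ring
lemma D_zero (i : ι) (f : (ι → ℤ) → ℝ) (y : ι → ℤ) (hy : y + ee i ∉ bx ι N) : D N h i f y = 0 := by
  simp [D, hy]
lemma D_comm (i j : ι) (f : (ι → ℤ) → ℝ) {x : ι → ℤ} (hx : x ∈ bx ι N) :
    D N h i (D N h j f) x = D N h j (D N h i f) x := by
  by_cases hij : i = j
  · rw [hij]
  have e1 : x + ee i + ee j = x + ee j + ee i := by abel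
  by_cases hi : x + ee i ∈ bx ι N <;> by_cases hj : x + ee j ∈ bx ι N
  · have s1 : x + ee j + ee i ∈ bx ι N ↔ x + ee i ∈ bx ι N := by
      rw [mem_add hj, mem_add hx]; simp [ee, hij]
    have h3 := s1.2 hi
    simp only [D, hi, hj, if_true, e1, h3]; ring
  · have s1 : x + ee i + ee j ∉ bx ι N := by
      rw [mem_add hx] at hj; rw [mem_add hi]; simpa [ee, Ne.symm hij] using hj
    simp [D, hi, hj, s1]
  · have s1 : x + ee j + ee i ∉ bx ι N := by
      rw [mem_add hx] at hi; rw [mem_add hj]; simpa [ee, hij] using hi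
    simp [D, hi, hj, s1]
  · simp [D, hi, hj]
lemma ip_comm (f g : (ι → ℤ) → ℝ) : ip N w f g = ip N w g f := by
  unfold ip; exact sum_congr rfl fun x _ => by ring
def Lap (N : ℕ) (h : ℝ) (w : (ι → ℤ) → ℝ) (u : (ι → ℤ) → ℝ) (x : ι → ℤ) : ℝ :=
  ∑ i, Ds N h w i (D N h i u) x
lemma ip_Lap (hw : ∀ x, 0 < w x) (u g : (ι → ℤ) → ℝ) :
    ip N w g (Lap N h w u) = ∑ i, ip N w (D N h i g) (D N h i u) := by
  simp_rw [adj hw]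
  unfold ip Lap
  rw [sum_comm]
  exact sum_congr rfl fun x _ => by rw [mul_sum]
lemma bochner (hw : ∀ x, 0 < w x) (u : (ι → ℤ) → ℝ) :
    ip N w (Lap N h w u) (Lap N h w u) =
      ∑ i, ∑ j, ip N w (D N h j (D N h i u)) (D N h j (D N h i u)) +
      ∑ x ∈ bx ι N, w x * ∑ i, ∑ j, cc N h w i j x * D N h i u (x + ee j - ee i) * D N h j u x := by
  rw [ip_Lap hw]
  have key : ∀ j, ip N w (D N h j (Lap N h w u)) (D N h j u)
      = ∑ i, (ip N w (D N h j (D N h i u)) (D N h j (D N h i u)) +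
        ∑ x ∈ bx ι N, w x * (cc N h w i j x * D N h i u (x + ee j - ee i) * D N h j u x)) := by
    intro j
    have e0 : ip N w (D N h j (Lap N h w u)) (D N h j u)
        = ∑ i, ip N w (D N h j (Ds N h w i (D N h i u))) (D N h j u) := by
      unfold ip
      rw [sum_comm]
      refine sum_congr rfl fun x _ => ?_
      rw [← sum_mul, ← mul_sum]
      congr 2
      by_cases hj : x + ee j ∈ bx ι N
      · have : ∀ f : (ι → ℤ) → ℝ, D N h j f x = (f (x + ee j) - f x) / h := fun f => by simp [D, hj]
        simp_rw [this]
        unfold Lap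
        rw [← sum_sub_distrib, sum_div]
      · simp [D_zero, hj]
    rw [e0]
    refine sum_congr rfl fun i _ => ?_
    have e1 : ip N w (D N h j (Ds N h w i (D N h i u))) (D N h j u) =
        ip N w (Ds N h w i (D N h j (D N h i u))) (D N h j u) +
        ∑ x ∈ bx ι N, w x * (cc N h w i j x * D N h i u (x + ee j - ee i) * D N h j u x) := by
      unfold ip
      rw [← sum_add_distrib]
      refine sum_congr rfl fun x hx => ?_
      by_cases hj : x + ee j ∈ bx ι N
      · rw [comm i j _ (D_zero i u) hx hj]; ring
      · rw [D_zero j u x hj]; ring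
    rw [e1, ip_comm, ← adj hw]
    congr 1
    unfold ip
    exact sum_congr rfl fun x hx => by rw [D_comm i j u hx]
  rw [sum_congr rfl fun j _ => key j, sum_comm]
  simp_rw [sum_add_distrib]
  congr 1
  simp_rw [mul_sum]
  rw [sum_comm (s := bx ι N)]
  exact sum_congr rfl fun i _ => by rw [sum_comm]
end
section
variable {ι : Type} [Fintype ι] [DecidableEq ι]
variable {N : ℕ} {h : ℝ} {w : (ι → ℤ) → ℝ}
lemma D_pos (i : ι) (f : (ι → ℤ) → ℝ) (y : ι → ℤ) (hy : y + ee i ∈ bx ι N) :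
    D N h i f y = (f (y + ee i) - f y) / h := by
  simp [D, hy]
lemma shift_le (hw2 : ∀ x ∈ bx ι N, ∀ i, x + ee i ∈ bx ι N → w (x + ee i) ≤ 2 * w x)
    (hw : ∀ x, 0 < w x) (i : ι) (G : (ι → ℤ) → ℝ) :
    ∑ x ∈ bx ι N, w x * (if x - ee i ∈ bx ι N then G (x - ee i) ^ 2 else 0) ≤ 2 * ip N w G G := by
  have h1 := sum_shift (N := N) (fun x y => w y * G x ^ 2) i
  have e1 : ∑ x ∈ bx ι N, w x * (if x - ee i ∈ bx ι N then G (x - ee i) ^ 2 else 0)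
    = ∑ x ∈ bx ι N, (if x - ee i ∈ bx ι N then w x * G (x - ee i) ^ 2 else 0) :=
    sum_congr rfl fun x _ => by split_ifs <;> simp
  rw [e1, ← h1, ip, mul_sum]
  refine sum_le_sum fun x hx => ?_
  split_ifs with H
  · have := hw2 x hx i H
    nlinarith [sq_nonneg (G x), mlR this (sq_nonneg (G x))]
  · have := (hw x).le
    nlinarith [mul_nonneg this (sq_nonneg (G x))]
lemma entry {H : Matrix ι ι ℝ} {C θ : ℝ} (hh : 0 < h) (hw : ∀ x, 0 < w x)
    (hw2 : ∀ x ∈ bx ι N, ∀ i, x + ee i ∈ bx ι N → w (x + ee i) ≤ 2 * w x)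
    {x : ι → ℤ} (hx : x ∈ bx ι N) (i j : ι)
    (ha : x - ee i ∈ bx ι N → x + ee j ∈ bx ι N → |cc N h w i j x - H i j| ≤ θ)
    (hH : |H i j| ≤ C) (h1 : h * (C + θ) ≤ θ) (hd : C ^ 2 * Fintype.card ι * h ^ 2 ≤ 2 * θ) (hθ : 0 ≤ θ)
    (u : (ι → ℤ) → ℝ) :
    H i j * D N h i u x * D N h j u x - θ * (D N h i u x ^ 2 / 2 + D N h j u x ^ 2 * (5 / 2))
      - θ / 2 * ((if x - ee i ∈ bx ι N then D N h j (D N h i u) (x - ee i) ^ 2 else 0)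
      + (if x - ee i ∈ bx ι N then D N h i (D N h i u) (x - ee i) ^ 2 else 0))
      + (if x - ee i ∈ bx ι N then 0 else
        (if i = j then D N h i u x ^ 2 / (2 * h ^ 2) else 0)
          - D N h i u x ^ 2 / (2 * h ^ 2 * Fintype.card ι))
    ≤ cc N h w i j x * D N h i u (x + ee j - ee i) * D N h j u x := by
  have hdp : (0:ℝ) < Fintype.card ι := by
    have : 0 < Fintype.card ι := Fintype.card_pos_iff.2 ⟨i⟩
    exact_mod_cast this
  by_cases hj : x + ee j ∈ bx ι N
  swap
  · rw [D_zero j u x hj]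
    have e1 := sq_nonneg (D N h i u x)
    have a1 : 0 ≤ (if x - ee i ∈ bx ι N then D N h j (D N h i u) (x - ee i) ^ 2 else 0) := by positivity
    have a2 : 0 ≤ (if x - ee i ∈ bx ι N then D N h i (D N h i u) (x - ee i) ^ 2 else 0) := by positivity
    have a3 : (if x - ee i ∈ bx ι N then (0:ℝ) else
        (if i = j then D N h i u x ^ 2 / (2 * h ^ 2) else 0)
          - D N h i u x ^ 2 / (2 * h ^ 2 * Fintype.card ι)) ≤ 0 := by
      split_ifs with s1 s2
      · exact le_rfl
      · subst s2; rw [D_zero i u x hj]; simp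
      · have : 0 ≤ D N h i u x ^ 2 / (2 * h ^ 2 * Fintype.card ι) := by positivity
        linarith
    nlinarith [mul_nonneg hθ e1, mul_nonneg hθ a1, mul_nonneg hθ a2]
  by_cases hi : x - ee i ∈ bx ι N
  · simp only [hi, if_true]
    have ha := ha hi hj
    have e1 : x - ee i + ee i = x := by abel
    have e2 : x + ee j - ee i = x - ee i + ee j := by abel
    have m2 : x - ee i + ee j ∈ bx ι N := by
      by_cases hij : i = j
      · subst hij; rwa [e1]
      · rw [← e2, mem_sub hj]
        rw [mem_sub hx] at hi
        simpa [ee, hij] using hi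
    have d1 : D N h i u (x + ee j - ee i) = D N h i u x
        + h * (D N h j (D N h i u) (x - ee i) - D N h i (D N h i u) (x - ee i)) := by
      have q1 : D N h j (D N h i u) (x - ee i)
        = (D N h i u (x - ee i + ee j) - D N h i u (x - ee i)) / h := by
        rw [D_pos _ _ _ m2]
      have q2 : D N h i (D N h i u) (x - ee i)
        = (D N h i u x - D N h i u (x - ee i)) / h := by
        rw [D_pos _ _ _ (by rwa [e1]), e1]
      rw [q1, q2, e2]; field_simp; ring
    rw [d1]
    generalize D N h j (D N h i u) (x - ee i) = P
    generalize D N h i (D N h i u) (x - ee i) = Q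
    generalize D N h i u x = a
    generalize D N h j u x = b
    generalize cc N h w i j x = c at *
    have hc : |c| ≤ C + θ := by
      have := abs_le.1 ha; have := abs_le.1 hH; apply abs_le.2; constructor <;> linarith
    have hhc : |h * c| ≤ θ := by
      rw [abs_mul, abs_of_pos hh]; exact (mlL hc hh.le).trans h1
    have t1 : |(c - H i j) * (a * b)| ≤ θ * (a ^ 2 / 2 + b ^ 2 / 2) := by
      rw [abs_mul]
      refine mul_le_mul ha ?_ (abs_nonneg _) hθ
      apply abs_le.2; constructor <;> nlinarith [sq_nonneg (a + b), sq_nonneg (a - b)]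
    have t2 : |(h * c) * ((P - Q) * b)| ≤ θ * (P ^ 2 / 2 + Q ^ 2 / 2 + b ^ 2) := by
      rw [abs_mul]
      refine mul_le_mul hhc ?_ (abs_nonneg _) hθ
      apply abs_le.2; constructor <;>
        nlinarith [sq_nonneg (P + b), sq_nonneg (P - b), sq_nonneg (Q + b), sq_nonneg (Q - b)]
    have := abs_le.1 t1
    have := abs_le.1 t2
    nlinarith [mul_nonneg hθ (sq_nonneg b)]
  · simp only [hi, if_false]
    have hH2 : H i j * D N h i u x * D N h j u x ≤ D N h i u x ^ 2 / (2 * h ^ 2 * Fintype.card ι)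
        + θ * D N h j u x ^ 2 := by
      generalize D N h i u x = a
      generalize D N h j u x = b
      have q : (H i j) ^ 2 ≤ C ^ 2 := sq_le_sq' (by have := abs_le.1 hH; linarith) (abs_le.1 hH).2
      have k : 0 ≤ (a / (h * Real.sqrt (Fintype.card ι)) - H i j * b * (h * Real.sqrt (Fintype.card ι))) ^ 2 :=
        sq_nonneg _
      have s : Real.sqrt (Fintype.card ι) ^ 2 = Fintype.card ι := Real.sq_sqrt hdp.le
      have sp : 0 < Real.sqrt (Fintype.card ι) := sqrt_pos.2 hdp
      have e : (a / (h * Real.sqrt (Fintype.card ι)) - H i j * b * (h * Real.sqrt (Fintype.card ι))) ^ 2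
          = 2 * (a ^ 2 / (2 * h ^ 2 * Real.sqrt (Fintype.card ι) ^ 2)) - 2 * (H i j * a * b)
            + (H i j)^2 * Real.sqrt (Fintype.card ι) ^ 2 * h^2 * b^2 := by
        field_simp
        ring
      rw [e, s] at k
      have : (H i j)^2 * (Fintype.card ι : ℝ) * h^2 * b^2 ≤ 2 * θ * b^2 := by
        refine mlR (le_trans ?_ hd) (sq_nonneg b)
        gcongr
      nlinarith
    have z1 := mul_nonneg hθ (sq_nonneg (D N h i u x))
    have z2 := mul_nonneg hθ (sq_nonneg (D N h j u x))
    by_cases hij : i = j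
    · subst hij
      simp only [if_true]
      have e1 : x + ee i - ee i = x := by abel
      rw [e1]
      have c1 : 1 / (2 * h ^ 2) ≤ cc N h w i i x := by
        unfold cc rr
        rw [e1]
        simp only [hx, hi, if_true, if_false]
        have w2 := hw2 x hx i hj
        have : 1 / 2 ≤ w x / w (x + ee i) := by
          rw [le_div_iff₀ (hw _)]; linarith
        rw [sub_zero, le_div_iff₀ (by positivity)]
        calc 1 / (2 * h ^ 2) * h ^ 2 = 1 / 2 := by field_simp
          _ ≤ _ := this
      have := mlR c1 (sq_nonneg (D N h i u x))
      have e3 : 1 / (2 * h ^ 2) * D N h i u x ^ 2 = D N h i u x ^ 2 / (2 * h ^ 2) := by ring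
      nlinarith
    · simp only [hij, if_false]
      have m2 : x + ee j - ee i ∉ bx ι N := by
        rw [mem_sub hj]
        rw [mem_sub hx] at hi
        simpa [ee, hij] using hi
      have c0 : cc N h w i j x = 0 := by simp [cc, rr, m2, hi]
      rw [c0]
      nlinarith
lemma bochner_le {H : (ι → ℤ) → Matrix ι ι ℝ} {C θ t : ℝ} (hh : 0 < h) (hw : ∀ x, 0 < w x)
    (hw2 : ∀ x ∈ bx ι N, ∀ i, x + ee i ∈ bx ι N → w (x + ee i) ≤ 2 * w x)
    (ha : ∀ x ∈ bx ι N, ∀ i j, x - ee i ∈ bx ι N → x + ee j ∈ bx ι N →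
      |cc N h w i j x - H x i j| ≤ θ)
    (hH : ∀ x ∈ bx ι N, ∀ i j, |H x i j| ≤ C)
    (hpos : ∀ x ∈ bx ι N, ∀ v : ι → ℝ, t * ∑ i, v i ^ 2 ≤ ∑ i, ∑ j, H x i j * v i * v j)
    (h1 : h * (C + θ) ≤ θ) (hd : C ^ 2 * Fintype.card ι * h ^ 2 ≤ 2 * θ) (hθ : 0 ≤ θ)
    (u : (ι → ℤ) → ℝ) :
    (1 - 3 * Fintype.card ι * θ) * ∑ i, ∑ j, ip N w (D N h j (D N h i u)) (D N h j (D N h i u))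
     + (t - 3 * Fintype.card ι * θ) * ∑ i, ip N w (D N h i u) (D N h i u)
     ≤ ip N w (Lap N h w u) (Lap N h w u) := by
  rw [bochner hw]
  set d : ℝ := (Fintype.card ι : ℝ) with hdd
  set P : ι → ι → (ι → ℤ) → ℝ := fun i j x =>
    if x - ee i ∈ bx ι N then D N h j (D N h i u) (x - ee i) ^ 2 else 0 with hP
  have row : ∀ x ∈ bx ι N, t * ∑ i, D N h i u x ^ 2 - 3 * d * θ * ∑ i, D N h i u x ^ 2
      - θ / 2 * (∑ i, ∑ j, P i j x + d * ∑ i, P i i x)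
      ≤ ∑ i, ∑ j, cc N h w i j x * D N h i u (x + ee j - ee i) * D N h j u x := by
    intro x hx
    have ent := sum_le_sum fun i (_ : i ∈ Finset.univ) =>
      sum_le_sum fun j (_ : j ∈ Finset.univ) =>
      entry hh hw hw2 hx i j (ha x hx i j) (hH x hx i j) h1 hd hθ u
    refine le_trans ?_ ent
    have hp := hpos x hx (fun i => D N h i u x)
    simp only [sum_add_distrib, sum_sub_distrib, ← mul_sum, Finset.sum_const,
      Finset.card_univ, nsmul_eq_mul, ← hdd, ← sum_div, ← sum_mul]
    have e5 : 0 ≤ ∑ i, ∑ j, (if x - ee i ∈ bx ι N then (0:ℝ) else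
        (if i = j then D N h i u x ^ 2 / (2 * h ^ 2) else 0)
          - D N h i u x ^ 2 / (2 * h ^ 2 * d)) := by
      refine sum_nonneg fun i _ => ?_
      split_ifs
      · simp
      · have hd0 : d ≠ 0 := by
          have : 0 < Fintype.card ι := Fintype.card_pos_iff.2 ⟨i⟩
          rw [hdd]; exact_mod_cast this.ne'
        simp only [sum_sub_distrib, Finset.sum_ite_eq, Finset.mem_univ, if_true, Finset.sum_const,
          Finset.card_univ, nsmul_eq_mul, ← hdd]
        apply le_of_eq
        field_simp
        ring
    simp only [hP]
    nlinarith
  have tot := sum_le_sum fun x hx => mlL (row x hx) (hw x).le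
  have sP : ∀ i j, ∑ x ∈ bx ι N, w x * P i j x ≤
      2 * ip N w (D N h j (D N h i u)) (D N h j (D N h i u)) := fun i j => shift_le hw2 hw i _
  have nn : ∀ i j, 0 ≤ ip N w (D N h j (D N h i u)) (D N h j (D N h i u)) := fun i j =>
    sum_nonneg fun x _ => by
      have := mul_nonneg (hw x).le (mul_self_nonneg (D N h j (D N h i u) x)); linarith
  have e1 : ∑ x ∈ bx ι N, w x * (t * ∑ i, D N h i u x ^ 2 - 3 * d * θ * ∑ i, D N h i u x ^ 2
      - θ / 2 * (∑ i, ∑ j, P i j x + d * ∑ i, P i i x)) =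
      (t - 3 * d * θ) * ∑ i, ip N w (D N h i u) (D N h i u)
      - θ / 2 * (∑ i, ∑ j, ∑ x ∈ bx ι N, w x * P i j x + d * ∑ i, ∑ x ∈ bx ι N, w x * P i i x) := by
    have a1 : ∑ i, ip N w (D N h i u) (D N h i u) = ∑ x ∈ bx ι N, w x * ∑ i, D N h i u x ^ 2 := by
      unfold ip; rw [sum_comm]
      exact sum_congr rfl fun x _ => by
        rw [mul_sum]; exact sum_congr rfl fun i _ => by ring
    have a2 : ∑ i, ∑ j, ∑ x ∈ bx ι N, w x * P i j x = ∑ x ∈ bx ι N, w x * ∑ i, ∑ j, P i j x := by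
      simp_rw [mul_sum]
      rw [sum_comm (s := bx ι N)]
      exact sum_congr rfl fun i _ => by rw [sum_comm]
    have a3 : ∑ i, ∑ x ∈ bx ι N, w x * P i i x = ∑ x ∈ bx ι N, w x * ∑ i, P i i x := by
      rw [sum_comm]; simp_rw [mul_sum]
    rw [a1, a2, a3, mul_sum, mul_sum, ← sum_add_distrib, mul_sum,
      ← sum_sub_distrib]
    exact sum_congr rfl fun x _ => by ring
  rw [e1] at tot
  have b1 : ∑ i, ∑ j, ∑ x ∈ bx ι N, w x * P i j x ≤
      2 * ∑ i, ∑ j, ip N w (D N h j (D N h i u)) (D N h j (D N h i u)) := by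
    simp_rw [mul_sum]
    exact sum_le_sum fun i _ => sum_le_sum fun j _ => sP i j
  have b2 : ∑ i, ∑ x ∈ bx ι N, w x * P i i x ≤
      2 * ∑ i, ∑ j, ip N w (D N h j (D N h i u)) (D N h j (D N h i u)) := by
    rw [mul_sum]
    refine sum_le_sum fun i _ => (sP i i).trans ?_
    exact mlL
      (single_le_sum (f := fun j => ip N w (D N h j (D N h i u)) (D N h j (D N h i u)))
        (fun j _ => nn i j) (Finset.mem_univ i)) (by norm_num)
  set X := ∑ i, ∑ j, ip N w (D N h j (D N h i u)) (D N h j (D N h i u)) with hX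
  have X0 : 0 ≤ X := sum_nonneg fun i _ => sum_nonneg fun j _ => nn i j
  have d1 : X ≤ d * X := by
    rcases isEmpty_or_nonempty ι with hE | hN
    · have : X = 0 := by rw [hX]; simp
      rw [this]; simp
    · have : (1:ℝ) ≤ d := by
        rw [hdd]; exact_mod_cast Nat.one_le_iff_ne_zero.2 Fintype.card_ne_zero
      nlinarith
  have d0 : 0 ≤ d := by rw [hdd]; positivity
  have c1 := mlL b1 hθ
  have c2 := mlL b2 (mul_nonneg hθ d0)
  have c3 := mlL d1 hθ
  have c4 := mul_nonneg (mul_nonneg hθ d0) X0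
  nlinarith
end
section
variable {ι : Type} [Fintype ι] [DecidableEq ι]
variable {N : ℕ} {h : ℝ} {w : (ι → ℤ) → ℝ}
def En (N : ℕ) (h : ℝ) (w f g : (ι → ℤ) → ℝ) : ℝ := ∑ i, ip N w (D N h i f) (D N h i g)
lemma ip_add (f g k : (ι → ℤ) → ℝ) : ip N w (f + g) k = ip N w f k + ip N w g k := by
  unfold ip; rw [← sum_add_distrib]; exact sum_congr rfl fun x _ => by simp; ring
lemma ip_smul (c : ℝ) (f k : (ι → ℤ) → ℝ) : ip N w (c • f) k = c * ip N w f k := by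
  unfold ip; rw [mul_sum]; exact sum_congr rfl fun x _ => by simp; ring
lemma ip_add' (f g k : (ι → ℤ) → ℝ) : ip N w k (f + g) = ip N w k f + ip N w k g := by
  rw [ip_comm, ip_add, ip_comm, ip_comm g]
lemma ip_smul' (c : ℝ) (f k : (ι → ℤ) → ℝ) : ip N w k (c • f) = c * ip N w k f := by
  rw [ip_comm, ip_smul, ip_comm]
lemma D_add (i : ι) (f g : (ι → ℤ) → ℝ) : D N h i (f + g) = D N h i f + D N h i g := by
  funext x; simp only [D, Pi.add_apply]; split_ifs <;> ring
lemma D_smul (i : ι) (c : ℝ) (f : (ι → ℤ) → ℝ) : D N h i (c • f) = c • D N h i f := by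
  funext x; simp only [D, Pi.smul_apply, smul_eq_mul]; split_ifs <;> ring
lemma D_one (i : ι) : D N h i (1 : (ι → ℤ) → ℝ) = 0 := by
  funext x; simp [D]
lemma ip_nonneg (hw : ∀ x, 0 < w x) (f : (ι → ℤ) → ℝ) : 0 ≤ ip N w f f :=
  sum_nonneg fun x _ => by
    have := mul_nonneg (hw x).le (mul_self_nonneg (f x)); linarith
lemma En_nonneg (hw : ∀ x, 0 < w x) (f : (ι → ℤ) → ℝ) : 0 ≤ En N h w f f :=
  sum_nonneg fun _ _ => ip_nonneg hw _
lemma En_comm (f g : (ι → ℤ) → ℝ) : En N h w f g = En N h w g f :=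
  sum_congr rfl fun _ _ => ip_comm _ _
lemma En_add (f g k : (ι → ℤ) → ℝ) : En N h w (f + g) k = En N h w f k + En N h w g k := by
  simp only [En, D_add, ip_add, sum_add_distrib]
lemma En_smul (c : ℝ) (f k : (ι → ℤ) → ℝ) : En N h w (c • f) k = c * En N h w f k := by
  simp only [En, D_smul, ip_smul, mul_sum]
lemma ip_zero_on (hw : ∀ x, 0 < w x) (f : (ι → ℤ) → ℝ) (hf : ip N w f f = 0) : ∀ x ∈ bx ι N, f x = 0 := by
  intro x hx
  have := (Finset.sum_eq_zero_iff_of_nonneg (fun x _ => by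
    have := mul_nonneg (hw x).le (mul_self_nonneg (f x)); linarith)).1 hf x hx
  have h0 := (hw x).ne'
  simpa [h0] using this
lemma ip_congr {f g f' g' : (ι → ℤ) → ℝ} (h1 : ∀ x ∈ bx ι N, f x = f' x)
    (h2 : ∀ x ∈ bx ι N, g x = g' x) : ip N w f g = ip N w f' g' :=
  sum_congr rfl fun x hx => by rw [h1 x hx, h2 x hx]
lemma D_congr {f f' : (ι → ℤ) → ℝ} (h1 : ∀ x ∈ bx ι N, f x = f' x) (i : ι) :
    ∀ x ∈ bx ι N, D N h i f x = D N h i f' x := by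
  intro x hx; unfold D; split_ifs with H
  · rw [h1 x hx, h1 _ H]
  · rfl
lemma En_congr {f f' : (ι → ℤ) → ℝ} (h1 : ∀ x ∈ bx ι N, f x = f' x) :
    En N h w f f = En N h w f' f' :=
  sum_congr rfl fun i _ => ip_congr (D_congr h1 i) (D_congr h1 i)
lemma zero_mem : (0 : ι → ℤ) ∈ bx ι N := by rw [mem_bx]; intro i; simp
lemma ip_one_pos (hw : ∀ x, 0 < w x) : 0 < ip N w 1 1 := by
  unfold ip
  exact Finset.sum_pos (fun x _ => by simpa using hw x) ⟨0, zero_mem⟩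
lemma const_of (hh : 0 < h) (f : (ι → ℤ) → ℝ) (hD : ∀ i, ∀ x ∈ bx ι N, D N h i f x = 0) :
    ∀ x ∈ bx ι N, f x = f (fun _ => -(N:ℤ)) := by
  have : ∀ n : ℕ, ∀ x ∈ bx ι N, ∑ i, (x i + N).toNat = n → f x = f (fun _ => -(N:ℤ)) := by
    intro n
    induction n with
    | zero =>
      intro x hx hs
      congr 1; funext i
      have := Finset.sum_eq_zero_iff.1 hs i (Finset.mem_univ i)
      have := mem_bx.1 hx i; omega
    | succ n ih =>
      intro x hx hs
      obtain ⟨i, hi⟩ : ∃ i, 0 < (x i + N).toNat := by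
        by_contra! H
        have : ∑ i, (x i + N).toNat = 0 := Finset.sum_eq_zero fun i _ => by have := H i; omega
        omega
      have hm : x - ee i ∈ bx ι N := by rw [mem_sub hx]; omega
      have e1 : x - ee i + ee i = x := by abel
      have := hD i _ hm
      rw [D_pos _ _ _ (by rwa [e1]), e1, div_eq_zero_iff] at this
      have h2 : f x = f (x - ee i) := by
        rcases this with h | h
        · linarith
        · exact absurd h hh.ne'
      rw [h2]
      apply ih _ hm
      have e3 : ∑ j, (x j + N).toNat = ∑ j, (((x - ee i) j + N).toNat + if j = i then 1 else 0) := by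
        refine sum_congr rfl fun j _ => ?_
        by_cases hj : j = i
        · subst hj; simp [ee]; omega
        · simp [ee, hj]
      rw [sum_add_distrib] at e3
      simp at e3
      simp only [Pi.sub_apply]
      omega
  exact fun x hx => this _ x hx rfl
lemma exists_eig (hh : 0 < h) (hw : ∀ x, 0 < w x) (g₀ : (ι → ℤ) → ℝ) (hg0 : ip N w g₀ 1 = 0)
    (hg1 : ip N w g₀ g₀ ≠ 0) :
    ∃ (f : (ι → ℤ) → ℝ) (l : ℝ), 0 < l ∧ ip N w f 1 = 0 ∧ ip N w f f = 1 ∧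
      (∀ x ∈ bx ι N, Lap N h w f x = l * f x) ∧
      ∀ g, ip N w g 1 = 0 → l * ip N w g g ≤ En N h w g g := by
  set A : Set ((ι → ℤ) → ℝ) := {f | (∀ x ∉ bx ι N, f x = 0) ∧ ip N w f 1 = 0 ∧ ip N w f f = 1} with hA
  have ipc : Continuous fun f : (ι → ℤ) → ℝ => ip N w f f := by unfold ip; fun_prop
  have ipc1 : Continuous fun f : (ι → ℤ) → ℝ => ip N w f 1 := by unfold ip; fun_prop
  have Dc : ∀ i x, Continuous fun f : (ι → ℤ) → ℝ => D N h i f x := by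
    intro i x; unfold D; split_ifs <;> fun_prop
  have Ec : Continuous fun f : (ι → ℤ) → ℝ => En N h w f f := by
    unfold En ip
    exact continuous_finsetSum _ fun i _ => continuous_finsetSum _ fun x _ =>
      ((continuous_const.mul (Dc i x)).mul (Dc i x))
  have Acl : IsClosed A := by
    refine IsClosed.inter ?_ (IsClosed.inter (isClosed_eq ipc1 continuous_const) (isClosed_eq ipc continuous_const))
    have : {f : (ι → ℤ) → ℝ | ∀ x ∉ bx ι N, f x = 0} = ⋂ x, ⋂ (_ : x ∉ bx ι N), {f | f x = 0} := by
      ext f; simp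
    change IsClosed {f : (ι → ℤ) → ℝ | ∀ x ∉ bx ι N, f x = 0}
    rw [this]
    exact isClosed_iInter fun x => isClosed_iInter fun _ => isClosed_eq (continuous_apply x) continuous_const
  have Acomp : IsCompact A := by
    refine IsCompact.of_isClosed_subset
      (isCompact_univ_pi (s := fun x : ι → ℤ => Set.Icc (-(1 + 1 / w x)) (1 + 1 / w x)) fun x => isCompact_Icc) Acl ?_
    rintro f ⟨h0, _, h2⟩ x _
    have q : w x * f x * f x ≤ 1 := by
      by_cases hx : x ∈ bx ι N
      · rw [← h2]
        exact single_le_sum (f := fun x => w x * f x * f x) (fun x _ => by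
          have := mul_nonneg (hw x).le (mul_self_nonneg (f x)); linarith) hx
      · rw [h0 x hx]; simp
    have q2 : f x ^ 2 ≤ 1 / w x := by rw [le_div_iff₀ (hw x)]; nlinarith
    have q3 : 0 < 1 / w x := by have := hw x; positivity
    exact abs_le.1 (abs_le_of_sq_le_sq (by nlinarith) (by linarith))
  have norm : ∀ g : (ι → ℤ) → ℝ, ip N w g 1 = 0 → ip N w g g ≠ 0 → ∃ f ∈ A,
      En N h w f f = En N h w g g / ip N w g g := by
    intro g h1 h2
    have hp : 0 < ip N w g g := lt_of_le_of_ne (ip_nonneg hw g) (Ne.symm h2)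
    set f : (ι → ℤ) → ℝ := (1 / Real.sqrt (ip N w g g)) • fun x => if x ∈ bx ι N then g x else 0 with hf
    have hc : ∀ x ∈ bx ι N, f x = ((1 / Real.sqrt (ip N w g g)) • g) x := by
      intro x hx; simp [hf, hx]
    have s := Real.mul_self_sqrt hp.le
    have sp := sqrt_pos.2 hp
    refine ⟨f, ⟨?_, ?_, ?_⟩, ?_⟩
    · intro x hx; simp [hf, hx]
    · rw [ip_congr hc (fun _ _ => rfl), ip_smul, h1, mul_zero]
    · rw [ip_congr hc hc, ip_smul, ip_smul']; field_simp; nlinarith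
    · rw [En_congr hc, En_smul, En_comm, En_smul, ← mul_assoc, div_mul_div_comm, s, one_mul]
      ring
  obtain ⟨f0, hf0, _⟩ := norm g₀ hg0 hg1
  obtain ⟨f, hfA, hmin⟩ := Acomp.exists_isMinOn ⟨f0, hf0⟩ Ec.continuousOn
  set l := En N h w f f with hl
  have hq : ∀ g, ip N w g 1 = 0 → l * ip N w g g ≤ En N h w g g := by
    intro g hg
    by_cases h0 : ip N w g g = 0
    · rw [h0, mul_zero]; exact En_nonneg hw g
    · obtain ⟨f', hf', e⟩ := norm g hg h0
      have := hmin hf'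
      have hp : 0 < ip N w g g := lt_of_le_of_ne (ip_nonneg hw g) (Ne.symm h0)
      simp only [Set.mem_ofPred_eq] at this
      rw [e, le_div_iff₀ hp] at this
      exact this
  obtain ⟨_, hf1, hf2⟩ := hfA
  have pol : ∀ g, ip N w g 1 = 0 → En N h w g f - l * ip N w g f = 0 := by
    intro g hg
    by_contra hne
    set q := En N h w g f - l * ip N w g f with hqd
    set Q := En N h w g g - l * ip N w g g with hQ
    have key : ∀ s : ℝ, 0 ≤ 2 * s * q + s ^ 2 * Q := by
      intro s
      have := hq (f + s • g) (by rw [ip_add, ip_smul, hf1, hg]; ring)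
      simp only [ip_add, ip_add', ip_smul, ip_smul', En_add, En_smul] at this
      rw [En_comm f, En_comm g (f + _), En_add, En_add, En_smul, En_smul, hf2, ← hl, ip_comm f g,
        En_comm f g] at this
      rw [hqd, hQ]; nlinarith
    have Q0 : 0 ≤ Q := by have := hq g hg; rw [hQ]; linarith
    have := key (-q / (Q + 1))
    have e : 2 * (-q / (Q + 1)) * q + (-q / (Q + 1)) ^ 2 * Q = - (q ^ 2 * (Q + 2)) / (Q + 1) ^ 2 := by
      field_simp; ring
    rw [e] at this
    have p1 : 0 < q ^ 2 * (Q + 2) := by positivity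
    have p2 : 0 < q ^ 2 * (Q + 2) / (Q + 1) ^ 2 := by positivity
    rw [neg_div] at this
    linarith
  have W0 := ip_one_pos (N := N) hw
  have polall : ∀ g, En N h w g f - l * ip N w g f = 0 := by
    intro g
    have e1 : En N h w 1 f = 0 := by simp [En, D_one, ip]
    have := pol (g + (-(ip N w g 1 / ip N w 1 1)) • 1) (by
      rw [ip_add, ip_smul]; field_simp; ring)
    rw [En_add, En_smul, ip_add, ip_smul, e1, ip_comm 1 f, hf1] at this
    linarith
  have eig : ∀ x ∈ bx ι N, Lap N h w f x = l * f x := by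
    intro x hx
    have := polall (Lap N h w f + (-l) • f)
    have e2 : En N h w (Lap N h w f + (-l) • f) f = ip N w (Lap N h w f + (-l) • f) (Lap N h w f) := by
      rw [ip_Lap hw]; rfl
    rw [e2] at this
    have e3 : ip N w (Lap N h w f + (-l) • f) (Lap N h w f + (-l) • f) = 0 := by
      rw [ip_add', ip_smul']; linarith
    have := ip_zero_on hw _ e3 x hx
    simp at this; linarith
  refine ⟨f, l, ?_, hf1, hf2, eig, hq⟩
  refine lt_of_le_of_ne (En_nonneg hw f) fun h0 => ?_
  have h0' : ∑ i, ip N w (D N h i f) (D N h i f) = 0 := h0.symm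
  have hD : ∀ i, ∀ x ∈ bx ι N, D N h i f x = 0 := fun i => ip_zero_on hw _
    ((Finset.sum_eq_zero_iff_of_nonneg fun i _ => ip_nonneg hw _).1 h0' i (Finset.mem_univ i))
  have hc := const_of hh f hD
  set c := f (fun _ => -(N:ℤ))
  have e1 : ip N w f 1 = c * ip N w 1 1 := by
    rw [← ip_smul]; exact ip_congr (fun x hx => by simp [hc x hx]) fun _ _ => rfl
  have e2 : ip N w f f = c ^ 2 * ip N w 1 1 := by
    rw [pow_two, mul_assoc, ← ip_smul', ← ip_smul]
    exact ip_congr (fun x hx => by simp [hc x hx]) (fun x hx => by simp [hc x hx])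
  rw [hf1] at e1
  have : c = 0 := by
    rcases mul_eq_zero.1 e1.symm with h | h
    · exact h
    · linarith
  rw [hf2, this] at e2; norm_num at e2
lemma gap_arith {W B l l1 a ε t p X : ℝ} (W0 : 0 < W) (B0 : 0 ≤ B) (lpos : 0 < l) (ha0 : 0 ≤ a)
    (hε0 : 0 ≤ ε) (hε : ε ≤ 1) (hlt : l < l1) (bb : B = l * p) (cs : p ^ 2 ≤ a * W * B)
    (pis : l * (l - B / W) ≤ X) (bo : (1 - ε) * X + (t - ε) * l ≤ l ^ 2) :
    t - ε ≤ ε * l1 + l1 ^ 2 * a := by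
  have BW : B / W ≤ l ^ 2 * a := by
    rw [div_le_iff₀ W0]
    by_cases hB0 : B = 0
    · rw [hB0]; positivity
    have Bp : 0 < B := lt_of_le_of_ne B0 (Ne.symm hB0)
    have : B * B ≤ l ^ 2 * (a * W * B) := by
      calc B * B = l ^ 2 * p ^ 2 := by rw [bb]; ring
        _ ≤ _ := mlL cs (by positivity)
    nlinarith
  have BW0 : 0 ≤ B / W := by positivity
  have k1 := mlL pis (sub_nonneg.2 hε)
  have k2 : l * ((1 - ε) * (l - B / W) + (t - ε)) ≤ l * l := by nlinarith
  have k3 := le_of_mul_le_mul_left k2 lpos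
  have k4 : t - ε ≤ ε * l + l ^ 2 * a := by nlinarith
  have a1 := mlL hlt.le hε0
  have a2 : l ^ 2 * a ≤ l1 ^ 2 * a :=
    mlR (pow_le_pow_left₀ lpos.le hlt.le 2) ha0
  linarith
set_option maxHeartbeats 1000000 in
lemma gap {H : (ι → ℤ) → Matrix ι ι ℝ} {C θ t a l1 : ℝ} (hh : 0 < h) (hw : ∀ x, 0 < w x)
    (hw2 : ∀ x ∈ bx ι N, ∀ i, x + ee i ∈ bx ι N → w (x + ee i) ≤ 2 * w x)
    (ha : ∀ x ∈ bx ι N, ∀ i j, x - ee i ∈ bx ι N → x + ee j ∈ bx ι N →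
      |cc N h w i j x - H x i j| ≤ θ)
    (hH : ∀ x ∈ bx ι N, ∀ i j, |H x i j| ≤ C)
    (hpos : ∀ x ∈ bx ι N, ∀ v : ι → ℝ, t * ∑ i, v i ^ 2 ≤ ∑ i, ∑ j, H x i j * v i * v j)
    (h1 : h * (C + θ) ≤ θ) (hd : C ^ 2 * Fintype.card ι * h ^ 2 ≤ 2 * θ) (hθ : 0 ≤ θ)
    (ha0 : 0 ≤ a)
    (hcov : ∀ v : ι → ℝ, ip N w (fun x => ∑ i, v i * (h * x i)) (fun x => ∑ i, v i * (h * x i))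
      - ip N w (fun x => ∑ i, v i * (h * x i)) 1 ^ 2 / ip N w 1 1 ≤ a * ip N w 1 1 * ∑ i, v i ^ 2)
    (hε : 3 * Fintype.card ι * θ ≤ 1) 
    (hl : 3 * Fintype.card ι * θ * l1 + l1 ^ 2 * a < t - 3 * Fintype.card ι * θ)
    (g : (ι → ℤ) → ℝ) :
    l1 * (ip N w g g - ip N w g 1 ^ 2 / ip N w 1 1) ≤ En N h w g g := by
  have W0 := ip_one_pos (N := N) hw
  set W := ip N w 1 1 with hW
  set ε : ℝ := 3 * (Fintype.card ι : ℝ) * θ with hεd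
  have hε0 : 0 ≤ ε := by rw [hεd]; positivity
  have cen : ∀ g : (ι → ℤ) → ℝ, ip N w (g + (-(ip N w g 1 / W)) • 1) 1 = 0 ∧
      ip N w (g + (-(ip N w g 1 / W)) • 1) (g + (-(ip N w g 1 / W)) • 1) =
        ip N w g g - ip N w g 1 ^ 2 / W ∧
      En N h w (g + (-(ip N w g 1 / W)) • 1) (g + (-(ip N w g 1 / W)) • 1) = En N h w g g := by
    intro g
    refine ⟨?_, ?_, ?_⟩
    · rw [ip_add, ip_smul, ← hW]; field_simp; ring
    · simp only [ip_add, ip_add', ip_smul, ip_smul', ← hW]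
      rw [ip_comm 1 g]; field_simp; ring
    · unfold En; simp only [D_add, D_smul, D_one, smul_zero, add_zero]
  obtain ⟨c1, c2, c3⟩ := cen g
  rw [← c2, ← c3]
  set g₀ := g + (-(ip N w g 1 / W)) • 1
  by_cases hz : ip N w g₀ g₀ = 0
  · rw [hz, mul_zero]; exact En_nonneg hw _
  obtain ⟨f, l, lpos, f1, f2, feig, fmin⟩ := exists_eig hh hw g₀ c1 hz
  suffices hll : l1 ≤ l from
    (mlR hll (ip_nonneg hw _)).trans (fmin _ c1)
  by_contra! hlt
  have Ef : En N h w f f = l := by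
    have : ip N w f (Lap N h w f) = En N h w f f := ip_Lap hw f f
    rw [← this, ip_congr (fun _ _ => rfl) (g' := l • f) (fun x hx => by simp [feig x hx]), ip_smul', f2, mul_one]
  have Lf : ip N w (Lap N h w f) (Lap N h w f) = l ^ 2 := by
    rw [ip_congr (f' := l • f) (fun x hx => by simp [feig x hx]) (g' := l • f) (fun x hx => by simp [feig x hx]),
      ip_smul, ip_smul', f2]; ring
  have bo := bochner_le hh hw hw2 ha hH hpos h1 hd hθ f
  rw [Lf, ← hεd] at bo
  change _ + _ * En N h w f f ≤ _ at bo
  rw [Ef] at bo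
  set b : ι → ℝ := fun i => ip N w (D N h i f) 1 with hb
  have pi : ∀ i, l * (ip N w (D N h i f) (D N h i f) - b i ^ 2 / W) ≤
      ∑ j, ip N w (D N h j (D N h i f)) (D N h j (D N h i f)) := by
    intro i
    obtain ⟨c1, c2, c3⟩ := cen (D N h i f)
    have := fmin _ c1
    rw [c2, c3] at this
    exact this
  have pis : l * (l - (∑ i, b i ^ 2) / W) ≤
      ∑ i, ∑ j, ip N w (D N h j (D N h i f)) (D N h j (D N h i f)) := by
    refine le_trans (le_of_eq ?_) (sum_le_sum fun i _ => pi i)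
    rw [← mul_sum, sum_sub_distrib, sum_div]
    congr 2
    exact Ef.symm
  set F : (ι → ℤ) → ℝ := fun x => ∑ i, b i * (h * x i) with hF
  have DF : ∀ i, ∀ x, x + ee i ∈ bx ι N → D N h i F x = b i := by
    intro i x hx
    rw [D_pos _ _ _ hx, hF]
    simp only [← sum_sub_distrib]
    rw [Finset.sum_eq_single i]
    · simp [ee]; field_simp; ring
    · intro j _ hj; simp [ee, hj]
    · simp
  have bb : ∑ i, b i ^ 2 = l * ip N w F f := by
    have e1 : ip N w F (Lap N h w f) = l * ip N w F f := by
      rw [← ip_smul']; exact ip_congr (fun _ _ => rfl) (fun x hx => by simp [feig x hx])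
    rw [← e1, ip_Lap hw]
    refine sum_congr rfl fun i _ => ?_
    rw [pow_two]; conv_lhs => rw [hb]
    simp only []
    rw [← ip_smul', ip_comm]
    refine sum_congr rfl fun x _ => ?_
    by_cases hx : x + ee i ∈ bx ι N
    · rw [DF i x hx]; simp [hb]
    · rw [D_zero i f x hx]; simp
  set B := ∑ i, b i ^ 2 with hB
  have B0 : 0 ≤ B := sum_nonneg fun i _ => sq_nonneg _
  have cs : (ip N w F f) ^ 2 ≤ a * W * B := by
    refine le_trans ?_ (hcov b)
    obtain ⟨c1, c2, _⟩ := cen F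
    change _ ≤ ip N w F F - ip N w F 1 ^ 2 / W
    rw [← c2]
    set F0 := F + (-(ip N w F 1 / W)) • 1
    have e1 : ip N w F0 f = ip N w F f := by
      rw [ip_add, ip_smul, ip_comm 1 f, f1, mul_zero, add_zero]
    rw [← e1]
    have := ip_nonneg (N := N) hw (F0 + (-(ip N w F0 f)) • f)
    simp only [ip_add, ip_add', ip_smul, ip_smul', f2] at this
    rw [ip_comm f F0] at this
    nlinarith
  exact absurd hl (not_lt.2 (gap_arith W0 B0 lpos ha0 hε0 hε hlt bb cs pis bo))
end
section
variable {ι : Type} [Fintype ι] [DecidableEq ι]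
def er (i : ι) : ι → ℝ := Pi.single i 1
def sc (h : ℝ) (x : ι → ℤ) : ι → ℝ := fun i => h * x i
lemma sc_add (h : ℝ) (x : ι → ℤ) (i : ι) : sc h (x + ee i) = sc h x + h • er i := by
  funext j
  by_cases hj : j = i
  · subst hj; simp [sc, er, ee]; ring
  · simp [sc, er, ee, hj]
lemma sc_sub (h : ℝ) (x : ι → ℤ) (i : ι) : sc h (x - ee i) = sc h x - h • er i := by
  funext j
  by_cases hj : j = i
  · subst hj; simp [sc, er, ee]; ring
  · simp [sc, er, ee, hj]
structure IsPot (V : (ι → ℝ) → ℝ) (g : ι → (ι → ℝ) → ℝ) (H : ι → ι → (ι → ℝ) → ℝ) : Prop where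
  d1 : ∀ x j, HasDerivAt (fun s : ℝ => V (x + s • er j)) (g j x) 0
  d2 : ∀ x i j, HasDerivAt (fun s : ℝ => g j (x + s • er i)) (H i j x) 0
  cg : ∀ j, Continuous (g j)
  cH : ∀ i j, Continuous (H i j)
lemma shift_deriv {F G : (ι → ℝ) → ℝ} {e : ι → ℝ}
    (hd : ∀ x, HasDerivAt (fun s : ℝ => F (x + s • e)) (G x) 0) (x : ι → ℝ) (s : ℝ) :
    HasDerivAt (fun s : ℝ => F (x + s • e)) (G (x + s • e)) s := by
  have h1 := hd (x + s • e)
  have h2 : HasDerivAt (fun r : ℝ => r - s) 1 s := (hasDerivAt_id s).sub_const s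
  have h3 : HasDerivAt (fun s' : ℝ => F (x + s • e + s' • e)) (G (x + s • e)) ((fun r : ℝ => r - s) s) := by
    simpa using h1
  have h4 := HasDerivAt.comp (h := fun r : ℝ => r - s) s h3 h2
  simp only [mul_one] at h4
  refine h4.congr_of_eventuallyEq (Filter.Eventually.of_forall fun r => ?_)
  simp only [Function.comp]
  congr 1
  rw [add_assoc, ← add_smul]; congr 2; ring
lemma er_norm (i : ι) : ‖(er i : ι → ℝ)‖ ≤ 1 := by
  rw [er, pi_norm_le_iff_of_nonneg (by norm_num)]
  intro j
  by_cases hj : j = i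
  · subst hj; simp
  · simp [hj]
variable {V : (ι → ℝ) → ℝ} {g : ι → (ι → ℝ) → ℝ} {H : ι → ι → (ι → ℝ) → ℝ}
lemma pot_mvt1 {F G : (ι → ℝ) → ℝ} {e : ι → ℝ}
    (hd : ∀ x, HasDerivAt (fun s : ℝ => F (x + s • e)) (G x) 0) (x : ι → ℝ) {h : ℝ} (hh : 0 < h) :
    ∃ s ∈ Set.Icc 0 h, F (x + h • e) - F x = h * G (x + s • e) := by
  obtain ⟨s, hs, e1⟩ := exists_hasDerivAt_eq_slope (fun s : ℝ => F (x + s • e)) (fun s => G (x + s • e)) hh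
    (fun s _ => (shift_deriv hd x s).continuousAt.continuousWithinAt) (fun s _ => shift_deriv hd x s)
  refine ⟨s, ⟨hs.1.le, hs.2.le⟩, ?_⟩
  rw [e1]; simp; field_simp
lemma pot_unif (hV : IsPot V g H) (R θ : ℝ) (hθ : 0 < θ) :
    ∃ C : ℝ, 0 ≤ C ∧ (∀ x : ι → ℝ, ‖x‖ ≤ R → ∀ i j, |H i j x| ≤ C) ∧
    ∃ h0 > 0, ∀ h, 0 < h → h < h0 → ∀ N : ℕ, h * N ≤ R →
    (∀ x ∈ bx ι N, ∀ i, x + ee i ∈ bx ι N →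
      exp (-V (sc h (x + ee i))) ≤ 2 * exp (-V (sc h x))) ∧
    (∀ x ∈ bx ι N, ∀ i j, x - ee i ∈ bx ι N → x + ee j ∈ bx ι N →
      |cc N h (fun x => exp (-V (sc h x))) i j x - H i j (sc h x)| ≤ θ) := by
  have cpt : IsCompact (Metric.closedBall (0 : ι → ℝ) (R + 2)) := isCompact_closedBall _ _
  have bd : ∀ F : (ι → ℝ) → ℝ, Continuous F → ∃ C : ℝ, 0 ≤ C ∧
      ∀ x ∈ Metric.closedBall (0 : ι → ℝ) (R + 2), |F x| ≤ C := by
    intro F hF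
    obtain ⟨C, hC⟩ := cpt.exists_bound_of_continuousOn hF.continuousOn
    exact ⟨max C 0, le_max_right _ _, fun x hx => (hC x hx).trans (le_max_left _ _)⟩
  choose CH hCH0 hCH using fun p : ι × ι => bd (H p.1 p.2) (hV.cH p.1 p.2)
  choose Cg hCg0 hCg using fun j : ι => bd (g j) (hV.cg j)
  set C := ∑ p, CH p with hC
  set G := ∑ j, Cg j with hG
  have C0 : 0 ≤ C := sum_nonneg fun p _ => hCH0 p
  have G0 : 0 ≤ G := sum_nonneg fun p _ => hCg0 p
  have bH : ∀ x ∈ Metric.closedBall (0 : ι → ℝ) (R + 2), ∀ i j, |H i j x| ≤ C := fun x hx i j =>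
    (hCH (i, j) x hx).trans (single_le_sum (fun p _ => hCH0 p) (Finset.mem_univ (i, j)))
  have bg : ∀ x ∈ Metric.closedBall (0 : ι → ℝ) (R + 2), ∀ j, |g j x| ≤ G := fun x hx j =>
    (hCg j x hx).trans (single_le_sum (fun p _ => hCg0 p) (Finset.mem_univ j))
  have uc : ∀ p : ι × ι, ∃ δ > 0, ∀ x ∈ Metric.closedBall (0 : ι → ℝ) (R + 2),
      ∀ y ∈ Metric.closedBall (0 : ι → ℝ) (R + 2), dist x y < δ →
      dist (H p.1 p.2 x) (H p.1 p.2 y) < θ / 2 := fun p =>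
    Metric.uniformContinuousOn_iff.1
      (cpt.uniformContinuousOn_of_continuous (hV.cH p.1 p.2).continuousOn) _ (half_pos hθ)
  choose δ δ0 hδ using uc
  obtain ⟨δ1, δ10, hδ1⟩ : ∃ δ1 > 0, ∀ p, δ1 ≤ δ p := by
    rcases isEmpty_or_nonempty (ι × ι) with hE | hN
    · exact ⟨1, one_pos, fun p => hE.elim p⟩
    · refine ⟨Finset.univ.inf' Finset.univ_nonempty δ, ?_, fun p => Finset.inf'_le _ (Finset.mem_univ p)⟩
      exact (Finset.lt_inf'_iff _).2 fun p _ => δ0 p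
  refine ⟨C, C0, fun x hx i j => bH x (by simpa using hx.trans (by linarith)) i j, 
    min (min 1 (δ1 / 2)) (min (1 / (2 * (G + 1))) (θ / (4 * (G + 1) * (C + 1)))), by positivity, ?_⟩
  intro h hh hlt N hN
  simp only [lt_min_iff] at hlt
  obtain ⟨⟨l1, l2⟩, l3, l4⟩ := hlt
  rw [lt_div_iff₀ (by positivity)] at l3 l4
  have scn : ∀ x ∈ bx ι N, ‖sc h x‖ ≤ R := by
    intro x hx
    refine le_trans ((pi_norm_le_iff_of_nonneg (by positivity)).2 fun i => ?_) hN
    have := mem_bx.1 hx i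
    rw [sc, Real.norm_eq_abs, abs_mul, abs_of_pos hh]
    gcongr
    rw [abs_le]; constructor
    · exact_mod_cast this.1
    · exact_mod_cast this.2
  have nrm : ∀ s ∈ Set.Icc 0 h, ∀ i : ι, ‖s • er i‖ ≤ h := by
    intro s hs i
    rw [norm_smul, Real.norm_eq_abs, abs_of_nonneg hs.1]
    have := er_norm i
    nlinarith [hs.1, hs.2, norm_nonneg (er i : ι → ℝ)]
  have gs : ∀ y : ι → ℝ, ‖y‖ ≤ R + 2 → ∀ i, |h * g i y| ≤ h * G := by
    intro y hy i
    rw [abs_mul, abs_of_pos hh]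
    exact mlL (bg y (by simpa using hy) i) hh.le
  have hG2 : h * G ≤ 1 / 2 := by nlinarith
  have ex : ∀ z : ℝ, |z| ≤ h * G → |exp z - 1| ≤ 2 * (h * G) := by
    intro z hz
    exact (Real.abs_exp_sub_one_le (by linarith)).trans (by linarith)
  constructor
  · intro x hx i hi
    obtain ⟨s, hs, e1⟩ := pot_mvt1 (fun x => hV.d1 x i) (sc h x) hh
    rw [sc_add]
    have e2 : -V (sc h x + h • er i) = -(h * g i (sc h x + s • er i)) + -V (sc h x) := by linarith
    rw [e2, exp_add]
    refine mlR ?_ (exp_pos _).le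
    have nn : ‖sc h x + s • er i‖ ≤ R + 2 := by
      have := norm_add_le (sc h x) (s • er i); have := scn x hx; have := nrm s hs i; linarith
    have := abs_le.1 (ex (-(h * g i (sc h x + s • er i))) (by rw [abs_neg]; exact gs _ nn i))
    linarith
  · intro x hx i j hi hj
    have m2 : x + ee j - ee i ∈ bx ι N := by
      by_cases hij : i = j
      · subst hij; rwa [add_sub_cancel_right]
      · rw [mem_sub hj]
        rw [mem_sub hx] at hi
        simpa [ee, hij] using hi
    set X := sc h x with hX
    set Y := X - h • er i with hY
    set ρ : (ι → ℝ) → ℝ := fun z => exp (V (z + h • er i) - V z) with hρ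
    have rx : rr N (fun x => exp (-V (sc h x))) i x = ρ Y := by
      rw [rr, if_pos hi, ← Real.exp_sub, sc_sub, hρ]
      simp only [← hX, hY, sub_add_cancel]; congr 1; ring
    have rx2 : rr N (fun x => exp (-V (sc h x))) i (x + ee j) = ρ (Y + h • er j) := by
      rw [rr, if_pos m2, ← Real.exp_sub, sc_sub, sc_add, hρ]
      simp only [← hX, hY]
      have q : X - h • er i + h • er j + h • er i = X + h • er j := by abel
      have q2 : X + h • er j - h • er i = X - h • er i + h • er j := by abel
      rw [q, q2]; congr 1; ring
    have dρ : ∀ z, HasDerivAt (fun s : ℝ => ρ (z + s • er j)) (ρ z * (g j (z + h • er i) - g j z)) 0 := by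
      intro z
      have a1 := hV.d1 (z + h • er i) j
      have a2 := hV.d1 z j
      have a3 : HasDerivAt (fun s : ℝ => V (z + s • er j + h • er i)) (g j (z + h • er i)) 0 := by
        refine a1.congr_of_eventuallyEq (Filter.Eventually.of_forall fun r => ?_)
        simp only; congr 1; abel
      have := (a3.sub a2).exp
      simpa [hρ] using this
    obtain ⟨s, hs, e1⟩ := pot_mvt1 dρ Y hh
    obtain ⟨r, hr, e2⟩ := pot_mvt1 (fun x => hV.d2 x i j) (Y + s • er j) hh
    obtain ⟨q, hq, e3⟩ := pot_mvt1 (fun x => hV.d1 x i) (Y + s • er j) hh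
    have hcc : cc N h (fun x => exp (-V (sc h x))) i j x
        = ρ (Y + s • er j) * H i j (Y + s • er j + r • er i) := by
      rw [cc, rx, rx2, e1, e2]; field_simp
    have nX := scn x hx
    rw [← hX] at nX
    have near : ∀ r ∈ Set.Icc 0 h, ‖Y + s • er j + r • er i - X‖ ≤ 2 * h := by
      intro r hr
      have q : Y + s • er j + r • er i - X = s • er j - (h - r) • er i := by
        rw [hY, sub_smul]; abel
      have n1 := nrm s hs j
      have n2 := nrm (h - r) ⟨by linarith [hr.2], by linarith [hr.1]⟩ i
      have := norm_sub_le (s • er j : ι → ℝ) ((h - r) • er i)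
      rw [q]; linarith
    have tri : ∀ r ∈ Set.Icc 0 h, ‖Y + s • er j + r • er i‖ ≤ R + 2 := by
      intro r hr
      have := near r hr
      have := norm_le_norm_add_norm_sub X (Y + s • er j + r • er i)
      rw [norm_sub_rev] at this
      linarith
    have tri2 : dist (Y + s • er j + r • er i) X < δ1 := by
      rw [dist_eq_norm]; have := near r hr; linarith
    have ρ1 : |ρ (Y + s • er j) - 1| ≤ 2 * (h * G) := by
      rw [hρ]; simp only; rw [e3]
      exact ex _ (gs _ (tri q hq) i)
    rw [hcc]
    have b1 := bH _ (by simpa using tri r hr) i j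
    have b2 := hδ (i, j) (Y + s • er j + r • er i) (by simpa using tri r hr) X
      (by simpa using nX.trans (by linarith)) (tri2.trans_le (hδ1 _))
    rw [Real.dist_eq] at b2
    have b3 : |(ρ (Y + s • er j) - 1) * H i j (Y + s • er j + r • er i)| ≤ 2 * (h * G) * C := by
      rw [abs_mul]; exact mul_le_mul ρ1 b1 (abs_nonneg _) (by positivity)
    have b4 : 2 * (h * G) * C ≤ θ / 2 := by
      have : h * (4 * (G + 1) * (C + 1)) = 4 * (h * G * C) + 4 * (h * G) + 4 * (h * C) + 4 * h := by ring
      have := mul_nonneg hh.le G0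
      have := mul_nonneg hh.le C0
      linarith
    simp only at b2
    have := abs_le.1 b3
    have := abs_lt.1 b2
    rw [abs_le]; constructor <;> nlinarith
end
section
variable {ι : Type} [Fintype ι] [DecidableEq ι]
lemma mem_ball_iff (R : ℝ) (hR : 0 ≤ R) (x : ι → ℝ) :
    x ∈ Metric.closedBall (0 : ι → ℝ) R ↔ ∀ i, |x i| ≤ R := by
  rw [mem_closedBall_zero_iff, pi_norm_le_iff_of_nonneg hR]; simp
lemma riemann (R : ℕ) (F : (ι → ℝ) → ℝ) (hF : Continuous F) :
    Tendsto (fun n : ℕ => (∑ x ∈ bx ι (R * n), F (sc (1 / n) x)) / (n : ℝ) ^ Fintype.card ι) atTop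
      (𝓝 (∫ x in Metric.closedBall (0 : ι → ℝ) R, F x)) := by
  have h := tendsto_tsum_div_pow_atTop_integral (Metric.closedBall (0 : ι → ℝ) R) F hF
    Metric.isBounded_closedBall Metric.isClosed_closedBall.measurableSet
    ((convex_closedBall (0 : ι → ℝ) (R:ℝ)).addHaar_frontier volume)
  refine h.congr' ?_
  filter_upwards [eventually_gt_atTop 0] with n hn
  have hn' : (0:ℝ) < n := by exact_mod_cast hn
  congr 1
  have inj : Set.InjOn (sc (1 / (n:ℝ))) (bx ι (R * n) : Set (ι → ℤ)) := by
    intro x _ y _ hxy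
    funext i
    have := congrFun hxy i
    simp only [sc] at this
    have h2 := mul_left_cancel₀ (by positivity : (1 / (n:ℝ)) ≠ 0) this
    exact_mod_cast h2
  have hset : Metric.closedBall (0 : ι → ℝ) R ∩ (n : ℝ)⁻¹ • (Submodule.span ℤ (Set.range (Pi.basisFun ℝ ι)) : Set (ι → ℝ))
      = ((bx ι (R * n)).image (sc (1 / (n:ℝ))) : Finset (ι → ℝ)) := by
    ext z
    simp only [Set.mem_inter_iff, Finset.coe_image, Set.mem_image, Finset.mem_coe]
    rw [Set.mem_smul_set, mem_ball_iff _ (by positivity)]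
    constructor
    · rintro ⟨hz, y, hy, rfl⟩
      have hy' := hy
      rw [SetLike.mem_coe, (Pi.basisFun ℝ ι).mem_span_iff_repr_mem ℤ] at hy'
      choose k hk using hy'
      simp at hk
      refine ⟨k, ?_, ?_⟩
      · rw [mem_bx]; intro i
        have := hz i
        simp only [Pi.smul_apply, smul_eq_mul, ← hk i, abs_mul, abs_inv, Nat.abs_cast] at this
        rw [inv_mul_le_iff₀ hn'] at this
        have h3 := abs_le.1 this
        constructor
        · have : (-((R * n : ℕ) : ℤ) : ℝ) ≤ (k i : ℝ) := by push_cast; linarith [h3.1]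
          exact_mod_cast this
        · have : (k i : ℝ) ≤ ((R * n : ℕ) : ℤ) := by push_cast; linarith [h3.2]
          exact_mod_cast this
      · funext i; simp [sc, hk i]
    · rintro ⟨k, hk, rfl⟩
      refine ⟨fun i => ?_, fun i => (k i : ℝ), ?_, ?_⟩
      · have := mem_bx.1 hk i
        simp only [sc, abs_mul, abs_of_pos (by positivity : 0 < 1 / (n:ℝ))]
        rw [one_div, inv_mul_le_iff₀ hn', abs_le]
        constructor
        · have := this.1; rw [mul_comm]; exact_mod_cast this
        · have := this.2; rw [mul_comm]; exact_mod_cast this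
      · rw [SetLike.mem_coe, (Pi.basisFun ℝ ι).mem_span_iff_repr_mem ℤ]
        intro i; exact ⟨k i, by simp⟩
      · funext i; simp [sc]
  rw [← Finset.sum_image (f := F) inj, ← Finset.tsum_subtype]
  exact tsum_congr_set_coe F hset
lemma cov_event {c : ℕ → ι → ι → ℝ} {c0 : ι → ι → ℝ} {A : ℕ → ℝ} {A0 A1 : ℝ}
    (hc : ∀ i j, Tendsto (fun k => c k i j) atTop (𝓝 (c0 i j))) (hA : Tendsto A atTop (𝓝 A0))
    (hlt : A1 < A0) (h0 : ∀ v : ι → ℝ, ∑ i, ∑ j, v i * v j * c0 i j ≤ A1 * ∑ i, v i ^ 2) :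
    ∀ᶠ k in atTop, ∀ v : ι → ℝ, ∑ i, ∑ j, v i * v j * c k i j ≤ A k * ∑ i, v i ^ 2 := by
  have e1 : Tendsto (fun k => ∑ i, ∑ j, |c k i j - c0 i j|) atTop (𝓝 0) := by
    have : Tendsto (fun k => ∑ i, ∑ j, |c k i j - c0 i j|) atTop (𝓝 (∑ i : ι, ∑ j : ι, |c0 i j - c0 i j|)) :=
      tendsto_finsetSum _ fun i _ => tendsto_finsetSum _ fun j _ => ((hc i j).sub_const _).abs
    simpa using this
  have e2 : Tendsto (fun k => A k - ∑ i, ∑ j, |c k i j - c0 i j|) atTop (𝓝 (A0 - 0)) := hA.sub e1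
  rw [sub_zero] at e2
  filter_upwards [e2.eventually (lt_mem_nhds hlt)] with k hk v
  have b : ∀ i j, v i * v j * (c k i j - c0 i j) ≤ (∑ i, v i ^ 2) * |c k i j - c0 i j| := by
    intro i j
    have hvi := single_le_sum (f := fun i => v i ^ 2) (fun i _ => sq_nonneg (v i)) (Finset.mem_univ i)
    have hvj := single_le_sum (f := fun i => v i ^ 2) (fun i _ => sq_nonneg (v i)) (Finset.mem_univ j)
    have : |v i * v j| ≤ ∑ i, v i ^ 2 := by
      rw [abs_le]; constructor <;> nlinarith [sq_nonneg (v i + v j), sq_nonneg (v i - v j)]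
    calc _ ≤ |v i * v j * (c k i j - c0 i j)| := le_abs_self _
      _ = |v i * v j| * |c k i j - c0 i j| := abs_mul _ _
      _ ≤ _ := mlR this (abs_nonneg _)
  have s := sum_le_sum fun i (_ : i ∈ Finset.univ) => sum_le_sum fun j (_ : j ∈ Finset.univ) => b i j
  simp only [mul_sub, sum_sub_distrib, ← mul_sum] at s
  have := h0 v
  have v0 : 0 ≤ ∑ i, v i ^ 2 := sum_nonneg fun i _ => sq_nonneg _
  nlinarith
def qf (H : ι → ι → ℝ) (q : ι → ℝ) (x : ι → ℝ) : ℝ := ∑ i, ∑ j, H i j * x i * x j + ∑ i, q i * x i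
def dq (H : ι → ι → ℝ) (q : ι → ℝ) (i : ι) (x : ι → ℝ) : ℝ := ∑ j, (H i j + H j i) * x j + q i
lemma qf_cont (H : ι → ι → ℝ) (q : ι → ℝ) : Continuous (qf H q) := by unfold qf; fun_prop
lemma dq_cont (H : ι → ι → ℝ) (q : ι → ℝ) (i : ι) : Continuous (dq H q i) := by unfold dq; fun_prop
def covT (T : ((ι → ℝ) → ℝ) → ℝ) (i j : ι) : ℝ :=
  T (fun x => x i * x j) * T 1 - T (fun x => x i) * T (fun x => x j)
def PIf (t : ℝ) (T : ((ι → ℝ) → ℝ) → ℝ) : Prop :=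
  ∀ a l1 : ℝ, 0 ≤ a → 0 ≤ l1 →
    (∀ v : ι → ℝ, ∑ i, ∑ j, v i * v j * covT T i j ≤ a * T 1 ^ 2 * ∑ i, v i ^ 2) → l1 ^ 2 * a < t →
    ∀ H q, l1 * (T (fun x => qf H q x ^ 2) * T 1 - T (qf H q) ^ 2) ≤ T 1 * T (fun x => ∑ i, dq H q i x ^ 2)
lemma exists_bigger {a l1 t : ℝ} (h : l1 ^ 2 * a < t) : ∃ a' > a, l1 ^ 2 * a' < t := by
  refine ⟨a + (t - l1 ^ 2 * a) / (2 * (l1 ^ 2 + 1)), ?_, ?_⟩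
  · have : 0 < (t - l1 ^ 2 * a) / (2 * (l1 ^ 2 + 1)) := by apply div_pos <;> [linarith; positivity]
    linarith
  · have : l1 ^ 2 * ((t - l1 ^ 2 * a) / (2 * (l1 ^ 2 + 1))) ≤ (t - l1 ^ 2 * a) / 2 := by
      rw [mul_div_assoc', div_le_div_iff₀ (by positivity) (by norm_num)]
      nlinarith [sq_nonneg l1]
    nlinarith
lemma covT_lim {T : ℕ → ((ι → ℝ) → ℝ) → ℝ} {T0 : ((ι → ℝ) → ℝ) → ℝ}
    (hT : ∀ F : (ι → ℝ) → ℝ, Continuous F → Tendsto (fun k => T k F) atTop (𝓝 (T0 F))) (i j : ι) :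
    Tendsto (fun k => covT (T k) i j) atTop (𝓝 (covT T0 i j)) := by
  unfold covT
  exact ((hT _ (by fun_prop)).mul (hT _ continuous_const)).sub ((hT _ (by fun_prop)).mul (hT _ (by fun_prop)))
lemma PIf_lim {t : ℝ} {T : ℕ → ((ι → ℝ) → ℝ) → ℝ} {T0 : ((ι → ℝ) → ℝ) → ℝ}
    (hT : ∀ F : (ι → ℝ) → ℝ, Continuous F → Tendsto (fun k => T k F) atTop (𝓝 (T0 F)))
    (h1 : 0 < T0 1) (hP : ∀ k, PIf t (T k)) : PIf t T0 := by
  intro a l1 ha hl hc hlt H q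
  obtain ⟨a', ha', hlt'⟩ := exists_bigger hlt
  have T1 : Tendsto (fun k => T k 1) atTop (𝓝 (T0 1)) := hT _ continuous_const
  have ev := cov_event (covT_lim hT) ((T1.pow 2).const_mul a')
    (mul_lt_mul_of_pos_right ha' (by positivity)) hc
  refine le_of_tendsto_of_tendsto (f := fun k => l1 * (T k (fun x => qf H q x ^ 2) * T k 1 - T k (qf H q) ^ 2))
    (g := fun k => T k 1 * T k (fun x => ∑ i, dq H q i x ^ 2)) ?_ ?_ ?_ (b := atTop)
  · exact (((hT _ ((qf_cont H q).pow 2)).mul T1).sub ((hT _ (qf_cont H q)).pow 2)).const_mul l1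
  · exact T1.mul (hT _ (continuous_finsetSum _ fun i _ => (dq_cont H q i).pow 2))
  · filter_upwards [ev] with k hk
    exact hP k a' l1 (ha.trans ha'.le) hl hk hlt' H q
lemma qf_add (H : ι → ι → ℝ) (q : ι → ℝ) (x : ι → ℝ) (h : ℝ) (i : ι) :
    qf H q (x + h • er i) - qf H q x = h * (dq H q i x + h * H i i) := by
  have e : ∀ k, (x + h • er i) k = x k + if k = i then h else 0 := by
    intro k; by_cases hk : k = i
    · subst hk; simp [er]
    · simp [er, hk]
  unfold qf dq
  simp only [e, mul_add, add_mul, sum_add_distrib, mul_ite, ite_mul, mul_zero, zero_mul,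
    Finset.sum_ite_eq', Finset.mem_univ, if_true]
  have e2 : ∀ x_1 : ι, (∑ j, if x_1 = i then H x_1 j * h * x j else 0) = if x_1 = i then ∑ j, H x_1 j * h * x j else 0 := by
    intro k; split_ifs <;> simp
  simp only [e2, Finset.sum_ite_eq', Finset.mem_univ, if_true, mul_sum]
  have e3 : ∑ k, h * (H k i * x k) = ∑ k, H k i * x k * h := sum_congr rfl fun _ _ => by ring
  have e4 : ∑ k, h * (H i k * x k) = ∑ k, H i k * h * x k := sum_congr rfl fun _ _ => by ring
  rw [e3, e4]; ring
variable {V : (ι → ℝ) → ℝ} {g : ι → (ι → ℝ) → ℝ} {H : ι → ι → (ι → ℝ) → ℝ}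
lemma PIf_pot (hV : IsPot V g H) (hVc : Continuous V) {t : ℝ}
    (hpos : ∀ x, ∀ v : ι → ℝ, t * ∑ i, v i ^ 2 ≤ ∑ i, ∑ j, H i j x * v i * v j) (R : ℕ) (hR : 0 < R) :
    PIf t (fun F => ∫ x in Metric.closedBall (0 : ι → ℝ) R, F x * exp (-V x)) := by
  intro a l1 ha hl hc hlt Hq q
  set T0 : ((ι → ℝ) → ℝ) → ℝ := fun F => ∫ x in Metric.closedBall (0 : ι → ℝ) R, F x * exp (-V x) with hT0
  set w : ℕ → (ι → ℤ) → ℝ := fun n x => exp (-V (sc (1 / n) x)) with hw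
  set T : ℕ → ((ι → ℝ) → ℝ) → ℝ := fun n F =>
    (∑ x ∈ bx ι (R * n), F (sc (1 / n) x) * exp (-V (sc (1 / n) x))) / (n : ℝ) ^ Fintype.card ι with hT
  have hlim : ∀ F : (ι → ℝ) → ℝ, Continuous F → Tendsto (fun k => T k F) atTop (𝓝 (T0 F)) := fun F hF =>
    riemann R (fun x => F x * exp (-V x)) (by fun_prop)
  have T1 : Tendsto (fun k => T k 1) atTop (𝓝 (T0 1)) := hlim _ continuous_const
  have h1 : 0 < T0 1 := by
    simp only [hT0, Pi.one_apply, one_mul]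
    have hint : IntegrableOn (fun x => exp (-V x)) (Metric.closedBall (0 : ι → ℝ) R) :=
      (Real.continuous_exp.comp hVc.neg).continuousOn.integrableOn_compact (isCompact_closedBall _ _)
    rw [setIntegral_pos_iff_support_of_nonneg_ae (Eventually.of_forall fun x => (exp_pos _).le) hint]
    have : Function.support (fun x => exp (-V x)) = Set.univ := by
      ext x; simp [(exp_pos _).ne']
    rw [this, Set.univ_inter]
    exact Metric.measure_closedBall_pos _ _ (by exact_mod_cast hR)
  obtain ⟨a', ha', hlt'⟩ := exists_bigger hlt
  have ev := cov_event (covT_lim hlim) ((T1.pow 2).const_mul a')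
    (mul_lt_mul_of_pos_right ha' (by positivity)) hc
  set d : ℝ := (Fintype.card ι : ℝ) with hd
  have d0 : 0 ≤ d := by rw [hd]; positivity
  set θ : ℝ := min 1 (t - l1 ^ 2 * a') / (3 * (d + 1) * (l1 + 2)) with hθ
  have m0 : 0 < min 1 (t - l1 ^ 2 * a') := lt_min one_pos (by linarith)
  have θ0 : 0 < θ := by rw [hθ]; positivity
  have hθ1 : θ * (3 * (d + 1) * (l1 + 2)) = min 1 (t - l1 ^ 2 * a') := by
    rw [hθ]; field_simp
  have hθ2 : θ * (3 * (d + 1) * (l1 + 2)) = 3 * d * θ * l1 + 6 * d * θ + 3 * θ * l1 + 6 * θ := by ring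
  have p1 := mul_nonneg d0 θ0.le
  have p2 := mul_nonneg θ0.le hl
  have p3 := mul_nonneg p1 hl
  have ma := min_le_left 1 (t - l1 ^ 2 * a')
  have mb := min_le_right 1 (t - l1 ^ 2 * a')
  have hε1 : 3 * d * θ ≤ 1 := by linarith
  have hε2 : 3 * d * θ * l1 + l1 ^ 2 * a' < t - 3 * d * θ := by linarith
  obtain ⟨C, C0, hC, h0, h0p, hg⟩ := pot_unif hV R θ θ0
  have inv0 : Tendsto (fun n : ℕ => (1:ℝ) / n) atTop (𝓝 0) := tendsto_one_div_atTop_nhds_zero_nat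
  have ev1 : ∀ᶠ n : ℕ in atTop, (1:ℝ) / n < h0 := inv0.eventually (gt_mem_nhds h0p)
  have ev2 : ∀ᶠ n : ℕ in atTop, (1:ℝ) / n * (C + θ) < θ := by
    have := inv0.mul_const (C + θ); rw [zero_mul] at this
    exact this.eventually (gt_mem_nhds θ0)
  have ev3 : ∀ᶠ n : ℕ in atTop, C ^ 2 * d * ((1:ℝ) / n) ^ 2 < 2 * θ := by
    have := (inv0.pow 2).const_mul (C ^ 2 * d)
    rw [zero_pow two_ne_zero, mul_zero] at this
    exact this.eventually (gt_mem_nhds (by linarith))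
  have lhs : Tendsto (fun k => l1 * (T k (fun x => qf Hq q x ^ 2) * T k 1 - T k (qf Hq q) ^ 2)) atTop
      (𝓝 (l1 * (T0 (fun x => qf Hq q x ^ 2) * T0 1 - T0 (qf Hq q) ^ 2))) :=
    (((hlim _ ((qf_cont Hq q).pow 2)).mul T1).sub ((hlim _ (qf_cont Hq q)).pow 2)).const_mul l1
  have rhs : Tendsto (fun k : ℕ => T k 1 * (T k (fun x => ∑ i, dq Hq q i x ^ 2) +
      (1 / (k:ℝ)) * (∑ i, (2 * Hq i i * T k (dq Hq q i) + (1 / (k:ℝ)) * Hq i i ^ 2 * T k 1)))) atTop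
      (𝓝 (T0 1 * (T0 (fun x => ∑ i, dq Hq q i x ^ 2) +
      0 * (∑ i, (2 * Hq i i * T0 (dq Hq q i) + 0 * Hq i i ^ 2 * T0 1))))) := by
    refine T1.mul ((hlim _ (continuous_finsetSum _ fun i _ => (dq_cont Hq q i).pow 2)).add
      (inv0.mul (tendsto_finsetSum _ fun i _ => ?_)))
    exact ((hlim _ (dq_cont Hq q i)).const_mul _).add ((inv0.mul_const _).mul T1)
  rw [zero_mul, add_zero] at rhs
  refine le_of_tendsto_of_tendsto lhs rhs ?_
  filter_upwards [ev, ev1, ev2, ev3, eventually_gt_atTop 0] with n hcn l1' l2' l3' hn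
  have hn' : (0:ℝ) < n := by exact_mod_cast hn
  set h : ℝ := 1 / (n:ℝ) with hh
  have hp : 0 < h := by positivity
  have hN : h * ((R * n : ℕ) : ℝ) ≤ R := by rw [hh]; push_cast; field_simp; exact le_rfl
  obtain ⟨g1, g2⟩ := hg h hp l1' (R * n) hN
  set P : ℝ := (n:ℝ) ^ Fintype.card ι with hP
  have P0 : 0 < P := by positivity
  have link : ∀ F G : (ι → ℝ) → ℝ, ip (R * n) (w n) (fun x => F (sc h x)) (fun x => G (sc h x)) =
      P * T n (fun x => F x * G x) := by
    intro F G
    simp only [hT, ip, hw, ← hh, ← hP]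
    rw [mul_div_cancel₀ _ P0.ne']
    exact sum_congr rfl fun x _ => by ring
  have link1 : ∀ F : (ι → ℝ) → ℝ, ip (R * n) (w n) (fun x => F (sc h x)) 1 = P * T n F := by
    intro F; have := link F 1; simp only [Pi.one_apply, mul_one] at this; exact this
  have linkW : ip (R * n) (w n) 1 1 = P * T n 1 := link1 1
  have Tsum : ∀ (s : Finset ι) (F : ι → (ι → ℝ) → ℝ), T n (fun x => ∑ i ∈ s, F i x) = ∑ i ∈ s, T n (F i) := by
    intro s F
    simp only [hT, ← sum_div]
    rw [sum_comm]
    simp only [sum_mul]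
  have Tmul : ∀ (c : ℝ) (F : (ι → ℝ) → ℝ), T n (fun x => c * F x) = c * T n F := by
    intro c F
    simp only [hT, mul_assoc, ← mul_sum, mul_div_assoc]
  have Tadd : ∀ (F G : (ι → ℝ) → ℝ), T n (fun x => F x + G x) = T n F + T n G := by
    intro F G
    simp only [hT, add_mul, sum_add_distrib, add_div]
  have Wp : 0 < T n 1 := by
    have := ip_one_pos (N := R * n) (w := w n) (fun x => exp_pos _)
    rw [linkW] at this
    exact (mul_pos_iff_of_pos_left P0).1 this
  have scN : ∀ x ∈ bx ι (R * n), ‖sc h x‖ ≤ R := by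
    intro x hx
    refine le_trans ((pi_norm_le_iff_of_nonneg (by positivity)).2 fun i => ?_) hN
    have := mem_bx.1 hx i
    rw [sc, Real.norm_eq_abs, abs_mul, abs_of_pos hp]
    gcongr
    rw [abs_le]; constructor
    · exact_mod_cast this.1
    · exact_mod_cast this.2
  have G := gap (N := R * n) (h := h) (w := w n) (H := fun x => Matrix.of fun i j => H i j (sc h x)) (C := C) (θ := θ) (t := t)
    (a := a') (l1 := l1) hp (fun x => exp_pos _) g1 g2 (fun x hx i j => hC _ (scN x hx) i j)
    (fun x _ v => hpos _ v) l2'.le l3'.le θ0.le (ha.trans ha'.le) (by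
      intro v
      have a1 := link (fun z : ι → ℝ => ∑ i, v i * z i) (fun z : ι → ℝ => ∑ i, v i * z i)
      have a2 := link1 (fun z : ι → ℝ => ∑ i, v i * z i)
      simp only [sc] at a1 a2
      rw [a1, a2, linkW]
      have e2 : T n (fun x => (∑ i, v i * x i) * ∑ i, v i * x i) = ∑ i, ∑ j, v i * v j * T n (fun x => x i * x j) := by
        have : (fun x : ι → ℝ => (∑ i, v i * x i) * ∑ i, v i * x i) = fun x => ∑ i, ∑ j, (v i * v j) * (x i * x j) := by
          funext x; rw [sum_mul_sum]
          exact sum_congr rfl fun i _ => sum_congr rfl fun j _ => by ring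
        rw [this, Tsum Finset.univ (fun i x => ∑ j, (v i * v j) * (x i * x j))]
        refine sum_congr rfl fun i _ => ?_
        rw [Tsum Finset.univ (fun j x => (v i * v j) * (x i * x j))]
        exact sum_congr rfl fun j _ => Tmul _ (fun x => x i * x j)
      have e3 : T n (fun x => ∑ i, v i * x i) = ∑ i, v i * T n (fun x => x i) := by
        rw [Tsum Finset.univ (fun i x => v i * x i)]
        exact sum_congr rfl fun i _ => Tmul _ (fun x => x i)
      have := hcn v
      have e4 : ∑ i, ∑ j, v i * v j * covT (T n) i j = T n (fun x => (∑ i, v i * x i) * ∑ i, v i * x i) * T n 1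
          - T n (fun x => ∑ i, v i * x i) ^ 2 := by
        rw [e2, e3, pow_two, sum_mul_sum, sum_mul, ← sum_sub_distrib]
        refine sum_congr rfl fun i _ => ?_
        rw [sum_mul, ← sum_sub_distrib]
        refine sum_congr rfl fun j _ => ?_
        unfold covT; ring
      rw [e4] at this
      have e5 : P * T n (fun x => (∑ i, v i * x i) * ∑ i, v i * x i) - (P * T n (fun x => ∑ i, v i * x i)) ^ 2 / (P * T n 1)
        = P / T n 1 * (T n (fun x => (∑ i, v i * x i) * ∑ i, v i * x i) * T n 1 - T n (fun x => ∑ i, v i * x i) ^ 2) := by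
        field_simp
      rw [e5]
      calc _ ≤ P / T n 1 * (a' * T n 1 ^ 2 * ∑ i, v i ^ 2) := mlL this (by positivity)
        _ = _ := by field_simp) hε1 hε2 (fun x => qf Hq q (sc h x))
  rw [link, link1, linkW] at G
  have En1 : En (R * n) h (w n) (fun x => qf Hq q (sc h x)) (fun x => qf Hq q (sc h x)) ≤
      P * (T n (fun x => ∑ i, dq Hq q i x ^ 2) +
      h * (∑ i, (2 * Hq i i * T n (dq Hq q i) + h * Hq i i ^ 2 * T n 1))) := by
    have e1 : T n (fun x => ∑ i, dq Hq q i x ^ 2) +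
      h * (∑ i, (2 * Hq i i * T n (dq Hq q i) + h * Hq i i ^ 2 * T n 1)) =
      ∑ i, T n (fun x => (dq Hq q i x + h * Hq i i) * (dq Hq q i x + h * Hq i i)) := by
      rw [Tsum Finset.univ (fun i x => dq Hq q i x ^ 2), mul_sum, ← sum_add_distrib]
      refine sum_congr rfl fun i _ => ?_
      have : (fun x => (dq Hq q i x + h * Hq i i) * (dq Hq q i x + h * Hq i i)) =
        fun x => (dq Hq q i x ^ 2 + (2 * h * Hq i i) * dq Hq q i x) + (h ^ 2 * Hq i i ^ 2) * (1 : (ι → ℝ) → ℝ) x := by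
        funext x; simp; ring
      rw [this, Tadd (fun x => dq Hq q i x ^ 2 + (2 * h * Hq i i) * dq Hq q i x) (fun x => (h ^ 2 * Hq i i ^ 2) * (1 : (ι → ℝ) → ℝ) x),
        Tadd (fun x => dq Hq q i x ^ 2) (fun x => (2 * h * Hq i i) * dq Hq q i x), Tmul _ (dq Hq q i), Tmul _ (1 : (ι → ℝ) → ℝ)]
      ring
    rw [e1, mul_sum]
    refine sum_le_sum fun i _ => ?_
    rw [← link (fun x => dq Hq q i x + h * Hq i i) (fun x => dq Hq q i x + h * Hq i i)]
    refine sum_le_sum fun x _ => ?_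
    have wp : 0 < w n x := exp_pos _
    rw [mul_assoc, mul_assoc]
    refine mlL ?_ wp.le
    by_cases hx : x + ee i ∈ bx ι (R * n)
    · rw [D_pos _ _ _ hx, sc_add, qf_add, mul_div_cancel_left₀ _ hp.ne']
    · rw [D_zero _ _ _ hx]; simp [mul_self_nonneg]
  have G2 := G.trans En1
  have e6 : (fun x => qf Hq q x ^ 2) = fun x => qf Hq q x * qf Hq q x := by funext x; ring
  rw [e6]
  have e7 : l1 * (P * T n (fun x => qf Hq q x * qf Hq q x) - (P * T n (qf Hq q)) ^ 2 / (P * T n 1)) =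
     P / T n 1 * (l1 * (T n (fun x => qf Hq q x * qf Hq q x) * T n 1 - T n (qf Hq q) ^ 2)) := by
    field_simp
  change l1 * (P * T n (fun x => qf Hq q x * qf Hq q x) - (P * T n (qf Hq q)) ^ 2 / (P * T n 1)) ≤ _ at G2
  rw [e7] at G2
  have := mlL G2 (by positivity : 0 ≤ T n 1 / P)
  calc _ = T n 1 / P * (P / T n 1 * (l1 * (T n (fun x => qf Hq q x * qf Hq q x) * T n 1 - T n (qf Hq q) ^ 2))) := by
        field_simp
    _ ≤ _ := this
    _ = _ := by field_simp
end
section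
variable {ι : Type} [Fintype ι] [DecidableEq ι]
lemma er_apply (i k : ι) : (er i : ι → ℝ) k = if k = i then 1 else 0 := by
  simp [er, Pi.single_apply]
lemma sum_er (u : ι → ℝ) (x : ι → ℝ) (s : ℝ) (i : ι) :
    ∑ k, u k * (x + s • er i) k = ∑ k, u k * x k + s * u i := by
  simp [mul_add, sum_add_distrib, er_apply, mul_comm]
lemma pot_add {V V' : (ι → ℝ) → ℝ} {g g' : ι → (ι → ℝ) → ℝ} {H H' : ι → ι → (ι → ℝ) → ℝ}
    (h : IsPot V g H) (h' : IsPot V' g' H') :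
    IsPot (fun x => V x + V' x) (fun j x => g j x + g' j x) (fun i j x => H i j x + H' i j x) :=
  ⟨fun x j => (h.d1 x j).add (h'.d1 x j), fun x i j => (h.d2 x i j).add (h'.d2 x i j),
    fun j => (h.cg j).add (h'.cg j), fun i j => (h.cH i j).add (h'.cH i j)⟩
lemma pot_exp (u : ι → ℝ) (b : ℝ) :
    IsPot (fun x => exp (∑ k, u k * x k - b)) (fun j x => u j * exp (∑ k, u k * x k - b))
      (fun i j x => u i * u j * exp (∑ k, u k * x k - b)) := by
  have key : ∀ (x : ι → ℝ) j, HasDerivAt (fun s : ℝ => exp (∑ k, u k * (x + s • er j) k - b))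
      (u j * exp (∑ k, u k * x k - b)) 0 := by
    intro x j
    simp only [sum_er]
    have := ((((hasDerivAt_id (0:ℝ)).mul_const (u j)).const_add (∑ k, u k * x k)).sub_const b).exp
    simpa [mul_comm] using this
  refine ⟨key, fun x i j => ?_, fun j => by fun_prop, fun i j => by fun_prop⟩
  have := (key x i).const_mul (u j)
  exact this.congr_deriv (by ring)
lemma pot_quad (t : ℝ) (y : ι → ℝ) :
    IsPot (fun x => t / 2 * ∑ k, x k ^ 2 - ∑ k, y k * x k) (fun j x => t * x j - y j)
      (fun i j _ => if i = j then t else 0) := by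
  refine ⟨fun x j => ?_, fun x i j => ?_, fun j => by fun_prop, fun i j => by fun_prop⟩
  · have e : ∀ s : ℝ, t / 2 * ∑ k, (x + s • er j) k ^ 2 - ∑ k, y k * (x + s • er j) k =
        t / 2 * ∑ k, x k ^ 2 - ∑ k, y k * x k + (s * (t * x j - y j) + s ^ 2 * (t / 2)) := by
      intro s
      rw [sum_er]
      have : ∑ k, (x + s • er j) k ^ 2 = ∑ k, x k ^ 2 + (2 * s * x j + s ^ 2) := by
        have : ∀ k, (x + s • er j) k ^ 2 = x k ^ 2 + if k = j then 2 * s * x k + s ^ 2 else 0 := by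
          intro k; simp only [Pi.add_apply, Pi.smul_apply, er_apply, smul_eq_mul]; split_ifs <;> ring
        simp only [this, sum_add_distrib, Finset.sum_ite_eq', Finset.mem_univ, if_true]
      rw [this]; ring
    simp only [e]
    have h := (((hasDerivAt_id (0:ℝ)).mul_const (t * x j - y j)).add (((hasDerivAt_id (0:ℝ)).pow 2).mul_const (t / 2))).const_add
      (t / 2 * ∑ k, x k ^ 2 - ∑ k, y k * x k)
    simpa using h
  · simp only [Pi.add_apply, Pi.smul_apply, er_apply, smul_eq_mul]
    have h := ((((hasDerivAt_id (0:ℝ)).mul_const (if j = i then (1:ℝ) else 0)).const_add (x j)).const_mul t).sub_const (y j)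
    refine h.congr_deriv ?_
    by_cases hij : i = j
    · simp [hij]
    · simp [hij, Ne.symm hij]
lemma halfspaces [Nonempty ι] {K : Set (ι → ℝ)} (hK : IsCompact K) (hc : Convex ℝ K) :
    ∃ (u : ℕ → ι → ℝ) (b : ℕ → ℝ), (∀ x ∈ K, ∀ k, ∑ i, u k i * x i ≤ b k - 1) ∧
      ∀ x ∉ K, ∃ k, b k < ∑ i, u k i * x i := by
  have h1 : ∀ x : (Kᶜ : Set (ι → ℝ)), ∃ (u : ι → ℝ) (b : ℝ), (∀ z ∈ K, ∑ i, u i * z i ≤ b - 1) ∧ b < ∑ i, u i * x.1 i := by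
    rintro ⟨x, hx⟩
    obtain ⟨f, a, b, hf, hab, hb⟩ := geometric_hahn_banach_compact_closed hc hK (convex_singleton x) isClosed_singleton
      (Set.disjoint_singleton_right.2 hx)
    have hfx : ∀ z, f z = ∑ i, f (er i) * z i := by
      intro z
      have : z = ∑ i, z i • (er i : ι → ℝ) := by
        funext k; simp [er_apply]
      conv_lhs => rw [this, map_sum]
      exact sum_congr rfl fun i _ => by rw [map_smul, smul_eq_mul, mul_comm]
    have hd : 0 < b - a := by linarith
    have e : ∀ z : ι → ℝ, ∑ i, f (er i) / (b - a) * z i = f z / (b - a) := by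
      intro z; rw [hfx, sum_div]; exact sum_congr rfl fun i _ => by ring
    refine ⟨fun i => f (er i) / (b - a), b / (b - a), fun z hz => ?_, ?_⟩
    · rw [e, div_le_iff₀ hd]
      have := hf z hz
      field_simp
      linarith
    · rw [e]; exact div_lt_div_of_pos_right (hb x rfl) hd
  choose u b hu hb using h1
  obtain ⟨T, hT, hU⟩ := TopologicalSpace.isOpen_iUnion_countable (fun x : (Kᶜ : Set (ι → ℝ)) => {z : ι → ℝ | b x < ∑ i, u x i * z i})
    (fun x => isOpen_lt continuous_const (by fun_prop))
  have hcov : ∀ z ∉ K, ∃ x ∈ T, b x < ∑ i, u x i * z i := by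
    intro z hz
    have : z ∈ ⋃ x : (Kᶜ : Set (ι → ℝ)), {z : ι → ℝ | b x < ∑ i, u x i * z i} :=
      Set.mem_iUnion.2 ⟨⟨z, hz⟩, hb ⟨z, hz⟩⟩
    rw [← hU] at this
    simpa using this
  have hne : T.Nonempty := by
    obtain ⟨z, hz⟩ : ∃ z, z ∉ K := by
      by_contra hcon
      push Not at hcon
      have : K = Set.univ := Set.eq_univ_of_forall hcon
      rw [this] at hK
      exact noncompact_univ _ hK
    obtain ⟨x, hx, _⟩ := hcov z hz
    exact ⟨x, hx⟩
  obtain ⟨e, he⟩ := hT.exists_eq_range hne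
  refine ⟨fun k => u (e k), fun k => b (e k), fun x hx k => hu _ x hx, fun x hx => ?_⟩
  obtain ⟨z, hz, h⟩ := hcov x hx
  rw [he] at hz
  obtain ⟨k, rfl⟩ := hz
  exact ⟨k, h⟩
def Vm (t : ℝ) (y : ι → ℝ) (u : ℕ → ι → ℝ) (b : ℕ → ℝ) (m n : ℕ) (x : ι → ℝ) : ℝ :=
  t / 2 * ∑ k, x k ^ 2 - ∑ k, y k * x k + ∑ j ∈ range n, exp (∑ k, ((m : ℝ) * u j k) * x k - m * b j)
lemma Vm_pot (t : ℝ) (y : ι → ℝ) (u : ℕ → ι → ℝ) (b : ℕ → ℝ) (m n : ℕ) :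
    ∃ g H, IsPot (Vm t y u b m n) g H ∧ ∀ x, ∀ v : ι → ℝ, t * ∑ i, v i ^ 2 ≤ ∑ i, ∑ j, H i j x * v i * v j := by
  induction n with
  | zero =>
    have e : Vm t y u b m 0 = fun x => t / 2 * ∑ k, x k ^ 2 - ∑ k, y k * x k := by
      funext x; simp [Vm]
    refine ⟨_, _, e ▸ pot_quad t y, ?_⟩
    · intro x v
      simp [mul_sum]
      exact le_of_eq (sum_congr rfl fun i _ => by ring)
  | succ n ih =>
    obtain ⟨g, H, h1, h2⟩ := ih
    have h3 := pot_add h1 (pot_exp (fun k => (m : ℝ) * u n k) (m * b n))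
    have e : Vm t y u b m (n + 1) = fun x => Vm t y u b m n x + exp (∑ k, (m : ℝ) * u n k * x k - m * b n) := by
      funext x; simp [Vm, Finset.sum_range_succ, add_assoc]
    refine ⟨_, _, e ▸ h3, ?_⟩
    · intro x v
      refine (h2 x v).trans ?_
      have e : ∀ i j, (H i j x + m * u n i * (m * u n j) * exp (∑ k, m * u n k * x k - m * b n)) * v i * v j =
        H i j x * v i * v j + exp (∑ k, m * u n k * x k - m * b n) * ((m * u n i * v i) * (m * u n j * v j)) := by
        intro i j; ring
      simp only [e, sum_add_distrib, ← mul_sum, ← sum_mul_sum]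
      have := mul_nonneg (exp_pos (∑ k, m * u n k * x k - m * b n)).le (mul_self_nonneg (∑ i, m * u n i * v i))
      rw [← sum_mul]
      linarith
lemma Vm_cont (t : ℝ) (y : ι → ℝ) (u : ℕ → ι → ℝ) (b : ℕ → ℝ) (m n : ℕ) : Continuous (Vm t y u b m n) := by
  unfold Vm; fun_prop
def wt (t : ℝ) (y : ι → ℝ) (x : ι → ℝ) : ℝ := exp (∑ k, y k * x k - t / 2 * ∑ k, x k ^ 2)
lemma PIf_body [Nonempty ι] {K : Set (ι → ℝ)} (hK : IsCompact K) (hc : Convex ℝ K) (hi : (interior K).Nonempty)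
    (t : ℝ) (y : ι → ℝ) : PIf t (fun F => ∫ x in K, F x * wt t y x) := by
  obtain ⟨u, b, h1, h2⟩ := halfspaces hK hc
  obtain ⟨R0, hR0⟩ := hK.isBounded.subset_closedBall (0 : ι → ℝ)
  obtain ⟨R, hR⟩ := exists_nat_gt (max R0 0)
  have Rp : 0 < R := by
    have := (le_max_right R0 0).trans_lt hR
    exact_mod_cast this
  have hKR : K ⊆ Metric.closedBall (0 : ι → ℝ) R :=
    hR0.trans (Metric.closedBall_subset_closedBall ((le_max_left _ _).trans hR.le))
  have wc : Continuous (wt t y) := by unfold wt; fun_prop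
  have wp : ∀ x, 0 < wt t y x := fun x => exp_pos _
  have eV : ∀ m n x, exp (-Vm t y u b m n x) = wt t y x *
      exp (-∑ j ∈ range n, exp (∑ k, ((m : ℝ) * u j k) * x k - m * b j)) := by
    intro m n x; unfold Vm wt; rw [← exp_add]; congr 1; ring
  have eE : ∀ (m j : ℕ) (x : ι → ℝ), ∑ k, ((m : ℝ) * u j k) * x k - m * b j = m * (∑ k, u j k * x k - b j) := by
    intro m j x; simp only [mul_assoc, ← mul_sum]; ring
  refine PIf_lim (T := fun m F => ∫ x in Metric.closedBall (0 : ι → ℝ) R, F x * exp (-Vm t y u b m m x)) ?_ ?_ ?_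
  · intro F hF
    have e0 : ∫ x in K, F x * wt t y x = ∫ x in Metric.closedBall (0 : ι → ℝ) R, K.indicator (fun x => F x * wt t y x) x := by
      rw [setIntegral_indicator hK.isClosed.measurableSet, Set.inter_eq_self_of_subset_right hKR]
    rw [e0]
    refine tendsto_integral_of_dominated_convergence (fun x => |F x| * wt t y x) ?_ ?_ ?_ ?_
    · intro m
      exact (hF.mul (Real.continuous_exp.comp (Vm_cont t y u b m m).neg)).aestronglyMeasurable
    · exact (hF.abs.mul wc).continuousOn.integrableOn_compact (isCompact_closedBall _ _)
    · intro m
      refine Eventually.of_forall fun x => ?_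
      rw [norm_mul, Real.norm_eq_abs, Real.norm_eq_abs, abs_of_pos (exp_pos _), eV]
      refine mlL ?_ (abs_nonneg _)
      refine mul_le_of_le_one_right (wp x).le (Real.exp_le_one_iff.2 ?_)
      have : 0 ≤ ∑ j ∈ range m, exp (∑ k, ((m : ℝ) * u j k) * x k - m * b j) :=
        sum_nonneg fun j _ => (exp_pos _).le
      linarith
    · refine Eventually.of_forall fun x => ?_
      simp only [eV]
      by_cases hx : x ∈ K
      · rw [Set.indicator_of_mem hx]
        refine Tendsto.const_mul _ ?_
        have s0 : Tendsto (fun m : ℕ => ∑ j ∈ range m, exp (∑ k, ((m : ℝ) * u j k) * x k - m * b j)) atTop (𝓝 0) := by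
          have z : Tendsto (fun m : ℕ => (m:ℝ) ^ 1 * exp (-(m:ℝ))) atTop (𝓝 0) :=
            (Real.tendsto_pow_mul_exp_neg_atTop_nhds_zero 1).comp tendsto_natCast_atTop_atTop
          refine squeeze_zero (fun m => sum_nonneg fun j _ => (exp_pos _).le) (fun m => ?_) z
          calc _ ≤ ∑ j ∈ range m, exp (-(m:ℝ)) := sum_le_sum fun j _ => by
                rw [exp_le_exp, eE]
                have := h1 x hx j
                have m0 : (0:ℝ) ≤ m := by positivity
                nlinarith
            _ = _ := by simp
        have := (Real.continuous_exp.tendsto _).comp s0.neg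
        simp only [neg_zero, exp_zero] at this
        simpa [Function.comp_def] using this.const_mul (wt t y x)
      · rw [Set.indicator_of_notMem hx]
        obtain ⟨k, hk⟩ := h2 x hx
        have s0 : Tendsto (fun m : ℕ => ∑ j ∈ range m, exp (∑ k, ((m : ℝ) * u j k) * x k - m * b j)) atTop atTop := by
          have z : Tendsto (fun m : ℕ => (m:ℝ) * (∑ i, u k i * x i - b k)) atTop atTop :=
            tendsto_natCast_atTop_atTop.atTop_mul_const (by linarith)
          refine tendsto_atTop_mono' _ ?_ z
          filter_upwards [eventually_gt_atTop k] with m hm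
          rw [← eE]
          refine le_trans (by linarith [Real.add_one_le_exp (∑ i, (m:ℝ) * u k i * x i - m * b k)]) 
            (single_le_sum (f := fun j => exp (∑ k, ((m : ℝ) * u j k) * x k - m * b j))
              (fun j _ => (exp_pos _).le) (Finset.mem_range.2 hm))
        have := Real.tendsto_exp_neg_atTop_nhds_zero.comp s0
        have := (this.const_mul (wt t y x)).const_mul (F x)
        simpa [Function.comp_def] using this
  · simp only [Pi.one_apply, one_mul]
    rw [setIntegral_pos_iff_support_of_nonneg_ae (Eventually.of_forall fun x => (wp x).le)
      (wc.continuousOn.integrableOn_compact hK)]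
    have : Function.support (wt t y) = Set.univ := by
      ext x; simp [(wp x).ne']
    rw [this, Set.univ_inter]
    exact (isOpen_interior.measure_pos volume hi).trans_le (measure_mono interior_subset)
  · intro m
    obtain ⟨g, H, p1, p2⟩ := Vm_pot t y u b m m
    exact PIf_pot p1 (Vm_cont t y u b m m) p2 R Rp
end
section
variable {ι : Type} [Fintype ι] [DecidableEq ι]
structure IsExp (E : ((ι → ℝ) → ℝ) → ℝ) : Prop where
  add : ∀ F G : (ι → ℝ) → ℝ, Continuous F → Continuous G → E (fun x => F x + G x) = E F + E G
  mul : ∀ (c : ℝ) (F : (ι → ℝ) → ℝ), E (fun x => c * F x) = c * E F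
  nonneg : ∀ F : (ι → ℝ) → ℝ, (∀ x, 0 ≤ F x) → 0 ≤ E F
  one : E (fun _ => 1) = 1
namespace IsExp
variable {E : ((ι → ℝ) → ℝ) → ℝ} (hE : IsExp E)
include hE
lemma const (c : ℝ) : E (fun _ => c) = c := by
  have := hE.mul c (fun _ => 1)
  rw [hE.one] at this; simpa using this
lemma sum {κ : Type} (s : Finset κ) (F : κ → (ι → ℝ) → ℝ) (hF : ∀ i, Continuous (F i)) :
    E (fun x => ∑ i ∈ s, F i x) = ∑ i ∈ s, E (F i) := by
  classical
  induction s using Finset.induction_on with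
  | empty => simpa using hE.const 0
  | insert a s ha ih =>
    simp only [Finset.sum_insert ha]
    rw [hE.add _ _ (hF a) (continuous_finsetSum _ fun i _ => hF i), ih]
lemma cs (F G : (ι → ℝ) → ℝ) (hF : Continuous F) (hG : Continuous G) :
    E (fun x => F x * G x) ^ 2 ≤ E (fun x => F x ^ 2) * E (fun x => G x ^ 2) := by
  have h : ∀ s : ℝ, 0 ≤ E (fun x => F x ^ 2) * (s * s) + 2 * E (fun x => F x * G x) * s + E (fun x => G x ^ 2) := by
    intro s
    have h0 := hE.nonneg (fun x => (s * F x + G x) ^ 2) fun x => sq_nonneg _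
    have e : (fun x => (s * F x + G x) ^ 2) = fun x => ((s * s) * F x ^ 2 + (2 * s) * (F x * G x)) + G x ^ 2 := by
      funext x; ring
    rw [e, hE.add _ _ (by fun_prop) (by fun_prop), hE.add _ _ (by fun_prop) (by fun_prop), hE.mul, hE.mul] at h0
    linarith
  have := discrim_le_zero h
  unfold discrim at this
  nlinarith
lemma sub (F G : (ι → ℝ) → ℝ) (hF : Continuous F) (hG : Continuous G) :
    E (fun x => F x - G x) = E F - E G := by
  have e : (fun x => F x - G x) = fun x => F x + (-1) * G x := by funext x; ring
  rw [e, hE.add _ _ hF (by fun_prop), hE.mul]; ring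
end IsExp
def mn (E : ((ι → ℝ) → ℝ) → ℝ) (i : ι) : ℝ := E (fun x => x i)
def Cv (E : ((ι → ℝ) → ℝ) → ℝ) (i j : ι) : ℝ := E (fun x => (x i - mn E i) * (x j - mn E j))
def Tm (E : ((ι → ℝ) → ℝ) → ℝ) (i j k : ι) : ℝ :=
  E (fun x => (x i - mn E i) * (x j - mn E j) * (x k - mn E k))
variable {E : ((ι → ℝ) → ℝ) → ℝ}
lemma Cv_eq (hE : IsExp E) (i j : ι) : Cv E i j = E (fun x => x i * x j) - mn E i * mn E j := by
  unfold Cv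
  have e : (fun x : ι → ℝ => (x i - mn E i) * (x j - mn E j)) = fun x => (x i * x j - mn E i * x j) - (mn E j * x i - mn E i * mn E j) := by
    funext x; ring
  rw [e, hE.sub _ _ (by fun_prop) (by fun_prop), hE.sub _ _ (by fun_prop) (by fun_prop),
    hE.sub _ _ (by fun_prop) (by fun_prop), hE.mul, hE.mul, hE.const]
  change _ - mn E i * mn E j - (mn E j * mn E i - _) = _
  ring
lemma Tm_eq (hE : IsExp E) (i j k : ι) : Tm E i j k = (E (fun x => x i * x j * x k) - E (fun x => x i * x j) * mn E k)
    - mn E i * Cv E j k - mn E j * Cv E i k := by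
  rw [Cv_eq hE, Cv_eq hE]
  unfold Tm
  have e : (fun x : ι → ℝ => (x i - mn E i) * (x j - mn E j) * (x k - mn E k)) =
      fun x => ((x i * x j * x k - mn E k * (x i * x j)) - (mn E i * (x j * x k) - mn E i * mn E k * x j)) -
        ((mn E j * (x i * x k) - mn E j * mn E k * x i) - (mn E i * mn E j * x k - mn E i * mn E j * mn E k)) := by
    funext x; ring
  rw [e, hE.sub _ _ (by fun_prop) (by fun_prop), hE.sub _ _ (by fun_prop) (by fun_prop),
    hE.sub _ _ (by fun_prop) (by fun_prop), hE.sub _ _ (by fun_prop) (by fun_prop), hE.sub _ _ (by fun_prop) (by fun_prop),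
    hE.sub _ _ (by fun_prop) (by fun_prop), hE.sub _ _ (by fun_prop) (by fun_prop),
    hE.mul, hE.mul, hE.mul, hE.mul, hE.mul, hE.mul, hE.const]
  change _ - _ - (_ - _ * mn E j) - (_ - _ * mn E i - (_ * mn E k - _)) = _
  ring
lemma Cv_quad (hE : IsExp E) (u v : ι → ℝ) : E (fun x => (∑ i, u i * (x i - mn E i)) * ∑ j, v j * (x j - mn E j)) =
    ∑ i, ∑ j, u i * v j * Cv E i j := by
  have e : (fun x : ι → ℝ => (∑ i, u i * (x i - mn E i)) * ∑ j, v j * (x j - mn E j)) =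
      fun x => ∑ i, ∑ j, (u i * v j) * ((x i - mn E i) * (x j - mn E j)) := by
    funext x; rw [sum_mul_sum]
    exact sum_congr rfl fun i _ => sum_congr rfl fun j _ => by ring
  rw [e, hE.sum Finset.univ (fun i x => ∑ j, (u i * v j) * ((x i - mn E i) * (x j - mn E j))) (fun i => by fun_prop)]
  refine sum_congr rfl fun i _ => ?_
  rw [hE.sum Finset.univ (fun j x => (u i * v j) * ((x i - mn E i) * (x j - mn E j))) (fun i => by fun_prop)]
  exact sum_congr rfl fun j _ => hE.mul _ (fun x => (x i - mn E i) * (x j - mn E j))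
lemma third (hE : IsExp E) {t a : ℝ} (ht : 0 < t) (ha : 1 ≤ a) (hP : PIf t E)
    (hc : ∀ v : ι → ℝ, ∑ i, ∑ j, v i * v j * Cv E i j ≤ a * ∑ i, v i ^ 2) (θ : ι → ℝ) :
    ∑ i, ∑ j, (∑ k, θ k * Tm E i j k) ^ 2 ≤ 8 * a ^ 3 / Real.sqrt t * ∑ i, θ i ^ 2 := by
  have E1 : E 1 = 1 := hE.one
  have sp : 0 < Real.sqrt t := sqrt_pos.2 ht
  set l1 : ℝ := Real.sqrt t / (2 * a) with hl1
  have a0 : 0 < a := by linarith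
  have l0 : 0 < l1 := by positivity
  have hlt : l1 ^ 2 * a < t := by
    rw [hl1, div_pow, Real.sq_sqrt ht.le]
    rw [div_mul_eq_mul_div, div_lt_iff₀ (by positivity)]
    nlinarith [mul_pos ht a0, mul_nonneg ht.le (sub_nonneg.2 ha), mul_pos (mul_pos ht a0) a0]
  set H : ι → ι → ℝ := fun i j => ∑ k, θ k * Tm E i j k with hH
  set c := mn E with hcdef
  set Th : (ι → ℝ) → ℝ := fun x => ∑ k, θ k * (x k - c k) with hTh
  set Q : (ι → ℝ) → ℝ := fun x => ∑ i, ∑ j, H i j * ((x i - c i) * (x j - c j)) with hQ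
  have Qc : Continuous Q := by rw [hQ]; fun_prop
  have Tc : Continuous Th := by rw [hTh]; fun_prop
  set S : ℝ := ∑ i, ∑ j, H i j ^ 2 with hS
  have S0 : 0 ≤ S := sum_nonneg fun i _ => sum_nonneg fun j _ => sq_nonneg _
  have hHE : ∀ i j, H i j = E (fun x => (x i - c i) * (x j - c j) * Th x) := by
    intro i j
    have e : (fun x : ι → ℝ => (x i - c i) * (x j - c j) * Th x) =
        fun x => ∑ k, θ k * ((x i - c i) * (x j - c j) * (x k - c k)) := by
      funext x; rw [hTh, mul_sum]; exact sum_congr rfl fun k _ => by ring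
    rw [e, hE.sum Finset.univ (fun k x => θ k * ((x i - c i) * (x j - c j) * (x k - c k))) (fun k => by fun_prop)]
    exact sum_congr rfl fun k _ => (hE.mul _ (fun x => (x i - c i) * (x j - c j) * (x k - c k))).symm
  have hSE : S = E (fun x => Q x * Th x) := by
    have e : (fun x => Q x * Th x) = fun x => ∑ i, ∑ j, H i j * ((x i - c i) * (x j - c j) * Th x) := by
      funext x; rw [hQ, sum_mul]
      exact sum_congr rfl fun i _ => by
        rw [sum_mul]; exact sum_congr rfl fun j _ => by ring
    rw [e, hE.sum Finset.univ (fun i x => ∑ j, H i j * ((x i - c i) * (x j - c j) * Th x)) (fun i => by fun_prop)]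
    refine sum_congr rfl fun i _ => ?_
    rw [hE.sum Finset.univ (fun j x => H i j * ((x i - c i) * (x j - c j) * Th x)) (fun i => by fun_prop)]
    refine sum_congr rfl fun j _ => ?_
    rw [hE.mul _ (fun x => (x i - c i) * (x j - c j) * Th x), ← hHE]; ring
  have hTh0 : E Th = 0 := by
    rw [hTh, hE.sum Finset.univ (fun k x => θ k * (x k - c k)) (fun k => by fun_prop)]
    refine Finset.sum_eq_zero fun k _ => ?_
    rw [hE.mul _ (fun x => x k - c k), hE.sub _ _ (by fun_prop) (by fun_prop), hE.const]
    simp [hcdef, mn]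
  have hTh2 : E (fun x => Th x ^ 2) ≤ a * ∑ i, θ i ^ 2 := by
    have := Cv_quad hE θ θ
    have e : (fun x => Th x ^ 2) = fun x => (∑ i, θ i * (x i - mn E i)) * ∑ j, θ j * (x j - mn E j) := by
      funext x; rw [hTh, pow_two]
    rw [e, this]; exact hc θ
  have hcov : ∀ v : ι → ℝ, ∑ i, ∑ j, v i * v j * covT E i j ≤ a * E 1 ^ 2 * ∑ i, v i ^ 2 := by
    intro v
    have := hc v
    rw [E1]
    simp only [Cv_eq hE] at this
    simp only [covT, E1, mul_one, one_pow]
    exact this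
  set q : ι → ℝ := fun i => -∑ j, (H i j + H j i) * c j with hq
  set C0 : ℝ := ∑ i, ∑ j, H i j * (c i * c j) with hC0
  have hqQ : ∀ x, Q x = qf H q x + C0 := by
    intro x
    have e1 : ∑ i, q i * x i = -(∑ i, ∑ j, (H i j * c j * x i + H i j * c i * x j)) := by
      simp only [hq, neg_mul, Finset.sum_neg_distrib, sum_mul, add_mul, sum_add_distrib]
      congr 2
      rw [sum_comm]
    rw [hQ, qf, e1, hC0]
    simp only [← sum_add_distrib, ← Finset.sum_neg_distrib]
    exact sum_congr rfl fun i _ => sum_congr rfl fun j _ => by ring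
  have PI := hP a l1 a0.le l0.le hcov hlt H q
  rw [E1, mul_one, one_mul] at PI
  have hsym : ∀ i j, H i j = H j i := by
    intro i j; rw [hHE, hHE]; congr 1; funext x; ring
  have hdq : ∀ i x, dq H q i x = 2 * ∑ j, H i j * (x j - c j) := by
    intro i x
    simp only [dq, hq, ← sub_eq_add_neg, ← sum_sub_distrib, mul_sum]
    exact sum_congr rfl fun j _ => by rw [hsym j i]; ring
  have hD : E (fun x => ∑ i, dq H q i x ^ 2) ≤ 4 * a * S := by
    rw [hE.sum Finset.univ (fun i x => dq H q i x ^ 2) (fun i => (dq_cont H q i).pow 2), hS, mul_sum]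
    refine sum_le_sum fun i _ => ?_
    have e : (fun x => dq H q i x ^ 2) = fun x => 4 * ((∑ j, H i j * (x j - mn E j)) * ∑ j, H i j * (x j - mn E j)) := by
      funext x; rw [hdq]; ring
    rw [e, hE.mul, Cv_quad hE]
    linarith [hc (H i)]
  set b : ℝ := E (qf H q) with hb
  have hV : E (fun x => (qf H q x - b) ^ 2) = E (fun x => qf H q x ^ 2) - b ^ 2 := by
    have qc := qf_cont H q
    have e : (fun x => (qf H q x - b) ^ 2) = fun x => (qf H q x ^ 2 - (2 * b) * qf H q x) + b ^ 2 := by funext x; ring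
    rw [e, hE.add _ _ (by fun_prop) (by fun_prop), hE.sub _ _ (by fun_prop) (by fun_prop), hE.mul, hE.const, ← hb]
    ring
  have qc := qf_cont H q
  have hS2 : S = E (fun x => (qf H q x - b) * Th x) := by
    have e : (fun x => (qf H q x - b) * Th x) = fun x => Q x * Th x - (C0 + b) * Th x := by
      funext x; rw [hqQ]; ring
    rw [e, hE.sub _ _ (by fun_prop) (by fun_prop), hE.mul, hTh0, hSE]; ring
  have CS := hE.cs (fun x => qf H q x - b) Th (by fun_prop) Tc
  rw [← hS2, hV] at CS
  set W := E (fun x => qf H q x ^ 2) - b ^ 2 with hW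
  have W1 : l1 * W ≤ 4 * a * S := PI.trans hD
  have W0 : 0 ≤ W := by rw [← hV]; exact hE.nonneg _ fun x => sq_nonneg _
  set N : ℝ := ∑ i, θ i ^ 2 with hN
  have N0 : 0 ≤ N := sum_nonneg fun i _ => sq_nonneg _
  have f1 : l1 * S ^ 2 ≤ 4 * a ^ 2 * N * S := by
    calc l1 * S ^ 2 ≤ l1 * (W * (a * N)) := by
          apply mlL _ l0.le
          exact CS.trans (mlL hTh2 W0)
      _ = (l1 * W) * (a * N) := by ring
      _ ≤ (4 * a * S) * (a * N) := mlR W1 (by positivity)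
      _ = _ := by ring
  have f2 : l1 * S ≤ 4 * a ^ 2 * N := by
    rcases S0.eq_or_lt with h | h
    · rw [← h]; simp; positivity
    · have : (l1 * S) * S ≤ (4 * a ^ 2 * N) * S := by linarith [f1, pow_two S]
      exact le_of_mul_le_mul_right this h
  rw [hl1, div_mul_eq_mul_div, div_le_iff₀ (by positivity)] at f2
  rw [div_mul_eq_mul_div, le_div_iff₀ sp]
  linarith
end
section
variable {κ : Type} [Fintype κ] [DecidableEq κ]
abbrev Pt (κ : Type) := ℝ × (κ → ℝ)
def EG (g : Pt κ → ℝ) : Prop :=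
  Continuous g ∧ ∀ T : ℝ, ∃ C R : ℝ, 0 ≤ C ∧ 0 ≤ R ∧ ∀ p : Pt κ, |p.1| ≤ T → |g p| ≤ C * Real.exp (R * ‖p.2‖)
lemma EG.const (c : ℝ) : EG (κ := κ) fun _ => c :=
  ⟨continuous_const, fun _ => ⟨|c|, 0, abs_nonneg _, le_rfl, fun p _ => by simp⟩⟩
lemma EG.add {g h : Pt κ → ℝ} (hg : EG g) (hh : EG h) : EG fun p => g p + h p := by
  refine ⟨hg.1.add hh.1, fun T => ?_⟩
  obtain ⟨C, R, C0, R0, b⟩ := hg.2 T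
  obtain ⟨C', R', C0', R0', b'⟩ := hh.2 T
  refine ⟨C + C', R + R', by positivity, by positivity, fun p hp => ?_⟩
  have n0 := norm_nonneg p.2
  calc |g p + h p| ≤ |g p| + |h p| := abs_add_le _ _
    _ ≤ C * Real.exp (R * ‖p.2‖) + C' * Real.exp (R' * ‖p.2‖) := add_le_add (b p hp) (b' p hp)
    _ ≤ C * Real.exp ((R + R') * ‖p.2‖) + C' * Real.exp ((R + R') * ‖p.2‖) := by
        gcongr <;> linarith
    _ = _ := by ring
lemma EG.mul {g h : Pt κ → ℝ} (hg : EG g) (hh : EG h) : EG fun p => g p * h p := by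
  refine ⟨hg.1.mul hh.1, fun T => ?_⟩
  obtain ⟨C, R, C0, R0, b⟩ := hg.2 T
  obtain ⟨C', R', C0', R0', b'⟩ := hh.2 T
  refine ⟨C * C', R + R', by positivity, by positivity, fun p hp => ?_⟩
  calc |g p * h p| = |g p| * |h p| := abs_mul _ _
    _ ≤ (C * Real.exp (R * ‖p.2‖)) * (C' * Real.exp (R' * ‖p.2‖)) :=
        mul_le_mul (b p hp) (b' p hp) (abs_nonneg _) (by positivity)
    _ = _ := by rw [add_mul, Real.exp_add]; ring
lemma EG.neg {g : Pt κ → ℝ} (hg : EG g) : EG fun p => - g p := by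
  simpa using (EG.const (-1)).mul hg
lemma EG.pow {g : Pt κ → ℝ} (hg : EG g) (n : ℕ) : EG fun p => g p ^ n := by
  induction n with
  | zero => simpa using EG.const 1
  | succ n ih => simpa [pow_succ] using ih.mul hg
lemma EG.sum {α : Type} (s : Finset α) {g : α → Pt κ → ℝ} (hg : ∀ a, EG (g a)) : EG fun p => ∑ a ∈ s, g a p := by
  classical
  induction s using Finset.induction_on with
  | empty => simpa using EG.const 0
  | insert a s ha ih => simpa [Finset.sum_insert ha] using (hg a).add ih
lemma EG.mono {g h : Pt κ → ℝ} (hg : EG g) (hc : Continuous h) (hb : ∀ p, |h p| ≤ |g p|) : EG h := by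
  refine ⟨hc, fun T => ?_⟩
  obtain ⟨C, R, C0, R0, b⟩ := hg.2 T
  exact ⟨C, R, C0, R0, fun p hp => (hb p).trans (b p hp)⟩
@[ext] structure Jet (κ : Type) where
  f : Pt κ → ℝ
  ft : Pt κ → ℝ
  f1 : κ → Pt κ → ℝ
  f2 : κ → Pt κ → ℝ
namespace Jet
instance : Zero (Jet κ) := ⟨⟨fun _ => 0, fun _ => 0, fun _ _ => 0, fun _ _ => 0⟩⟩
instance : One (Jet κ) := ⟨⟨fun _ => 1, fun _ => 0, fun _ _ => 0, fun _ _ => 0⟩⟩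
instance : Add (Jet κ) := ⟨fun a b => ⟨fun p => a.f p + b.f p, fun p => a.ft p + b.ft p,
  fun i p => a.f1 i p + b.f1 i p, fun i p => a.f2 i p + b.f2 i p⟩⟩
instance : Neg (Jet κ) := ⟨fun a => ⟨fun p => -a.f p, fun p => -a.ft p,
  fun i p => -a.f1 i p, fun i p => -a.f2 i p⟩⟩
instance : Mul (Jet κ) := ⟨fun a b => ⟨fun p => a.f p * b.f p, fun p => a.f p * b.ft p + a.ft p * b.f p,
  fun i p => a.f p * b.f1 i p + a.f1 i p * b.f p,
  fun i p => a.f p * b.f2 i p + 2 * (a.f1 i p * b.f1 i p) + a.f2 i p * b.f p⟩⟩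
@[simp] lemma zero_f (p : Pt κ) : (0 : Jet κ).f p = 0 := rfl
@[simp] lemma zero_ft (p : Pt κ) : (0 : Jet κ).ft p = 0 := rfl
@[simp] lemma zero_f1 (i : κ) (p : Pt κ) : (0 : Jet κ).f1 i p = 0 := rfl
@[simp] lemma zero_f2 (i : κ) (p : Pt κ) : (0 : Jet κ).f2 i p = 0 := rfl
@[simp] lemma one_f (p : Pt κ) : (1 : Jet κ).f p = 1 := rfl
@[simp] lemma one_ft (p : Pt κ) : (1 : Jet κ).ft p = 0 := rfl
@[simp] lemma one_f1 (i : κ) (p : Pt κ) : (1 : Jet κ).f1 i p = 0 := rfl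
@[simp] lemma one_f2 (i : κ) (p : Pt κ) : (1 : Jet κ).f2 i p = 0 := rfl
@[simp] lemma add_f (a b : Jet κ) (p : Pt κ) : (a + b).f p = a.f p + b.f p := rfl
@[simp] lemma add_ft (a b : Jet κ) (p : Pt κ) : (a + b).ft p = a.ft p + b.ft p := rfl
@[simp] lemma add_f1 (a b : Jet κ) (i : κ) (p : Pt κ) : (a + b).f1 i p = a.f1 i p + b.f1 i p := rfl
@[simp] lemma add_f2 (a b : Jet κ) (i : κ) (p : Pt κ) : (a + b).f2 i p = a.f2 i p + b.f2 i p := rfl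
@[simp] lemma neg_f (a : Jet κ) (p : Pt κ) : (-a).f p = -a.f p := rfl
@[simp] lemma neg_ft (a : Jet κ) (p : Pt κ) : (-a).ft p = -a.ft p := rfl
@[simp] lemma neg_f1 (a : Jet κ) (i : κ) (p : Pt κ) : (-a).f1 i p = -a.f1 i p := rfl
@[simp] lemma neg_f2 (a : Jet κ) (i : κ) (p : Pt κ) : (-a).f2 i p = -a.f2 i p := rfl
@[simp] lemma mul_f (a b : Jet κ) (p : Pt κ) : (a * b).f p = a.f p * b.f p := rfl
@[simp] lemma mul_ft (a b : Jet κ) (p : Pt κ) : (a * b).ft p = a.f p * b.ft p + a.ft p * b.f p := rfl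
@[simp] lemma mul_f1 (a b : Jet κ) (i : κ) (p : Pt κ) : (a * b).f1 i p = a.f p * b.f1 i p + a.f1 i p * b.f p := rfl
@[simp] lemma mul_f2 (a b : Jet κ) (i : κ) (p : Pt κ) :
  (a * b).f2 i p = a.f p * b.f2 i p + 2 * (a.f1 i p * b.f1 i p) + a.f2 i p * b.f p := rfl
instance : CommRing (Jet κ) where
  add_assoc a b c := by ext <;> simp <;> ring
  zero_add a := by ext <;> simp
  add_zero a := by ext <;> simp
  add_comm a b := by ext <;> simp <;> ring
  left_distrib a b c := by ext <;> simp <;> ring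
  right_distrib a b c := by ext <;> simp <;> ring
  zero_mul a := by ext <;> simp
  mul_zero a := by ext <;> simp
  mul_assoc a b c := by ext <;> simp <;> ring
  one_mul a := by ext <;> simp
  mul_one a := by ext <;> simp
  mul_comm a b := by ext <;> simp <;> ring
  neg_add_cancel a := by ext <;> simp
  nsmul := nsmulRec
  zsmul := zsmulRec
def ev (p : Pt κ) : Jet κ →+* ℝ where
  toFun a := a.f p
  map_one' := rfl
  map_mul' _ _ := rfl
  map_zero' := rfl
  map_add' _ _ := rfl
def dd (i : κ) (p : Pt κ) : Jet κ →+ ℝ where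
  toFun a := a.f1 i p
  map_zero' := rfl
  map_add' _ _ := rfl
def C (c : ℝ) : Jet κ := ⟨fun _ => c, fun _ => 0, fun _ _ => 0, fun _ _ => 0⟩
end Jet
def lin (a : ℝ) (b : κ → ℝ) : Pt κ →L[ℝ] ℝ :=
  a • ContinuousLinearMap.fst ℝ ℝ (κ → ℝ) +
    ∑ i, b i • (ContinuousLinearMap.proj (R := ℝ) (φ := fun _ : κ => ℝ) i).comp (ContinuousLinearMap.snd ℝ ℝ (κ → ℝ))
lemma lin_apply (a : ℝ) (b : κ → ℝ) (v : Pt κ) : lin a b v = a * v.1 + ∑ i, b i * v.2 i := by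
  simp [lin]
structure Ok (J : Jet κ) : Prop where
  d : ∀ p, HasFDerivAt J.f (lin (J.ft p) fun i => J.f1 i p) p
  d2 : ∀ i (p : Pt κ), HasDerivAt (fun r : ℝ => J.f1 i (p.1, p.2 + r • er i)) (J.f2 i p) 0
  ef : EG J.f
  et : EG J.ft
  e1 : ∀ i, EG (J.f1 i)
  e2 : ∀ i, EG (J.f2 i)
lemma Ok.line {J : Jet κ} (h : Ok J) (i : κ) (p : Pt κ) :
    HasDerivAt (fun r : ℝ => J.f (p.1, p.2 + r • er i)) (J.f1 i p) 0 := by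
  have h1 : HasDerivAt (fun r : ℝ => ((p.1, p.2 + r • er i) : Pt κ)) (0, er i) 0 := by
    refine (hasDerivAt_const _ _).prodMk ?_
    simpa using ((hasDerivAt_id (0:ℝ)).smul_const (er i : κ → ℝ)).const_add p.2
  have h2 := h.d (p.1, p.2 + (0:ℝ) • er i)
  have h3 := h2.comp_hasDerivAt (0:ℝ) h1
  refine h3.congr_deriv ?_
  rw [lin_apply]; simp [er_apply]
lemma Ok.const (c : ℝ) : Ok (Jet.C c : Jet κ) where
  d p := by
    have : lin ((Jet.C c : Jet κ).ft p) (fun i => (Jet.C c : Jet κ).f1 i p) = 0 := by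
      ext <;> simp [lin_apply, Jet.C]
    rw [this]; exact hasFDerivAt_const _ _
  d2 i p := hasDerivAt_const _ _
  ef := EG.const _
  et := EG.const _
  e1 _ := EG.const _
  e2 _ := EG.const _
lemma Ok.add {J K : Jet κ} (hJ : Ok J) (hK : Ok K) : Ok (J + K) where
  d p := by
    refine ((hJ.d p).add (hK.d p)).congr_fderiv ?_
    refine ContinuousLinearMap.ext fun v => ?_
    simp [lin_apply, add_mul, sum_add_distrib]; ring
  d2 i p := (hJ.d2 i p).add (hK.d2 i p)
  ef := hJ.ef.add hK.ef
  et := hJ.et.add hK.et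
  e1 i := (hJ.e1 i).add (hK.e1 i)
  e2 i := (hJ.e2 i).add (hK.e2 i)
lemma Ok.mul {J K : Jet κ} (hJ : Ok J) (hK : Ok K) : Ok (J * K) where
  d p := by
    refine ((hJ.d p).mul (hK.d p)).congr_fderiv ?_
    refine ContinuousLinearMap.ext fun v => ?_
    simp [lin_apply, add_mul, mul_add, sum_add_distrib, mul_sum]
    have e : ∀ i, J.f1 i p * K.f p * v.2 i = K.f p * (J.f1 i p * v.2 i) := fun i => by ring
    simp only [e, mul_assoc]; ring
  d2 i p := by
    refine (((hJ.line i p).mul (hK.d2 i p)).add ((hJ.d2 i p).mul (hK.line i p))).congr_deriv ?_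
    simp; ring
  ef := hJ.ef.mul hK.ef
  et := (hJ.ef.mul hK.et).add (hJ.et.mul hK.ef)
  e1 i := (hJ.ef.mul (hK.e1 i)).add ((hJ.e1 i).mul hK.ef)
  e2 i := ((hJ.ef.mul (hK.e2 i)).add ((EG.const 2).mul ((hJ.e1 i).mul (hK.e1 i)))).add ((hJ.e2 i).mul hK.ef)
lemma Ok.one : Ok (1 : Jet κ) := Ok.const 1
lemma Ok.zero : Ok (0 : Jet κ) := Ok.const 0
lemma Ok.neg {J : Jet κ} (hJ : Ok J) : Ok (-J) := by
  have : -J = Jet.C (-1) * J := by ext <;> simp [Jet.C]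
  rw [this]; exact (Ok.const _).mul hJ
lemma Ok.sub {J K : Jet κ} (hJ : Ok J) (hK : Ok K) : Ok (J - K) := by
  rw [sub_eq_add_neg]; exact hJ.add hK.neg
def okRing (κ : Type) [Fintype κ] [DecidableEq κ] : Subring (Jet κ) where
  carrier := {J | Ok J}
  mul_mem' h h' := h.mul h'
  one_mem' := Ok.one
  add_mem' h h' := h.add h'
  zero_mem' := Ok.zero
  neg_mem' h := h.neg
lemma Ok.sum {α : Type} (s : Finset α) {J : α → Jet κ} (h : ∀ a, Ok (J a)) : Ok (∑ a ∈ s, J a) :=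
  (okRing κ).sum_mem fun a _ => h a
def Jet.comp (J : Jet κ) (φ φ1 φ2 : ℝ → ℝ) : Jet κ :=
  ⟨fun p => φ (J.f p), fun p => φ1 (J.f p) * J.ft p, fun i p => φ1 (J.f p) * J.f1 i p,
    fun i p => φ2 (J.f p) * J.f1 i p ^ 2 + φ1 (J.f p) * J.f2 i p⟩
lemma Ok.comp {J : Jet κ} (hJ : Ok J) {φ φ1 φ2 : ℝ → ℝ} (h1 : ∀ p, HasDerivAt φ (φ1 (J.f p)) (J.f p))
    (h2 : ∀ p, HasDerivAt φ1 (φ2 (J.f p)) (J.f p)) (g0 : EG fun p => φ (J.f p)) (g1 : EG fun p => φ1 (J.f p))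
    (g2 : EG fun p => φ2 (J.f p)) : Ok (J.comp φ φ1 φ2) where
  d p := by
    refine ((h1 p).comp_hasFDerivAt p (hJ.d p)).congr_fderiv ?_
    refine ContinuousLinearMap.ext fun v => ?_
    simp [lin_apply, Jet.comp, mul_add, mul_sum, mul_assoc]
  d2 i p := by
    have l := hJ.line i p
    have h2' : HasDerivAt φ1 (φ2 (J.f p)) (J.f (p.1, p.2 + (0:ℝ) • er i)) := by simpa using h2 p
    have := (HasDerivAt.comp (0:ℝ) h2' l).mul (hJ.d2 i p)
    refine this.congr_deriv ?_
    simp [Jet.comp]; ring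
  ef := g0
  et := g1.mul hJ.et
  e1 i := g1.mul (hJ.e1 i)
  e2 i := (g2.mul ((hJ.e1 i).pow 2)).add (g1.mul (hJ.e2 i))
def LB (g : Pt κ → ℝ) : Prop :=
  (∀ p, 0 < g p) ∧ ∀ T : ℝ, ∃ C R : ℝ, 0 ≤ C ∧ 0 ≤ R ∧ ∀ p : Pt κ, |p.1| ≤ T → (g p)⁻¹ ≤ C * Real.exp (R * ‖p.2‖)
lemma EG.inv {g : Pt κ → ℝ} (hg : EG g) (hb : LB g) : EG fun p => (g p)⁻¹ := by
  refine ⟨hg.1.inv₀ fun p => (hb.1 p).ne', fun T => ?_⟩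
  obtain ⟨C, R, C0, R0, b⟩ := hb.2 T
  refine ⟨C, R, C0, R0, fun p hp => ?_⟩
  rw [abs_of_pos (inv_pos.2 (hb.1 p))]; exact b p hp
def Jet.inv (J : Jet κ) : Jet κ := J.comp (fun x => x⁻¹) (fun x => -(x⁻¹ ^ 2)) (fun x => 2 * x⁻¹ ^ 3)
def Jet.log (J : Jet κ) : Jet κ := J.comp Real.log (fun x => x⁻¹) (fun x => -(x⁻¹ ^ 2))
def Jet.exp (J : Jet κ) : Jet κ := J.comp Real.exp Real.exp Real.exp
lemma Ok.inv {J : Jet κ} (hJ : Ok J) (hb : LB J.f) : Ok J.inv := by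
  have ei := hJ.ef.inv hb
  refine hJ.comp (fun p => ?_) (fun p => ?_) ei (ei.pow 2).neg ((EG.const 2).mul (ei.pow 3))
  · refine (hasDerivAt_inv (hb.1 p).ne').congr_deriv (by rw [inv_pow])
  · have := ((hasDerivAt_inv (hb.1 p).ne').pow 2).neg
    refine this.congr_deriv ?_
    simp; ring
lemma Ok.log {J : Jet κ} (hJ : Ok J) (hb : LB J.f) : Ok J.log := by
  have ei := hJ.ef.inv hb
  have c : Continuous fun p => Real.log (J.f p) := hJ.ef.1.log fun p => (hb.1 p).ne'
  refine hJ.comp (fun p => ?_) (fun p => ?_) ((hJ.ef.add ei).mono c fun p => ?_) ei (ei.pow 2).neg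
  · exact Real.hasDerivAt_log (hb.1 p).ne'
  · refine (hasDerivAt_inv (hb.1 p).ne').congr_deriv (by rw [inv_pow])
  · have p0 := hb.1 p
    have i0 := inv_pos.2 p0
    rw [abs_of_pos (by positivity : 0 < J.f p + (J.f p)⁻¹), abs_le]
    have h1 := Real.log_le_sub_one_of_pos p0
    have h2 := Real.log_le_sub_one_of_pos i0
    rw [Real.log_inv] at h2
    constructor <;> linarith
lemma Ok.exp {J : Jet κ} (hJ : Ok J) (hb : EG fun p => Real.exp (J.f p)) : Ok J.exp :=
  hJ.comp (fun _ => Real.hasDerivAt_exp _) (fun _ => Real.hasDerivAt_exp _) hb hb hb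
end
section
variable {κ : Type} [Fintype κ] [DecidableEq κ]
def rho (y : κ → ℝ) : ℝ := exp (-(∑ i, y i ^ 2) / 2)
lemma rho_pos (y : κ → ℝ) : 0 < rho y := exp_pos _
lemma rho_cont : Continuous (rho : (κ → ℝ) → ℝ) := by unfold rho; fun_prop
lemma gdom (R : ℝ) : Integrable (fun y : κ → ℝ => exp (R * ‖y‖) * rho y) := by
  have h1 : Integrable (fun y : κ → ℝ => ∏ i, exp (-(1/4) * y i ^ 2)) :=
    Integrable.fintype_prod (f := fun _ x => exp (-(1/4) * x ^ 2)) fun i => integrable_exp_neg_mul_sq (by norm_num)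
  refine (h1.const_mul (exp (∑ i : κ, R ^ 2))).mono' ?_ (Eventually.of_forall fun y => ?_)
  · have := rho_cont (κ := κ)
    exact (by fun_prop : Continuous _).aestronglyMeasurable
  · rw [Real.norm_eq_abs, abs_of_pos (mul_pos (exp_pos _) (rho_pos _)), rho, ← exp_add, ← Real.exp_sum,
      ← exp_add, exp_le_exp]
    have n1 : ‖y‖ ≤ ∑ i, |y i| := by
      refine (pi_norm_le_iff_of_nonneg (sum_nonneg fun _ _ => abs_nonneg _)).2 fun i => ?_
      exact single_le_sum (f := fun i => |y i|) (fun _ _ => abs_nonneg _) (Finset.mem_univ i)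
    have n2 : R * ‖y‖ ≤ ∑ i, |R| * |y i| := by
      rw [← mul_sum]
      calc R * ‖y‖ ≤ |R| * ‖y‖ := mlR (le_abs_self R) (norm_nonneg _)
        _ ≤ _ := mlL n1 (abs_nonneg _)
    have n3 : ∑ i, |R| * |y i| ≤ ∑ i, (R ^ 2 + y i ^ 2 / 4) := sum_le_sum fun i _ => by
      nlinarith [sq_nonneg (|R| - |y i| / 2), sq_abs R, sq_abs (y i)]
    rw [sum_add_distrib] at n3
    have e1 : ∑ i, y i ^ 2 / 4 = (∑ i, y i ^ 2) / 4 := by rw [sum_div]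
    have e2 : ∑ i, -(1/4) * y i ^ 2 = -(1/4) * ∑ i, y i ^ 2 := by rw [mul_sum]
    rw [e2]; rw [e1] at n3
    linarith
lemma gint {h : (κ → ℝ) → ℝ} (hc : Continuous h) {C R : ℝ} (hb : ∀ y, |h y| ≤ C * exp (R * ‖y‖)) :
    Integrable (fun y => h y * rho y) := by
  refine ((gdom R).const_mul C).mono' (hc.mul rho_cont).aestronglyMeasurable (Eventually.of_forall fun y => ?_)
  rw [norm_mul, Real.norm_eq_abs, Real.norm_eq_abs, abs_of_pos (rho_pos y), ← mul_assoc]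
  exact mlR (hb y) (rho_pos y).le
lemma EG.abs {g : Pt κ → ℝ} (hg : EG g) : EG fun p => |g p| := hg.mono hg.1.abs fun p => by simp
lemma EG.scale {g : Pt κ → ℝ} (hg : EG g) (T S : ℝ) : ∃ C R : ℝ, 0 ≤ C ∧ 0 ≤ R ∧
    ∀ (t : ℝ) (s y : κ → ℝ), |t| ≤ T → ‖s‖ ≤ S → |g (t, s * y)| ≤ C * exp (R * ‖y‖) := by
  obtain ⟨C, R, C0, R0, b⟩ := hg.2 T
  refine ⟨C, R * |S|, C0, by positivity, fun t s y ht hs => (b (t, s * y) ht).trans ?_⟩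
  have : ‖s * y‖ ≤ |S| * ‖y‖ := (norm_mul_le s y).trans
    (mlR (hs.trans (le_abs_self S)) (norm_nonneg _))
  have := mlL this R0
  refine mlL (exp_le_exp.2 ?_) C0
  simpa [mul_assoc] using this
lemma EG.contS {g : Pt κ → ℝ} (hg : EG g) (t : ℝ) (s : κ → ℝ) : Continuous fun y => g (t, s * y) :=
  hg.1.comp (by fun_prop)
lemma EG.int {g : Pt κ → ℝ} (hg : EG g) (t : ℝ) (s : κ → ℝ) : Integrable fun y => g (t, s * y) * rho y := by
  obtain ⟨C, R, _, _, b⟩ := hg.scale |t| ‖s‖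
  exact gint (hg.contS t s) fun y => b t s y le_rfl le_rfl
lemma EG.inty {g : Pt κ → ℝ} (hg : EG g) (t : ℝ) (s : κ → ℝ) (i : κ) :
    Integrable fun y => (g (t, s * y) * y i) * rho y := by
  obtain ⟨C, R, C0, R0, b⟩ := hg.scale |t| ‖s‖
  have := hg.contS t s
  refine gint (C := C) (R := R + 1) (this.mul (continuous_apply i)) fun y => ?_
  rw [abs_mul, add_mul, exp_add, ← mul_assoc]
  refine mul_le_mul (b t s y le_rfl le_rfl) ?_ (abs_nonneg _) (by positivity)
  have : |y i| ≤ ‖y‖ := norm_le_pi_norm y i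
  linarith [Real.add_one_le_exp (1 * ‖y‖)]
lemma rho_line (y : κ → ℝ) (i : κ) : HasLineDerivAt ℝ rho (-(y i) * rho y) y (er i) := by
  have h := (pot_quad (1:ℝ) (0 : κ → ℝ)).d1 y i
  have h2 := h.neg.exp
  have e : (fun r : ℝ => rho (y + r • er i)) = fun r => exp (-(1 / 2 * ∑ k, (y + r • er i) k ^ 2 - ∑ k, (0 : κ → ℝ) k * (y + r • er i) k)) := by
    funext r; unfold rho; congr 1; simp; ring
  unfold HasLineDerivAt
  rw [e]
  refine h2.congr_deriv ?_
  simp [rho]; ring_nf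
lemma gibp {h h' : (κ → ℝ) → ℝ} {i : κ} (hd : ∀ y, HasLineDerivAt ℝ h (h' y) y (er i))
    (i1 : Integrable fun y => h' y * rho y) (i2 : Integrable fun y => (h y * y i) * rho y)
    (i3 : Integrable fun y => h y * rho y) :
    ∫ y, (h y * y i) * rho y = ∫ y, h' y * rho y := by
  have := integral_bilinear_hasLineDerivAt_right_eq_neg_left_of_integrable (μ := volume)
    (f := h) (f' := h') (g := rho) (g' := fun y => -(y i) * rho y) (v := er i)
    (B := ContinuousLinearMap.mul ℝ ℝ) (by simpa using i1) (by
      refine i2.neg.congr (Eventually.of_forall fun y => ?_); simp; ring) (by simpa using i3)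
    (fun y _ => hd y) (fun y _ => rho_line y i)
  simp only [ContinuousLinearMap.mul_apply'] at this
  have e : ∫ y, h y * (-(y i) * rho y) = -∫ y, (h y * y i) * rho y := by
    rw [← integral_neg]; congr 1; funext y; ring
  rw [e] at this
  linarith
lemma Ok.line2 {J : Jet κ} (hJ : Ok J) (t : ℝ) (s y : κ → ℝ) (i : κ) :
    HasLineDerivAt ℝ (fun y => J.f1 i (t, s * y)) (s i * J.f2 i (t, s * y)) y (er i) := by
  unfold HasLineDerivAt
  have h := hJ.d2 i (t, s * y)
  have h1 : HasDerivAt (fun r : ℝ => r * s i) (s i) 0 := by simpa using (hasDerivAt_id (0:ℝ)).mul_const (s i)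
  have h' : HasDerivAt (fun r : ℝ => J.f1 i (t, s * y + r • er i)) (J.f2 i (t, s * y)) (0 * s i) := by simpa using h
  have := HasDerivAt.comp (0:ℝ) h' h1
  have e : (fun r : ℝ => J.f1 i (t, s * (y + r • er i))) = (fun r : ℝ => J.f1 i (t, s * y + r • er i)) ∘ fun r => r * s i := by
    funext r
    simp only [Function.comp]
    congr 2
    funext k
    by_cases hk : k = i
    · subst hk; simp [er_apply]; ring
    · simp [er_apply, hk]
  rw [e]
  exact this.congr_deriv (by ring)
def GI (g : Pt κ → ℝ) (t : ℝ) (s : κ → ℝ) : ℝ := ∫ y, g (t, s * y) * rho y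
lemma stein {J : Jet κ} (hJ : Ok J) (t : ℝ) (s : κ → ℝ) (i : κ) :
    ∫ y, (J.f1 i (t, s * y) * y i) * rho y = s i * GI (J.f2 i) t s := by
  rw [gibp (hJ.line2 t s · i) (by
    have := ((hJ.e2 i).int t s).const_mul (s i)
    refine this.congr (Eventually.of_forall fun y => ?_); simp; ring) ((hJ.e1 i).inty t s i) ((hJ.e1 i).int t s), GI, ← integral_const_mul]
  congr 1; funext y; ring
lemma heat {J : Jet κ} (hJ : Ok J) {s s' : ℝ → κ → ℝ} {t0 : ℝ} (hs : ∀ᶠ t in 𝓝 t0, HasDerivAt s (s' t) t)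
    (hs' : ContinuousAt s' t0) :
    HasDerivAt (fun t => GI J.f t (s t)) (GI J.ft t0 (s t0) + ∑ i, s' t0 i * s t0 i * GI (J.f2 i) t0 (s t0)) t0 := by
  have sc : ContinuousAt s t0 := hs.self_of_nhds.continuousAt
  set S := max (‖s t0‖ + 1) (‖s' t0‖ + 1) with hS
  have n1 : ∀ᶠ t in 𝓝 t0, ‖s t‖ ≤ S := by
    filter_upwards [sc.norm.eventually (gt_mem_nhds (lt_add_one ‖s t0‖))] with t ht
    exact ht.le.trans (le_max_left _ _)
  have n2 : ∀ᶠ t in 𝓝 t0, ‖s' t‖ ≤ S := by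
    filter_upwards [hs'.norm.eventually (gt_mem_nhds (lt_add_one ‖s' t0‖))] with t ht
    exact ht.le.trans (le_max_right _ _)
  have n3 : ∀ᶠ t in 𝓝 t0, |t| ≤ |t0| + 1 := by
    filter_upwards [(continuous_abs.tendsto t0).eventually (gt_mem_nhds (lt_add_one |t0|))] with t ht
    exact ht.le
  have S0 : 0 ≤ S := (by positivity : 0 ≤ ‖s t0‖ + 1).trans (le_max_left _ _)
  have eg : EG fun p => |J.ft p| + ∑ i, |J.f1 i p| := hJ.et.abs.add (EG.sum _ fun i => (hJ.e1 i).abs)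
  obtain ⟨C, R, C0, R0, b⟩ := eg.scale (|t0| + 1) S
  have key := hasDerivAt_integral_of_dominated_loc_of_deriv_le (μ := (volume : Measure (κ → ℝ))) (x₀ := t0)
    (F := fun t y => J.f (t, s t * y) * rho y)
    (F' := fun t y => (J.ft (t, s t * y) + ∑ i, J.f1 i (t, s t * y) * (s' t i * y i)) * rho y)
    (bound := fun y => ((1 + S) * C) * (exp ((R + 1) * ‖y‖) * rho y))
    (hs.and (n1.and (n2.and n3)))
    (Eventually.of_forall fun t => ((hJ.ef.contS t (s t)).mul rho_cont).aestronglyMeasurable)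
    (hJ.ef.int t0 (s t0))
    (by
      have c1 := hJ.et.contS t0 (s t0)
      have c2 := fun i => (hJ.e1 i).contS t0 (s t0)
      have := rho_cont (κ := κ)
      exact (by fun_prop : Continuous _).aestronglyMeasurable)
    (Eventually.of_forall fun y t ht => by
      obtain ⟨-, h1, h2, h3⟩ := ht
      rw [norm_mul, Real.norm_eq_abs, Real.norm_eq_abs, abs_of_pos (rho_pos y), ← mul_assoc]
      refine mlR ?_ (rho_pos y).le
      have hb := b t (s t) y h3 h1
      have p0 : 0 ≤ |J.ft (t, s t * y)| + ∑ i, |J.f1 i (t, s t * y)| := by positivity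
      rw [abs_of_nonneg p0] at hb
      have ey : 1 + ‖y‖ ≤ exp ‖y‖ := by linarith [Real.add_one_le_exp ‖y‖]
      have y0 := norm_nonneg y
      have s1 : ∑ i, |J.f1 i (t, s t * y) * (s' t i * y i)| ≤ (∑ i, |J.f1 i (t, s t * y)|) * (S * ‖y‖) := by
        rw [sum_mul]
        refine sum_le_sum fun i _ => ?_
        rw [abs_mul, abs_mul]
        have a1 : |s' t i| ≤ S := (norm_le_pi_norm (s' t) i).trans h2
        have a2 : |y i| ≤ ‖y‖ := norm_le_pi_norm y i
        gcongr
      calc |J.ft (t, s t * y) + ∑ i, J.f1 i (t, s t * y) * (s' t i * y i)|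
          ≤ |J.ft (t, s t * y)| + (∑ i, |J.f1 i (t, s t * y)|) * (S * ‖y‖) :=
            (abs_add_le _ _).trans (by gcongr; exact (Finset.abs_sum_le_sum_abs _ _).trans s1)
        _ ≤ (|J.ft (t, s t * y)| + ∑ i, |J.f1 i (t, s t * y)|) * ((1 + S) * exp ‖y‖) := by
            rw [add_mul]
            have q1 : 1 ≤ (1 + S) * exp ‖y‖ := by nlinarith [exp_pos ‖y‖]
            have q2 : S * ‖y‖ ≤ (1 + S) * exp ‖y‖ := by nlinarith [exp_pos ‖y‖]
            have q3 : 0 ≤ ∑ i, |J.f1 i (t, s t * y)| := by positivity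
            exact add_le_add (le_mul_of_one_le_right (abs_nonneg _) q1) (mlL q2 q3)
        _ ≤ (C * exp (R * ‖y‖)) * ((1 + S) * exp ‖y‖) := by gcongr
        _ = _ := by rw [show (R+1)*‖y‖ = R*‖y‖ + ‖y‖ by ring, exp_add]; ring)
    ((gdom _).const_mul _)
    (Eventually.of_forall fun y t ht => by
      have h1 : HasDerivAt (fun t => ((t, s t * y) : Pt κ)) (1, s' t * y) t :=
        (hasDerivAt_id t).prodMk (ht.1.mul_const y)
      have h2 := ((hJ.d (t, s t * y)).comp_hasDerivAt t h1).mul_const (rho y)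
      refine h2.congr_deriv ?_
      rw [lin_apply]; simp)
  refine key.2.congr_deriv ?_
  have i1 := hJ.et.int t0 (s t0)
  have i2 := fun i => ((hJ.e1 i).inty t0 (s t0) i).const_mul (s' t0 i)
  have e : (fun y => (J.ft (t0, s t0 * y) + ∑ i, J.f1 i (t0, s t0 * y) * (s' t0 i * y i)) * rho y) =
      fun y => J.ft (t0, s t0 * y) * rho y + ∑ i, s' t0 i * ((J.f1 i (t0, s t0 * y) * y i) * rho y) := by
    funext y; rw [add_mul, sum_mul]; congr 1; exact sum_congr rfl fun i _ => by ring
  rw [e, integral_add i1 (integrable_finsetSum _ fun i _ => i2 i), integral_finsetSum _ fun i _ => i2 i]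
  congr 1
  refine sum_congr rfl fun i _ => ?_
  rw [integral_const_mul, stein hJ]; ring
lemma GI_cont {g : Pt κ → ℝ} (hg : EG g) {s : ℝ → κ → ℝ} {a b : ℝ} (hs : ContinuousOn s (Set.Icc a b)) :
    ContinuousOn (fun t => GI g t (s t)) (Set.Icc a b) := by
  obtain ⟨S, hS⟩ := isCompact_Icc.exists_bound_of_continuousOn hs
  obtain ⟨C, R, C0, R0, bd⟩ := hg.scale (max |a| |b|) S
  refine continuousOn_of_dominated (bound := fun y => C * (exp (R * ‖y‖) * rho y)) (fun t ht => ?_) (fun t ht => ?_)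
    ((gdom R).const_mul C) ?_
  · exact ((hg.contS t (s t)).mul rho_cont).aestronglyMeasurable
  · refine Eventually.of_forall fun y => ?_
    rw [norm_mul, Real.norm_eq_abs, Real.norm_eq_abs, abs_of_pos (rho_pos y), ← mul_assoc]
    refine mlR (bd t (s t) y ?_ (hS t ht)) (rho_pos y).le
    exact abs_le_max_abs_abs ht.1 ht.2
  · refine Eventually.of_forall fun y => ?_
    refine ContinuousOn.mul (hg.1.comp_continuousOn ?_) continuousOn_const
    exact continuousOn_id.prodMk (hs.mul continuousOn_const)
end
section
variable {ι : Type} [Fintype ι] [DecidableEq ι]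
def ex (x : ι → ℝ) : Pt (ι ⊕ ι) →L[ℝ] ℝ := lin (-(∑ k, x k ^ 2) / 2) (Sum.elim x fun _ => 0)
lemma ex_apply (x : ι → ℝ) (p : Pt (ι ⊕ ι)) : ex x p = -(∑ k, x k ^ 2) / 2 * p.1 + ∑ k, x k * p.2 (Sum.inl k) := by
  rw [ex, lin_apply]; simp
lemma ex_cont : Continuous (ex : (ι → ℝ) → _) := by
  unfold ex lin
  refine Continuous.add (by fun_prop) (continuous_finset_sum _ fun i _ => ?_)
  refine Continuous.smul (f := fun x : ι → ℝ => (Sum.elim x (fun _ => (0:ℝ)) : ι ⊕ ι → ℝ) i) ?_ continuous_const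
  rcases i with i | i
  · simp only [Sum.elim_inl]; fun_prop
  · simp only [Sum.elim_inr]; fun_prop
def Im (K : Set (ι → ℝ)) (f : (ι → ℝ) → ℝ) (p : Pt (ι ⊕ ι)) : ℝ := ∫ x in K, f x * exp (ex x p)
lemma ex_wt (x : ι → ℝ) (p : Pt (ι ⊕ ι)) : exp (ex x p) = wt p.1 (fun i => p.2 (Sum.inl i)) x := by
  rw [ex_apply, wt]; congr 1
  have : ∑ k, x k * p.2 (Sum.inl k) = ∑ k, p.2 (Sum.inl k) * x k := sum_congr rfl fun _ _ => mul_comm _ _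
  rw [this]; ring
variable {K : Set (ι → ℝ)}
lemma fex_cont {f : (ι → ℝ) → ℝ} (hf : Continuous f) :
    Continuous (fun q : Pt (ι ⊕ ι) × (ι → ℝ) => f q.2 * exp (ex q.2 q.1)) := by
  have := ex_cont (ι := ι)
  have h : Continuous fun q : Pt (ι ⊕ ι) × (ι → ℝ) => ex q.2 q.1 := (this.comp continuous_snd).clm_apply continuous_fst
  fun_prop
lemma fex_int (hK : IsCompact K) {f : (ι → ℝ) → ℝ} (hf : Continuous f) (p : Pt (ι ⊕ ι)) :
    IntegrableOn (fun x => f x * exp (ex x p)) K :=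
  ((fex_cont hf).comp (by fun_prop : Continuous fun x : ι → ℝ => (p, x))).continuousOn.integrableOn_compact hK
lemma Im_cont (hK : IsCompact K) {f : (ι → ℝ) → ℝ} (hf : Continuous f) : Continuous (Im K f) :=
  continuous_parametric_integral_of_continuous (f := fun p x => f x * exp (ex x p)) (fex_cont hf) hK
lemma Im_add (hK : IsCompact K) {f g : (ι → ℝ) → ℝ} (hf : Continuous f) (hg : Continuous g) (p) :
    Im K (fun x => f x + g x) p = Im K f p + Im K g p := by
  unfold Im
  rw [← integral_add (fex_int hK hf p) (fex_int hK hg p)]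
  congr 1; funext x; ring
lemma Im_mul (c : ℝ) (f : (ι → ℝ) → ℝ) (p) : Im K (fun x => c * f x) p = c * Im K f p := by
  unfold Im
  rw [← integral_const_mul]; congr 1; funext x; ring
lemma Im_sum (hK : IsCompact K) {α : Type} (s : Finset α) {f : α → (ι → ℝ) → ℝ} (hf : ∀ a, Continuous (f a)) (p) :
    Im K (fun x => ∑ a ∈ s, f a x) p = ∑ a ∈ s, Im K (f a) p := by
  unfold Im
  rw [← integral_finsetSum _ fun a _ => fex_int hK (hf a) p]
  congr 1; funext x; rw [sum_mul]
lemma ex_bound (hK : IsCompact K) (T : ℝ) : ∃ M R : ℝ, 0 ≤ R ∧ ∀ x ∈ K, ∀ p : Pt (ι ⊕ ι), |p.1| ≤ T → |ex x p| ≤ M + R * ‖p.2‖ := by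
  obtain ⟨R, hR⟩ := hK.exists_bound_of_continuousOn (f := ex) ex_cont.continuousOn
  refine ⟨|R| * |T|, |R|, abs_nonneg _, fun x hx p hp => ?_⟩
  have h := (ex x).le_opNorm p
  rw [Real.norm_eq_abs] at h
  have hp' : ‖p‖ ≤ |T| + ‖p.2‖ := by
    rw [Prod.norm_def]
    refine max_le ?_ ?_
    · rw [Real.norm_eq_abs]; linarith [le_abs_self T, norm_nonneg p.2]
    · linarith [abs_nonneg T]
  calc |ex x p| ≤ ‖ex x‖ * ‖p‖ := h
    _ ≤ |R| * (|T| + ‖p.2‖) := mul_le_mul ((hR x hx).trans (le_abs_self R)) hp' (norm_nonneg _) (abs_nonneg _)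
    _ = _ := by ring
lemma Im_EG (hK : IsCompact K) {f : (ι → ℝ) → ℝ} (hf : Continuous f) : EG (Im K f) := by
  refine ⟨Im_cont hK hf, fun T => ?_⟩
  obtain ⟨M, R, R0, hb⟩ := ex_bound hK T
  obtain ⟨N, hN⟩ := hK.exists_bound_of_continuousOn (f := f) hf.continuousOn
  refine ⟨|N| * exp M * volume.real K, R, by positivity, R0, fun p hp => ?_⟩
  have := norm_setIntegral_le_of_norm_le_const (μ := volume) (s := K) (f := fun x => f x * exp (ex x p)) (C := |N| * exp (M + R * ‖p.2‖))
    hK.measure_lt_top (fun x hx => by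
      rw [norm_mul]
      refine mul_le_mul ((hN x hx).trans (le_abs_self N)) ?_ (norm_nonneg _) (abs_nonneg _)
      rw [Real.norm_eq_abs, Real.abs_exp]
      exact exp_le_exp.2 ((le_abs_self _).trans (hb x hx p hp)))
  rw [exp_add] at this
  refine this.trans (le_of_eq ?_)
  ring
lemma Im_LB (hK : IsCompact K) (h0 : 0 < volume.real K) : LB (Im K fun _ => 1) := by
  have key : ∀ T : ℝ, ∃ M R : ℝ, 0 ≤ R ∧ ∀ p : Pt (ι ⊕ ι), |p.1| ≤ T →
      volume.real K * exp (-(M + R * ‖p.2‖)) ≤ Im K (fun _ => 1) p := by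
    intro T
    obtain ⟨M, R, R0, hb⟩ := ex_bound hK T
    refine ⟨M, R, R0, fun p hp => ?_⟩
    have := setIntegral_mono_on (μ := volume) (s := K) (f := fun _ => exp (-(M + R * ‖p.2‖)))
      (g := fun x => 1 * exp (ex x p)) (by exact integrableOn_const hK.measure_lt_top.ne) (fex_int hK continuous_const p) hK.measurableSet
      (fun x hx => by
        rw [one_mul]; exact exp_le_exp.2 (by linarith [neg_abs_le (ex x p), hb x hx p hp]))
    rw [setIntegral_const, smul_eq_mul] at this
    exact this
  refine ⟨fun p => ?_, fun T => ?_⟩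
  · obtain ⟨M, R, _, h⟩ := key |p.1|
    exact (by positivity : 0 < volume.real K * exp (-(M + R * ‖p.2‖))).trans_le (h p le_rfl)
  · obtain ⟨M, R, R0, h⟩ := key T
    refine ⟨(volume.real K)⁻¹ * exp M, R, by positivity, R0, fun p hp => ?_⟩
    refine (inv_anti₀ (by positivity) (h p hp)).trans (le_of_eq ?_)
    rw [mul_inv, ← Real.exp_neg, neg_neg, exp_add]; ring
def Mj (K : Set (ι → ℝ)) (f : (ι → ℝ) → ℝ) : Jet (ι ⊕ ι) :=
  ⟨Im K f, Im K (fun x => -(∑ k, x k ^ 2) / 2 * f x),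
    Sum.elim (fun i => Im K (fun x => x i * f x)) (fun _ _ => 0),
    Sum.elim (fun i => Im K (fun x => x i * (x i * f x))) (fun _ _ => 0)⟩
lemma Im_d (hK : IsCompact K) {f : (ι → ℝ) → ℝ} (hf : Continuous f) (p : Pt (ι ⊕ ι)) :
    HasFDerivAt (Im K f) (lin ((Mj K f).ft p) fun i => (Mj K f).f1 i p) p := by
  have hc : Continuous fun q : Pt (ι ⊕ ι) × (ι → ℝ) => (f q.2 * exp (ex q.2 q.1)) • ex q.2 :=
    (fex_cont hf).smul (ex_cont.comp continuous_snd)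
  obtain ⟨N, hN⟩ := ((isCompact_closedBall p 1).prod hK).exists_bound_of_continuousOn hc.continuousOn
  have hi : IntegrableOn (fun x => (f x * exp (ex x p)) • ex x) K :=
    ((hc.comp (by fun_prop : Continuous fun x : ι → ℝ => (p, x))).continuousOn.integrableOn_compact hK)
  have key := hasFDerivAt_integral_of_dominated_of_fderiv_le (𝕜 := ℝ) (μ := volume.restrict K) (x₀ := p)
    (F := fun p x => f x * exp (ex x p)) (F' := fun p x => (f x * exp (ex x p)) • ex x)
    (bound := fun _ => N) (Metric.ball_mem_nhds p one_pos)
    (Eventually.of_forall fun p => (fex_int hK hf p).1) (fex_int hK hf p) hi.1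
    ((ae_restrict_iff' hK.measurableSet).2 (Eventually.of_forall fun x hx q hq => hN (q, x) ⟨Metric.ball_subset_closedBall hq, hx⟩))
    (by have := hK.measure_lt_top (μ := volume); exact integrableOn_const this.ne)
    (Eventually.of_forall fun x q _ => by
      refine (((ex x).hasFDerivAt (x := q)).exp.const_mul (f x)).congr_fderiv ?_
      refine ContinuousLinearMap.ext fun v => ?_
      simp [mul_assoc])
  refine key.congr_fderiv (ContinuousLinearMap.ext fun v => ?_)
  rw [ContinuousLinearMap.integral_apply hi, lin_apply]
  have e : (fun x => ((f x * exp (ex x p)) • ex x) v) = fun x =>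
      v.1 * ((-(∑ k, x k ^ 2) / 2 * f x) * exp (ex x p)) + ∑ k, v.2 (Sum.inl k) * ((x k * f x) * exp (ex x p)) := by
    funext x
    simp only [ContinuousLinearMap.smul_apply, smul_eq_mul]
    rw [ex_apply x v, mul_add, mul_sum]
    congr 1
    · ring
    · exact sum_congr rfl fun k _ => by ring
  have i1 := fex_int hK (f := fun x : ι → ℝ => -(∑ k, x k ^ 2) / 2 * f x) (by fun_prop) p
  have i2 := fun k => fex_int hK (f := fun x : ι → ℝ => x k * f x) (by fun_prop) p
  rw [e, integral_add (i1.const_mul _) (integrable_finsetSum _ fun k _ => (i2 k).const_mul _),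
    integral_finsetSum _ fun k _ => (i2 k).const_mul _]
  simp only [integral_const_mul, Fintype.sum_sum_type]
  simp [Mj, Im, mul_comm]
lemma line_of_d {κ : Type} [Fintype κ] [DecidableEq κ] {g : Pt κ → ℝ} {a : ℝ} {b : κ → ℝ} {p : Pt κ} (h : HasFDerivAt g (lin a b) p) (i : κ) :
    HasDerivAt (fun r : ℝ => g (p.1, p.2 + r • er i)) (b i) 0 := by
  have h1 : HasDerivAt (fun r : ℝ => ((p.1, p.2 + r • er i) : Pt κ)) (0, er i) 0 := by
    refine (hasDerivAt_const _ _).prodMk ?_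
    simpa using ((hasDerivAt_id (0:ℝ)).smul_const (er i : κ → ℝ)).const_add p.2
  have h2 : HasFDerivAt g (lin a b) (p.1, p.2 + (0:ℝ) • er i) := by simpa using h
  have h3 := h2.comp_hasDerivAt (0:ℝ) h1
  refine h3.congr_deriv ?_
  rw [lin_apply]; simp [er_apply]
lemma Mj_ok (hK : IsCompact K) {f : (ι → ℝ) → ℝ} (hf : Continuous f) : Ok (Mj K f) where
  d p := Im_d hK hf p
  d2 i p := by
    rcases i with i | i
    · exact line_of_d (Im_d hK (f := fun x => x i * f x) (by fun_prop) p) (Sum.inl i)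
    · exact hasDerivAt_const _ _
  ef := Im_EG hK hf
  et := Im_EG hK (by fun_prop)
  e1 i := by
    rcases i with i | i
    · exact Im_EG hK (by fun_prop)
    · exact EG.const 0
  e2 i := by
    rcases i with i | i
    · exact Im_EG hK (by fun_prop)
    · exact EG.const 0
def Xj {κ : Type} [DecidableEq κ] (i : κ) : Jet κ := ⟨fun p => p.2 i, fun _ => 0, fun j _ => if j = i then 1 else 0, fun _ _ => 0⟩
lemma Xj_ok {κ : Type} [Fintype κ] [DecidableEq κ] (i : κ) : Ok (Xj i) where
  d p := by
    have := (((ContinuousLinearMap.proj (R := ℝ) (φ := fun _ : κ => ℝ) i).comp (ContinuousLinearMap.snd ℝ ℝ (κ → ℝ))).hasFDerivAt (x := p))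
    refine this.congr_fderiv (ContinuousLinearMap.ext fun v => ?_)
    rw [lin_apply]; simp [Xj]
  d2 j p := hasDerivAt_const _ _
  ef := ⟨by unfold Xj; fun_prop, fun T => ⟨1, 1, by simp, by simp, fun p _ => by
    have : |p.2 i| ≤ ‖p.2‖ := norm_le_pi_norm p.2 i
    have := Real.add_one_le_exp (1 * ‖p.2‖)
    simp only [Xj]; linarith⟩⟩
  et := EG.const 0
  e1 j := EG.const _
  e2 j := EG.const 0
end
section
variable {ι : Type} [Fintype ι] [DecidableEq ι]
def HH (J : Jet (ι ⊕ ι)) (p : Pt (ι ⊕ ι)) : ℝ :=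
  J.ft p + 1 / 2 * ∑ i, J.f2 (Sum.inl i) p - 1 / 8 * ∑ i, J.f2 (Sum.inr i) p
def Gam (J K : Jet (ι ⊕ ι)) (p : Pt (ι ⊕ ι)) : ℝ :=
  ∑ i, J.f1 (Sum.inl i) p * K.f1 (Sum.inl i) p - 1 / 4 * ∑ i, J.f1 (Sum.inr i) p * K.f1 (Sum.inr i) p
lemma HH_add (J K : Jet (ι ⊕ ι)) (p) : HH (J + K) p = HH J p + HH K p := by
  simp [HH, sum_add_distrib]; ring
lemma HH_neg (J : Jet (ι ⊕ ι)) (p) : HH (-J) p = -HH J p := by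
  simp [HH]; ring
lemma HH_mul (J K : Jet (ι ⊕ ι)) (p) : HH (J * K) p = J.f p * HH K p + K.f p * HH J p + Gam J K p := by
  simp [HH, Gam, sum_add_distrib, ← mul_sum, ← sum_mul]; ring
lemma Ok.hh {J : Jet (ι ⊕ ι)} (h : Ok J) : EG (HH J) := by
  have := ((h.et.add ((EG.const (1/2)).mul (EG.sum Finset.univ fun i => h.e2 (Sum.inl i)))).add
    ((EG.const (1/8)).mul (EG.sum Finset.univ fun i => h.e2 (Sum.inr i))).neg)
  have e : HH J = fun p => J.ft p + 1 / 2 * ∑ a, J.f2 (Sum.inl a) p + -(1 / 8 * ∑ a, J.f2 (Sum.inr a) p) := by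
    funext p; simp only [HH, sub_eq_add_neg]
  rw [e]; exact this
variable {K : Set (ι → ℝ)}
lemma HH_Mj (hK : IsCompact K) {f : (ι → ℝ) → ℝ} (hf : Continuous f) (p) : HH (Mj K f) p = 0 := by
  simp only [HH, Mj, Sum.elim_inl, Sum.elim_inr]
  rw [← Im_sum hK _ (fun i => by fun_prop), ← Im_mul, ← Im_add hK (by fun_prop) (by fun_prop)]
  have : (fun x : ι → ℝ => -(∑ k, x k ^ 2) / 2 * f x + 1 / 2 * ∑ a, x a * (x a * f x)) = fun x => 0 * 1 := by
    funext x
    have : ∑ a, x a * (x a * f x) = (∑ a, x a ^ 2) * f x := by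
      rw [sum_mul]; exact sum_congr rfl fun _ _ => by ring
    rw [this]; ring
  rw [this, Im_mul]; simp
variable (K) in
def Zj : Jet (ι ⊕ ι) := Mj K fun _ => 1
variable (K) in
def Ef (f : (ι → ℝ) → ℝ) : Jet (ι ⊕ ι) := Mj K f * (Zj K).inv
variable (K) in
def aj (i : ι) : Jet (ι ⊕ ι) := Ef K fun x => x i
variable (K) in
def Aj (i j : ι) : Jet (ι ⊕ ι) := Ef K (fun x => x i * x j) - aj K i * aj K j
variable (K) in
def Ep (p : Pt (ι ⊕ ι)) (F : (ι → ℝ) → ℝ) : ℝ := (Ef K F).f p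
variable (K) in
def LL (J : Jet (ι ⊕ ι)) (p : Pt (ι ⊕ ι)) : ℝ := HH J p + ∑ i, (aj K i).f p * J.f1 (Sum.inl i) p
lemma inv_mul {κ : Type} {J : Jet κ} (h : ∀ p, J.f p ≠ 0) : J.inv * J = 1 := by
  ext p
  · simp [Jet.inv, Jet.comp, h p]
  · simp [Jet.inv, Jet.comp]; field_simp [h p]; ring
  · rename_i q; simp [Jet.inv, Jet.comp]; field_simp [h q]; ring
  · rename_i q; simp [Jet.inv, Jet.comp]; field_simp [h q]; ring
variable (hK : IsCompact K) (h0 : 0 < volume.real K)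
lemma Z_pos (hK : IsCompact K) (h0 : 0 < volume.real K) (p) : 0 < (Zj K).f p := (Im_LB hK h0).1 p
lemma Z_ok (hK : IsCompact K) : Ok (Zj K) := Mj_ok hK continuous_const
lemma Ef_Z (hK : IsCompact K) (h0 : 0 < volume.real K) (f : (ι → ℝ) → ℝ) : Ef K f * Zj K = Mj K f := by
  rw [Ef, mul_assoc, inv_mul fun p => (Z_pos hK h0 p).ne', mul_one]
lemma Ef_ok (hK : IsCompact K) (h0 : 0 < volume.real K) {f : (ι → ℝ) → ℝ} (hf : Continuous f) : Ok (Ef K f) :=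
  (Mj_ok hK hf).mul ((Z_ok hK).inv (Im_LB hK h0))
lemma aj_ok (hK : IsCompact K) (h0 : 0 < volume.real K) (i) : Ok (aj K i) := Ef_ok hK h0 (by fun_prop)
lemma Aj_ok (hK : IsCompact K) (h0 : 0 < volume.real K) (i j) : Ok (Aj K i j) :=
  (Ef_ok hK h0 (by fun_prop)).sub ((aj_ok hK h0 i).mul (aj_ok hK h0 j))
lemma Ok.ll {J : Jet (ι ⊕ ι)} (h : Ok J) (hK : IsCompact K) (h0 : 0 < volume.real K) : EG (LL K J) :=
  h.hh.add (EG.sum Finset.univ fun i => (aj_ok hK h0 i).ef.mul (h.e1 (Sum.inl i)))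
lemma Ep_eq (F : (ι → ℝ) → ℝ) (p) : Ep K p F = Im K F p * (Im K (fun _ => 1) p)⁻¹ := rfl
lemma isExp_Ep (hK : IsCompact K) (h0 : 0 < volume.real K) (p) : IsExp (Ep K p) where
  add F G hF hG := by simp only [Ep_eq, Im_add hK hF hG]; ring
  mul c F := by simp only [Ep_eq, Im_mul]; ring
  nonneg F hF := by
    rw [Ep_eq]
    refine mul_nonneg (integral_nonneg fun x => mul_nonneg (hF x) (exp_pos _).le) (inv_nonneg.2 (Z_pos hK h0 p).le)
  one := mul_inv_cancel₀ (Z_pos hK h0 p).ne'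
lemma Ep_PIf [Nonempty ι] (hK : IsCompact K) (hc : Convex ℝ K) (hi : (interior K).Nonempty) (h0 : 0 < volume.real K) (p) : PIf p.1 (Ep K p) := by
  have h := PIf_body hK hc hi p.1 (fun i => p.2 (Sum.inl i))
  set T : ((ι → ℝ) → ℝ) → ℝ := fun F => ∫ x in K, F x * wt p.1 (fun i => p.2 (Sum.inl i)) x with hT
  have eT : ∀ F, Ep K p F = (Im K (fun _ => 1) p)⁻¹ * T F := by
    intro F
    rw [Ep_eq, mul_comm]; congr 1
    simp only [Im, hT]; congr 1; funext x; rw [ex_wt]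
  set c := (Im K (fun _ => 1) p)⁻¹ with hc'
  have c0 : 0 < c := inv_pos.2 (Z_pos hK h0 p)
  intro a l1 ha hl hcov hlt H q
  have := h a l1 ha hl (fun v => ?_) hlt H q
  · simp only [eT]
    have := mlL this (sq_nonneg c)
    nlinarith [this]
  · have := hcov v
    have e : ∑ i, ∑ j, v i * v j * covT (Ep K p) i j = c ^ 2 * ∑ i, ∑ j, v i * v j * covT T i j := by
      simp only [mul_sum]
      refine sum_congr rfl fun i _ => sum_congr rfl fun j _ => ?_
      simp only [covT, eT]; ring
    rw [e, eT] at this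
    have c2 : 0 < c ^ 2 := by positivity
    refine le_of_mul_le_mul_left ?_ c2
    linarith
lemma Zf1_inl (hK : IsCompact K) (h0 : 0 < volume.real K) (i) (p) : (Zj K).f1 (Sum.inl i) p = (aj K i).f p * (Zj K).f p := by
  have : (Ef K (fun x => x i) * Zj K).f p = _ := congrArg (fun J => Jet.f J p) (Ef_Z hK h0 (fun x => x i))
  rw [Jet.mul_f] at this
  rw [aj, this]; simp [Zj, Mj]
lemma HH_Z (hK : IsCompact K) (h0 : 0 < volume.real K) (J : Jet (ι ⊕ ι)) (p) : HH (J * Zj K) p = LL K J p * (Zj K).f p := by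
  rw [HH_mul, Zj, HH_Mj hK continuous_const, ← Zj, LL, Gam]
  simp only [Zf1_inl hK h0]
  have : ∀ i, (Zj K).f1 (Sum.inr i) p = 0 := fun i => rfl
  simp only [this]
  rw [add_mul, sum_mul]
  have : ∀ i, J.f1 (Sum.inl i) p * ((aj K i).f p * (Zj K).f p) = (aj K i).f p * J.f1 (Sum.inl i) p * (Zj K).f p := fun i => by ring
  simp only [this]; simp; ring
lemma LL_add (J M : Jet (ι ⊕ ι)) (p) : LL K (J + M) p = LL K J p + LL K M p := by
  simp [LL, HH_add, mul_add, sum_add_distrib]; ring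
lemma LL_neg (J : Jet (ι ⊕ ι)) (p) : LL K (-J) p = -LL K J p := by
  simp [LL, HH_neg]; ring
lemma LL_mul (J M : Jet (ι ⊕ ι)) (p) : LL K (J * M) p = J.f p * LL K M p + M.f p * LL K J p + Gam J M p := by
  have e : ∀ i, (aj K i).f p * (J * M).f1 (Sum.inl i) p = J.f p * ((aj K i).f p * M.f1 (Sum.inl i) p) + M.f p * ((aj K i).f p * J.f1 (Sum.inl i) p) := fun i => by
    rw [Jet.mul_f1]; ring
  simp only [LL, HH_mul, e, sum_add_distrib, ← mul_sum]; ring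
lemma LL_Ef (hK : IsCompact K) (h0 : 0 < volume.real K) {f : (ι → ℝ) → ℝ} (hf : Continuous f) (p) : LL K (Ef K f) p = 0 := by
  have := HH_Z hK h0 (Ef K f) p
  rw [Ef_Z hK h0, HH_Mj hK hf] at this
  exact (mul_eq_zero.1 this.symm).resolve_right (Z_pos hK h0 p).ne'
lemma Ef_inr (f : (ι → ℝ) → ℝ) (i) (p) : (Ef K f).f1 (Sum.inr i) p = 0 := by
  simp [Ef, Mj, Zj, Jet.inv, Jet.comp]
lemma Ef_inl (hK : IsCompact K) (h0 : 0 < volume.real K) (f : (ι → ℝ) → ℝ) (i) (p) :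
    (Ef K f).f1 (Sum.inl i) p = Ep K p (fun x => x i * f x) - Ep K p f * mn (Ep K p) i := by
  have h1 : (Ef K f * Zj K).f1 (Sum.inl i) p = _ := congrArg (fun J => Jet.f1 J (Sum.inl i) p) (Ef_Z hK h0 f)
  have h2 : (Ef K (fun x => x i * f x) * Zj K).f p = _ := congrArg (fun J => Jet.f J p) (Ef_Z hK h0 (fun x => x i * f x))
  rw [Jet.mul_f1, Zf1_inl hK h0] at h1
  rw [Jet.mul_f] at h2
  have e : (Mj K f).f1 (Sum.inl i) p = (Mj K (fun x => x i * f x)).f p := rfl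
  have z := (Z_pos hK h0 p).ne'
  have : (Ef K f).f1 (Sum.inl i) p * (Zj K).f p = (Ep K p (fun x => x i * f x) - Ep K p f * mn (Ep K p) i) * (Zj K).f p := by
    simp only [Ep, mn] at *
    simp only [e, ← h2] at h1
    rw [sub_mul]
    have : (aj K i).f p = (Ef K fun x => x i).f p := rfl
    rw [this] at h1
    linarith
  exact mul_right_cancel₀ z this
lemma aj_f (i) (p) : (aj K i).f p = mn (Ep K p) i := rfl
lemma Aj_f (hK : IsCompact K) (h0 : 0 < volume.real K) (i j) (p) : (Aj K i j).f p = Cv (Ep K p) i j := by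
  rw [Cv_eq (isExp_Ep hK h0 p), Aj, sub_eq_add_neg]; simp only [Jet.add_f, Jet.neg_f, Jet.mul_f]; simp only [aj_f, Ep]; ring
lemma aj_inl (hK : IsCompact K) (h0 : 0 < volume.real K) (i k) (p) : (aj K i).f1 (Sum.inl k) p = Cv (Ep K p) k i := by
  rw [aj, Ef_inl hK h0, Cv_eq (isExp_Ep hK h0 p)]; simp only [mn]; ring
lemma aj_inr (i k) (p) : (aj K i).f1 (Sum.inr k) p = 0 := Ef_inr _ _ _
lemma LL_aj (hK : IsCompact K) (h0 : 0 < volume.real K) (i) (p) : LL K (aj K i) p = 0 := LL_Ef hK h0 (by fun_prop) p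
lemma Cv_symm {E : ((ι → ℝ) → ℝ) → ℝ} (i j) : Cv E i j = Cv E j i := by
  unfold Cv; congr 1; funext x; ring
lemma Aj_inl (hK : IsCompact K) (h0 : 0 < volume.real K) (i j k) (p) : (Aj K i j).f1 (Sum.inl k) p = Tm (Ep K p) i j k := by
  rw [Tm_eq (isExp_Ep hK h0 p), Aj, sub_eq_add_neg]
  simp only [Jet.add_f1, Jet.neg_f1, Jet.mul_f1, aj_inl hK h0, aj_f, Ef_inl hK h0]
  rw [Cv_symm k j, Cv_symm k i]
  have : (fun x : ι → ℝ => x k * (x i * x j)) = fun x => x i * x j * x k := by funext x; ring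
  rw [this]; ring
lemma Aj_inr (i j k) (p) : (Aj K i j).f1 (Sum.inr k) p = 0 := by
  rw [Aj, sub_eq_add_neg]; simp [aj_inr, Ef_inr]
lemma LL_Aj (hK : IsCompact K) (h0 : 0 < volume.real K) (i j) (p) :
    LL K (Aj K i j) p = -∑ k, Cv (Ep K p) i k * Cv (Ep K p) k j := by
  rw [Aj, sub_eq_add_neg, LL_add, LL_neg, LL_mul, LL_aj hK h0, LL_aj hK h0, LL_Ef hK h0 (by fun_prop), Gam]
  simp only [aj_inr, aj_inl hK h0]
  simp only [Cv_symm (E := Ep K p) i]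
  simp
lemma LL_C (c : ℝ) (p) : LL K (Jet.C c) p = 0 := by simp [LL, HH, Jet.C]
lemma comp_LL (J : Jet (ι ⊕ ι)) (φ φ1 φ2 : ℝ → ℝ) (p) :
    LL K (J.comp φ φ1 φ2) p = φ1 (J.f p) * LL K J p + 1 / 2 * φ2 (J.f p) * Gam J J p := by
  simp only [LL, HH, Gam, Jet.comp, sum_add_distrib, ← mul_sum]
  have e : ∀ i, (aj K i).f p * (φ1 (J.f p) * J.f1 (Sum.inl i) p) = φ1 (J.f p) * ((aj K i).f p * J.f1 (Sum.inl i) p) := fun i => by ring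
  have e2 : ∀ k, J.f1 k p * J.f1 k p = J.f1 k p ^ 2 := fun k => by ring
  simp only [e, e2, ← mul_sum]
  ring
end
section
variable {ι : Type} [Fintype ι] [DecidableEq ι]
def sT (T t : ℝ) : ι ⊕ ι → ℝ := Sum.elim (fun _ => √t) (fun _ => √(T / 3 - t / 4))
def sT' (T t : ℝ) : ι ⊕ ι → ℝ := Sum.elim (fun _ => 1 / (2 * √t)) (fun _ => -(1/4) / (2 * √(T / 3 - t / 4)))
lemma sT_cont (T : ℝ) : Continuous (sT T : ℝ → ι ⊕ ι → ℝ) := by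
  refine continuous_pi fun i => ?_
  rcases i with i | i <;> simp only [sT, Sum.elim_inl, Sum.elim_inr] <;> fun_prop
lemma GI_add {κ : Type} [Fintype κ] [DecidableEq κ] {g h : Pt κ → ℝ} (hg : EG g) (hh : EG h) (t s) :
    GI (fun p => g p + h p) t s = GI g t s + GI h t s := by
  unfold GI
  rw [← integral_add (hg.int t s) (hh.int t s)]; congr 1; funext y; ring
lemma GI_mul {κ : Type} [Fintype κ] (c : ℝ) (g : Pt κ → ℝ) (t s) : GI (fun p => c * g p) t s = c * GI g t s := by
  unfold GI
  rw [← integral_const_mul]; congr 1; funext y; ring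
lemma GI_sum {κ : Type} [Fintype κ] [DecidableEq κ] {α : Type} (S : Finset α) {g : α → Pt κ → ℝ} (hg : ∀ a, EG (g a)) (t s) :
    GI (fun p => ∑ a ∈ S, g a p) t s = ∑ a ∈ S, GI (g a) t s := by
  unfold GI
  rw [← integral_finsetSum _ fun a _ => (hg a).int t s]; congr 1; funext y; rw [sum_mul]
lemma GI_mono {κ : Type} [Fintype κ] [DecidableEq κ] {g h : Pt κ → ℝ} (hg : EG g) (hh : EG h) (t s) (hle : ∀ p : Pt κ, p.1 = t → g p ≤ h p) :
    GI g t s ≤ GI h t s :=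
  integral_mono (hg.int t s) (hh.int t s) fun y => mlR (hle _ rfl) (rho_pos y).le
lemma GI_HH {J : Jet (ι ⊕ ι)} (h : Ok J) (t s) : GI (HH J) t s = GI J.ft t s + 1 / 2 * ∑ i, GI (J.f2 (Sum.inl i)) t s -
    1 / 8 * ∑ i, GI (J.f2 (Sum.inr i)) t s := by
  have e : HH J = fun p => (J.ft p + 1 / 2 * ∑ a, J.f2 (Sum.inl a) p) + (-1 / 8) * ∑ a, J.f2 (Sum.inr a) p := by
    funext p; simp only [HH]; ring
  have e1 : EG fun p => ∑ a, J.f2 (Sum.inl a) p := EG.sum Finset.univ fun i => h.e2 (Sum.inl i)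
  have e2 : EG fun p => ∑ a, J.f2 (Sum.inr a) p := EG.sum Finset.univ fun i => h.e2 (Sum.inr i)
  rw [e, GI_add (h.et.add ((EG.const _).mul e1)) ((EG.const _).mul e2), GI_add h.et ((EG.const _).mul e1), GI_mul, GI_mul,
    GI_sum _ fun i => h.e2 (Sum.inl i), GI_sum _ fun i => h.e2 (Sum.inr i)]
  ring
lemma heat2 {J : Jet (ι ⊕ ι)} (h : Ok J) {T t : ℝ} (h1 : 0 < t) (h2 : t ≤ T) :
    HasDerivAt (fun t => GI J.f t (sT T t)) (GI (HH J) t (sT T t)) t := by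
  have hs : ∀ t, 0 < t → 0 < T / 3 - t / 4 → HasDerivAt (sT T : ℝ → ι ⊕ ι → ℝ) (sT' T t) t := by
    intro t ht ht'
    rw [hasDerivAt_pi]
    rintro (i | i)
    · exact (hasDerivAt_id t).sqrt ht.ne'
    · have : HasDerivAt (fun t : ℝ => T / 3 - t / 4) (-(1/4)) t := by
        simpa using ((hasDerivAt_id t).div_const 4).const_sub (T / 3)
      exact this.sqrt ht'.ne'
  have p1 : 0 < T / 3 - t / 4 := by linarith
  have ev : ∀ᶠ r in 𝓝 t, 0 < r ∧ 0 < T / 3 - r / 4 := by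
    refine (lt_mem_nhds h1).and ?_
    have : ContinuousAt (fun r : ℝ => T / 3 - r / 4) t := by fun_prop
    exact this.eventually (lt_mem_nhds p1)
  have q1 := sqrt_pos.2 h1
  have q2 := sqrt_pos.2 p1
  have := heat h (s := sT T) (s' := sT' T) (t0 := t) (ev.mono fun r hr => hs r hr.1 hr.2) (by
    refine continuousAt_pi.2 fun i => ?_
    rcases i with i | i
    · simp only [sT', Sum.elim_inl]
      exact ContinuousAt.div (by fun_prop) (by fun_prop) (by positivity)
    · simp only [sT', Sum.elim_inr]
      exact ContinuousAt.div (by fun_prop) (by fun_prop) (by positivity))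
  refine this.congr_deriv ?_
  rw [GI_HH h, Fintype.sum_sum_type]
  have e1 : 1 / (2 * √t) * √t = 1 / 2 := by field_simp
  have e2 : -(1/4) / (2 * √(T / 3 - t / 4)) * √(T / 3 - t / 4) = -(1 / 8) := by
    generalize √(T / 3 - t / 4) = q at q2
    field_simp; norm_num
  simp only [sT', sT, Sum.elim_inl, Sum.elim_inr, e1, e2, ← mul_sum]
  ring
variable (K : Set (ι → ℝ)) (T : ℝ)
def cn : ℝ := volume.real K * ∫ y : ι ⊕ ι → ℝ, rho y
def EE (g : Pt (ι ⊕ ι) → ℝ) (t : ℝ) : ℝ := (cn K)⁻¹ * GI (fun p => g p * (Zj K).f p) t (sT T t)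
variable {K T}
variable (hK : IsCompact K) (h0 : 0 < volume.real K)
lemma Z0 (p : Pt (ι ⊕ ι)) (h1 : p.1 = 0) (h2 : ∀ i, p.2 (Sum.inl i) = 0) : (Zj K).f p = volume.real K := by
  simp only [Zj, Mj, Im]
  have : ∀ x, ex x p = 0 := fun x => by rw [ex_apply]; simp [h1, h2]
  simp [this]
lemma rho_int : Integrable (rho : (ι → ℝ) → ℝ) := by
  simpa using gdom (κ := ι) 0
lemma rho_int_pos : 0 < ∫ y : ι → ℝ, rho y := by
  rw [integral_pos_iff_support_of_nonneg (fun y => (rho_pos y).le) rho_int]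
  have : Function.support (rho : (ι → ℝ) → ℝ) = Set.univ := by
    ext y; simp [(rho_pos y).ne']
  rw [this]; exact isOpen_univ.measure_pos _ Set.univ_nonempty
lemma cn_pos (h0 : 0 < volume.real K) : 0 < cn K := mul_pos h0 rho_int_pos
lemma EE_zero (h0 : 0 < volume.real K) (g : Pt (ι ⊕ ι) → ℝ) (c : ℝ) (h : ∀ p : Pt (ι ⊕ ι), p.1 = 0 → (∀ i, p.2 (Sum.inl i) = 0) → g p = c) : EE K T g 0 = c := by
  unfold EE GI
  have : (fun y : ι ⊕ ι → ℝ => g (0, sT T 0 * y) * (Zj K).f (0, sT T 0 * y) * rho y) = fun y => (c * volume.real K) * rho y := by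
    funext y
    have e : ∀ i : ι, (sT T 0 * y : ι ⊕ ι → ℝ) (Sum.inl i) = 0 := fun i => by simp [sT]
    rw [h _ rfl e, Z0 _ rfl e]
  rw [this, integral_const_mul]
  have c0 := cn_pos h0
  rw [mul_assoc, ← cn]; field_simp
lemma EE_cont (hK : IsCompact K) {g : Pt (ι ⊕ ι) → ℝ} (hg : EG g) : Continuous (EE K T g) := by
  rw [← continuousOn_univ]
  intro t _
  refine ContinuousAt.continuousWithinAt ?_
  have : ContinuousOn (EE K T g) (Set.Icc (t - 1) (t + 1)) :=
    continuousOn_const.mul (GI_cont (hg.mul (Z_ok hK).ef) (sT_cont T).continuousOn)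
  exact this.continuousAt (Icc_mem_nhds (by linarith) (by linarith))
lemma EE_deriv (hK : IsCompact K) (h0 : 0 < volume.real K) {F : Jet (ι ⊕ ι)} (hF : Ok F) {t : ℝ} (h1 : 0 < t) (h2 : t ≤ T) :
    HasDerivAt (EE K T F.f) (EE K T (LL K F) t) t := by
  have := (heat2 (hF.mul (Z_ok hK)) h1 h2).const_mul (cn K)⁻¹
  refine this.congr_deriv ?_
  unfold EE; congr 2
  funext p; exact HH_Z hK h0 F p
lemma EE_mul (c : ℝ) (g : Pt (ι ⊕ ι) → ℝ) (t) : EE K T (fun p => c * g p) t = c * EE K T g t := by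
  unfold EE
  have : (fun p => c * g p * (Zj K).f p) = fun p => c * (g p * (Zj K).f p) := by funext p; ring
  rw [this, GI_mul]; ring
lemma EE_add (hK : IsCompact K) {g h : Pt (ι ⊕ ι) → ℝ} (hg : EG g) (hh : EG h) (t) :
    EE K T (fun p => g p + h p) t = EE K T g t + EE K T h t := by
  unfold EE
  have : (fun p => (g p + h p) * (Zj K).f p) = fun p => (g p * (Zj K).f p) + (h p * (Zj K).f p) := by funext p; ring
  rw [this, GI_add (hg.mul (Z_ok hK).ef) (hh.mul (Z_ok hK).ef)]; ring
lemma EE_mono (hK : IsCompact K) (h0 : 0 < volume.real K) {g h : Pt (ι ⊕ ι) → ℝ} (hg : EG g) (hh : EG h) (t)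
    (hle : ∀ p : Pt (ι ⊕ ι), p.1 = t → g p ≤ h p) : EE K T g t ≤ EE K T h t := by
  unfold EE
  refine mlL (GI_mono (hg.mul (Z_ok hK).ef) (hh.mul (Z_ok hK).ef) t _ fun p hp => ?_) (inv_nonneg.2 (cn_pos h0).le)
  exact mlR (hle p hp) (Z_pos hK h0 p).le
lemma EE_le (f f' : ℝ → ℝ) {T : ℝ} (hf : Continuous f) (hd : ∀ t, 0 < t → t ≤ T → HasDerivAt f (f' t) t)
    {g g' : ℝ → ℝ} (hg : Continuous g) (hgd : ∀ t, 0 < t → t ≤ T → HasDerivAt g (g' t) t)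
    (hle : ∀ t, 0 < t → t ≤ T → f' t ≤ g' t) {t : ℝ} (h1 : 0 ≤ t) (h2 : t ≤ T) : f t - f 0 ≤ g t - g 0 := by
  have : AntitoneOn (fun t => f t - g t) (Set.Icc 0 T) := by
    refine antitoneOn_of_deriv_nonpos (convex_Icc 0 T) (hf.sub hg).continuousOn ?_ ?_
    · intro x hx
      rw [interior_Icc] at hx
      exact ((hd x hx.1 hx.2.le).sub (hgd x hx.1 hx.2.le)).differentiableAt.differentiableWithinAt
    · intro x hx
      rw [interior_Icc] at hx
      change deriv (f - g) x ≤ 0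
      rw [((hd x hx.1 hx.2.le).sub (hgd x hx.1 hx.2.le)).deriv]
      linarith [hle x hx.1 hx.2.le]
  have := this ⟨le_rfl, h1.trans h2⟩ ⟨h1, h2⟩ h1
  simp only at this
  linarith
lemma EE_one (hK : IsCompact K) (h0 : 0 < volume.real K) {t : ℝ} (h1 : 0 ≤ t) (h2 : t ≤ T) (c : ℝ) : EE K T (fun _ => c) t = c := by
  have d : ∀ t, 0 < t → t ≤ T → HasDerivAt (EE K T fun _ => c) 0 t := fun t h1 h2 => by
    refine (EE_deriv hK h0 (Ok.const c) h1 h2).congr_deriv ?_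
    have : LL K (Jet.C c : Jet (ι ⊕ ι)) = fun p => 0 * 0 := by funext p; rw [LL_C]; simp
    rw [this, EE_mul]; simp
  have hc := EE_cont (K := K) (T := T) hK (EG.const c)
  have e0 := EE_zero (T := T) h0 (fun _ : Pt (ι ⊕ ι) => c) c fun _ _ _ => rfl
  have a := EE_le _ (fun _ => 0) hc d (g := fun _ => 0) (g' := fun _ => 0) continuous_const (fun t _ _ => hasDerivAt_const _ _) (fun _ _ _ => le_rfl) h1 h2
  have b := EE_le (fun _ => 0) (fun _ => 0) continuous_const (fun t _ _ => hasDerivAt_const _ _) hc d (fun _ _ _ => le_rfl) h1 h2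
  linarith
end
section
variable {ι : Type} [Fintype ι] [DecidableEq ι]
open Matrix in
lemma spec {b : Matrix ι ι ℝ} (hb : bᵀ = b) : ∃ (U : Matrix ι ι ℝ) (d : ι → ℝ), U * Uᵀ = 1 ∧ Uᵀ * U = 1 ∧
    b = U * diagonal d * Uᵀ := by
  have hH : b.IsHermitian := by
    unfold Matrix.IsHermitian; rw [Matrix.conjTranspose_eq_transpose_of_trivial]; exact hb
  refine ⟨hH.eigenvectorUnitary, hH.eigenvalues, ?_, ?_, ?_⟩
  · have := Unitary.coe_mul_star_self hH.eigenvectorUnitary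
    rwa [Unitary.coe_star, Matrix.star_eq_conjTranspose, Matrix.conjTranspose_eq_transpose_of_trivial] at this
  · have := Unitary.coe_star_mul_self hH.eigenvectorUnitary
    rwa [Matrix.star_eq_conjTranspose, Matrix.conjTranspose_eq_transpose_of_trivial] at this
  · have := hH.spectral_theorem
    rw [Unitary.conjStarAlgAut_apply, Matrix.star_eq_conjTranspose, Matrix.conjTranspose_eq_transpose_of_trivial] at this
    exact this
open Matrix
lemma pow_diag {b U : Matrix ι ι ℝ} {d : ι → ℝ} (h1 : U * Uᵀ = 1) (h2 : Uᵀ * U = 1) (hb : b = U * diagonal d * Uᵀ) (m : ℕ) :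
    b ^ m = U * diagonal (fun p => d p ^ m) * Uᵀ := by
  induction m with
  | zero => simp [h1]
  | succ m ih =>
    rw [pow_succ, ih, hb]
    calc U * diagonal (fun p => d p ^ m) * Uᵀ * (U * diagonal d * Uᵀ)
        = U * diagonal (fun p => d p ^ m) * (Uᵀ * U) * diagonal d * Uᵀ := by simp only [Matrix.mul_assoc]
      _ = _ := by
        rw [h2, Matrix.mul_one, Matrix.mul_assoc U, diagonal_mul_diagonal]; simp only [pow_succ]
lemma tr_pow_mul {b U : Matrix ι ι ℝ} {d : ι → ℝ} (h1 : U * Uᵀ = 1) (h2 : Uᵀ * U = 1) (hb : b = U * diagonal d * Uᵀ) (m : ℕ) (X : Matrix ι ι ℝ) :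
    (b ^ m * X).trace = ∑ p, d p ^ m * (Uᵀ * X * U) p p := by
  rw [pow_diag h1 h2 hb, Matrix.mul_assoc, Matrix.mul_assoc, Matrix.trace_mul_comm, Matrix.mul_assoc, Matrix.trace]
  refine sum_congr rfl fun p _ => ?_
  rw [Matrix.diag_apply, diagonal_mul]
lemma tr_pow {b U : Matrix ι ι ℝ} {d : ι → ℝ} (h1 : U * Uᵀ = 1) (h2 : Uᵀ * U = 1) (hb : b = U * diagonal d * Uᵀ) (m : ℕ) :
    (b ^ m).trace = ∑ p, d p ^ m := by
  have := tr_pow_mul h1 h2 hb m 1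
  rw [Matrix.mul_one, Matrix.mul_one, h2] at this
  simpa using this
lemma pow_rearr {i j : ℕ} (h : Even (i + j)) (x y : ℝ) : x ^ i * y ^ j + y ^ i * x ^ j ≤ x ^ (i + j) + y ^ (i + j) := by
  suffices 0 ≤ (x ^ i - y ^ i) * (x ^ j - y ^ j) by rw [pow_add, pow_add]; nlinarith
  rcases Nat.even_or_odd i with hi | hi
  · have hj : Even j := by
      rw [Nat.even_add] at h; exact h.1 hi
    rw [← hi.pow_abs x, ← hi.pow_abs y, ← hj.pow_abs x, ← hj.pow_abs y]
    rcases le_total |x| |y| with h | h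
    · exact mul_nonneg_of_nonpos_of_nonpos (sub_nonpos.2 (pow_le_pow_left₀ (abs_nonneg _) h _)) (sub_nonpos.2 (pow_le_pow_left₀ (abs_nonneg _) h _))
    · exact mul_nonneg (sub_nonneg.2 (pow_le_pow_left₀ (abs_nonneg _) h _)) (sub_nonneg.2 (pow_le_pow_left₀ (abs_nonneg _) h _))
  · have hj : Odd j := by
      rw [Nat.even_add] at h; rw [← Nat.not_even_iff_odd]; rw [← Nat.not_even_iff_odd] at hi; exact fun q => hi (h.2 q)
    rcases le_total x y with h | h
    · exact mul_nonneg_of_nonpos_of_nonpos (sub_nonpos.2 (hi.strictMono_pow.monotone h)) (sub_nonpos.2 (hj.strictMono_pow.monotone h))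
    · exact mul_nonneg (sub_nonneg.2 (hi.strictMono_pow.monotone h)) (sub_nonneg.2 (hj.strictMono_pow.monotone h))
lemma tr_ineq {b β : Matrix ι ι ℝ} (hb : bᵀ = b) (hβ : βᵀ = β) {i j M : ℕ} (hM : i + j = M) (he : Even M) :
    (β * b ^ i * β * b ^ j).trace ≤ (b ^ M * (β * β)).trace := by
  obtain ⟨U, d, h1, h2, hd⟩ := spec hb
  set γ := Uᵀ * β * U with hγ
  have γs : ∀ p q, γ p q = γ q p := fun p q => by
    have : γᵀ = γ := by rw [hγ]; simp [Matrix.transpose_mul, hβ, Matrix.mul_assoc]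
    conv_lhs => rw [← this]
    rfl
  have e2 : (b ^ M * (β * β)).trace = ∑ p, ∑ q, d p ^ M * γ p q ^ 2 := by
    rw [tr_pow_mul h1 h2 hd]
    refine sum_congr rfl fun p _ => ?_
    have : Uᵀ * (β * β) * U = γ * γ := by
      calc Uᵀ * (β * β) * U = Uᵀ * β * (1 : Matrix ι ι ℝ) * β * U := by simp only [Matrix.mul_assoc, Matrix.one_mul]
        _ = _ := by rw [← h1, hγ]; simp only [Matrix.mul_assoc]
    rw [this, Matrix.mul_apply, mul_sum]
    exact sum_congr rfl fun q _ => by rw [γs q p]; ring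
  have e1 : (β * b ^ i * β * b ^ j).trace = ∑ p, ∑ q, d p ^ j * d q ^ i * γ p q ^ 2 := by
    rw [Matrix.trace_mul_comm, tr_pow_mul h1 h2 hd]
    refine sum_congr rfl fun p _ => ?_
    have : Uᵀ * (β * b ^ i * β) * U = γ * (diagonal (fun p => d p ^ i) * γ) := by
      rw [pow_diag h1 h2 hd, hγ]; simp only [Matrix.mul_assoc]
    rw [this, Matrix.mul_apply, mul_sum]
    refine sum_congr rfl fun q _ => ?_
    rw [diagonal_mul, γs q p]; ring
  rw [e1, e2]
  have s1 : ∑ p, ∑ q, d p ^ j * d q ^ i * γ p q ^ 2 = ∑ p, ∑ q, d q ^ j * d p ^ i * γ p q ^ 2 := by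
    rw [sum_comm]
    exact sum_congr rfl fun p _ => sum_congr rfl fun q _ => by rw [γs q p]
  have s2 : ∑ p, ∑ q, d p ^ M * γ p q ^ 2 = ∑ p, ∑ q, d q ^ M * γ p q ^ 2 := by
    rw [sum_comm]
    exact sum_congr rfl fun p _ => sum_congr rfl fun q _ => by rw [γs q p]
  have key : (∑ p, ∑ q, d p ^ j * d q ^ i * γ p q ^ 2) + ∑ p, ∑ q, d q ^ j * d p ^ i * γ p q ^ 2 ≤
      (∑ p, ∑ q, d p ^ M * γ p q ^ 2) + ∑ p, ∑ q, d q ^ M * γ p q ^ 2 := by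
    simp only [← sum_add_distrib]
    refine sum_le_sum fun p _ => sum_le_sum fun q _ => ?_
    have := mlR (pow_rearr (hM ▸ he) (d p) (d q)) (sq_nonneg (γ p q))
    rw [hM] at this
    linarith
  linarith
section rec
variable {b : Matrix ι ι ℝ} {α : Type} [Fintype α] {β : α → Matrix ι ι ℝ} {lam : Matrix ι ι ℝ}
  {D : α → ℕ → Matrix ι ι ℝ} {Lm : ℕ → Matrix ι ι ℝ}
lemma tr_D (hb : bᵀ = b) {β : Matrix ι ι ℝ} (hβ : βᵀ = β) {D : ℕ → Matrix ι ι ℝ} (hD0 : D 0 = 0)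
    (hD : ∀ m, D (m + 1) = b * D m + β * b ^ m) {M : ℕ} (he : Even M) (m : ℕ) :
    ∀ i l, i + m + l = M + 1 → (β * b ^ i * D m * b ^ l).trace ≤ m * (b ^ M * (β * β)).trace := by
  induction m with
  | zero => intro i l _; simp [hD0]
  | succ m ih =>
    intro i l h
    have h1 := ih (i + 1) l (by omega)
    have h2 := tr_ineq hb hβ (i := i) (j := m + l) (M := M) (by omega) he
    have e : β * b ^ i * D (m + 1) * b ^ l = β * b ^ (i + 1) * D m * b ^ l + β * b ^ i * β * b ^ (m + l) := by
      rw [hD, pow_succ b i, pow_add b m l]; noncomm_ring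
    rw [e, Matrix.trace_add]; push_cast; linarith
lemma tr_L (hb : bᵀ = b) (hβ : ∀ k, (β k)ᵀ = β k) (hD0 : ∀ k, D k 0 = 0) (hD : ∀ k m, D k (m + 1) = b * D k m + β k * b ^ m)
    (hL0 : Lm 0 = 0) (hL : ∀ m, Lm (m + 1) = b * Lm m + lam * b ^ m + ∑ k, β k * D k m) {M : ℕ} (he : Even M) (m : ℕ) :
    ∀ l, m + l = M + 2 → (Lm m * b ^ l).trace ≤ m * (b ^ (M + 1) * lam).trace + m * (m - 1) / 2 * ∑ k, (b ^ M * (β k * β k)).trace := by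
  induction m with
  | zero => intro l _; simp [hL0]
  | succ m ih =>
    intro l h
    have h1 := ih (l + 1) (by omega)
    have h2 := sum_le_sum fun k (_ : k ∈ Finset.univ) => tr_D hb (hβ k) (hD0 k) (hD k) he m 0 l (by omega)
    have e : (Lm (m + 1) * b ^ l).trace = (Lm m * b ^ (l + 1)).trace + (b ^ (M + 1) * lam).trace + ∑ k, (β k * b ^ 0 * D k m * b ^ l).trace := by
      rw [hL, Matrix.add_mul, Matrix.add_mul, Matrix.trace_add, Matrix.trace_add, Matrix.sum_mul, Matrix.trace_sum]
      congr 1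
      · congr 1
        · rw [Matrix.mul_assoc, Matrix.trace_mul_comm, Matrix.mul_assoc, ← pow_succ]
        · rw [Matrix.mul_assoc, Matrix.trace_mul_comm, ← pow_add]; congr 3; omega
      · simp
    rw [← mul_sum] at h2
    rw [e]; push_cast
    linarith
end rec
end
section
variable {ι : Type} [Fintype ι] [DecidableEq ι]
lemma quad_diag {b U : Matrix ι ι ℝ} {d : ι → ℝ} (hb : b = U * diagonal d * Uᵀ) (v : ι → ℝ) :
    ∑ i, ∑ j, v i * v j * b i j = ∑ p, d p * (∑ i, U i p * v i) ^ 2 := by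
  have e : ∀ i j, b i j = ∑ p, U i p * d p * U j p := fun i j => by
    rw [hb, Matrix.mul_apply]; refine sum_congr rfl fun p _ => ?_
    rw [Matrix.mul_diagonal, Matrix.transpose_apply]
  simp only [e, mul_sum]
  calc ∑ i, ∑ j, ∑ p, v i * v j * (U i p * d p * U j p)
      = ∑ i, ∑ p, ∑ j, v i * v j * (U i p * d p * U j p) := sum_congr rfl fun i _ => sum_comm
    _ = ∑ p, ∑ i, ∑ j, v i * v j * (U i p * d p * U j p) := sum_comm
    _ = _ := by
      refine sum_congr rfl fun p _ => ?_
      rw [pow_two, sum_mul_sum, mul_sum]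
      refine sum_congr rfl fun i _ => ?_
      rw [mul_sum]
      exact sum_congr rfl fun j _ => by ring
lemma sq_diag {U : Matrix ι ι ℝ} (h1 : U * Uᵀ = 1) (v : ι → ℝ) : ∑ p, (∑ i, U i p * v i) ^ 2 = ∑ i, v i ^ 2 := by
  have := quad_diag (b := 1) (U := U) (d := fun _ => 1) (by simp [h1]) v
  simp [Matrix.one_apply] at this
  rw [← this]; exact sum_congr rfl fun i _ => by ring
lemma ortho {U : Matrix ι ι ℝ} (h2 : Uᵀ * U = 1) (p q : ι) : ∑ i, U i p * U i q = if p = q then 1 else 0 := by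
  have := congrFun (congrFun h2 p) q
  rw [Matrix.mul_apply, Matrix.one_apply] at this
  simpa using this
lemma poly1 (r : ℕ) {x : ℝ} (hx : -1 ≤ x) : -(x ^ (2 * r + 1) + 2 * x ^ (2 * r + 2) + x ^ (2 * r + 3)) ≤ x ^ (2 * r) := by
  have e : x ^ (2 * r) + (x ^ (2 * r + 1) + 2 * x ^ (2 * r + 2) + x ^ (2 * r + 3)) = (x ^ r) ^ 2 * (1 + x * (1 + x) ^ 2) := by ring
  have : 0 ≤ 1 + x * (1 + x) ^ 2 := by
    rcases le_total 0 x with h | h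
    · positivity
    · nlinarith [mul_nonneg (by linarith : (0:ℝ) ≤ -x) (sq_nonneg x), mul_nonneg (by linarith : (0:ℝ) ≤ -x) (by linarith : (0:ℝ) ≤ 1 + x), sq_nonneg (1 + x)]
  have := mul_nonneg (sq_nonneg (x ^ r)) this
  linarith
lemma poly2 (r : ℕ) {δ : ℝ} (hδ : 0 < δ) (x : ℝ) : x ^ (2 * r) ≤ x ^ (2 * r + 2) / δ + δ ^ r := by
  rw [pow_add, pow_mul]
  rcases le_total δ (x ^ 2) with h | h
  · have h1 : (x ^ 2) ^ r ≤ (x ^ 2) ^ r * x ^ 2 / δ := by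
      rw [le_div_iff₀ hδ]; exact mlL h (by positivity)
    have : 0 < δ ^ r := by positivity
    linarith
  · have h1 := pow_le_pow_left₀ (sq_nonneg x) h r
    have : 0 ≤ (x ^ 2) ^ r * x ^ 2 / δ := by positivity
    linarith
lemma poly3 {r : ℕ} (hr : 1 ≤ r) (x : ℝ) : (1 + |x|) ^ 3 ≤ 8 * (1 + x ^ (2 * r + 2)) := by
  have ev : Even (2 * r + 2) := ⟨r + 1, by ring⟩
  rw [← ev.pow_abs x]
  have h0 := abs_nonneg x
  generalize |x| = y at h0
  have : 0 ≤ y ^ (2 * r + 2) := by positivity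
  rcases le_total y 1 with h | h
  · have : (1 + y) ^ 3 ≤ 2 ^ 3 := pow_le_pow_left₀ (by linarith) (by linarith) 3
    linarith
  · have h1 : (1 + y) ^ 3 ≤ (2 * y) ^ 3 := pow_le_pow_left₀ (by linarith) (by linarith) 3
    have h2 : y ^ 3 ≤ y ^ (2 * r + 2) := pow_le_pow_right₀ h (by omega)
    rw [mul_pow] at h1; linarith
lemma core [Nonempty ι] {E : ((ι → ℝ) → ℝ) → ℝ} (hE : IsExp E) {t : ℝ} (ht : 0 < t) (ht1 : t ≤ 1) (hP : PIf t E)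
    {b : Matrix ι ι ℝ} (hb : b = Matrix.of (Cv E) - 1) {D : ι → ℕ → Matrix ι ι ℝ} {Lm : ℕ → Matrix ι ι ℝ}
    (hD0 : ∀ k, D k 0 = 0) (hD : ∀ k m, D k (m + 1) = b * D k m + (Matrix.of fun i j => Tm E i j k) * b ^ m)
    (hL0 : Lm 0 = 0) (hL : ∀ m, Lm (m + 1) = b * Lm m + (-(Matrix.of (Cv E) * Matrix.of (Cv E))) * b ^ m + ∑ k, (Matrix.of fun i j => Tm E i j k) * D k m)
    {r : ℕ} (hr : 1 ≤ r) {δ : ℝ} (hδ : 0 < δ) :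
    0 ≤ (b ^ (2 * r + 2)).trace ∧
    (Lm (2 * r + 2)).trace ≤ 130 * (r + 1) ^ 2 / √t * (1 + (b ^ (2 * r + 2)).trace) * ((b ^ (2 * r + 2)).trace / δ + Fintype.card ι * δ ^ r) := by
  have hbT : bᵀ = b := by
    rw [hb, Matrix.transpose_sub, Matrix.transpose_one]; congr 1; ext i j; exact Cv_symm j i
  have hβ : ∀ k, (Matrix.of fun i j => Tm E i j k)ᵀ = Matrix.of fun i j => Tm E i j k := fun k => by
    ext i j; simp only [Matrix.transpose_apply, Matrix.of_apply]; unfold Tm; congr 1; funext x; ring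
  obtain ⟨U, d, h1, h2, hd⟩ := spec hbT
  have main := tr_L hbT hβ hD0 hD hL0 hL (M := 2 * r) ⟨r, by ring⟩ (2 * r + 2) 0 rfl
  rw [pow_zero, Matrix.mul_one] at main
  have hA : Matrix.of (Cv E) = 1 + b := by rw [hb]; abel
  have q : ∀ v : ι → ℝ, ∑ i, ∑ j, v i * v j * Cv E i j = ∑ p, (1 + d p) * (∑ i, U i p * v i) ^ 2 := fun v => by
    refine quad_diag (b := Matrix.of (Cv E)) ?_ v
    rw [hA, hd]
    have : diagonal (fun p => 1 + d p) = 1 + diagonal d := by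
      rw [← Matrix.diagonal_one, Matrix.diagonal_add]
    rw [this, Matrix.mul_add, Matrix.add_mul, Matrix.mul_one, h1]
  have dm : ∀ p, -1 ≤ d p := fun p => by
    have := q fun i => U i p
    simp only [ortho h2] at this
    simp at this
    rw [← Cv_quad hE] at this
    have nn := hE.nonneg (fun x => (∑ i, U i p * (x i - mn E i)) * ∑ j, U j p * (x j - mn E j)) fun x => mul_self_nonneg _
    linarith
  have e1 := tr_pow h1 h2 hd (2 * r + 2)
  have e0 := tr_pow h1 h2 hd (2 * r)
  have ev2 : ∀ p, 0 ≤ d p ^ (2 * r + 2) := fun p => Even.pow_nonneg ⟨r + 1, by ring⟩ _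
  have ev0 : ∀ p, 0 ≤ d p ^ (2 * r) := fun p => Even.pow_nonneg ⟨r, by ring⟩ _
  set Φ := (b ^ (2 * r + 2)).trace with hΦ
  set S := (b ^ (2 * r)).trace with hS
  have Φ0 : 0 ≤ Φ := by rw [e1]; exact sum_nonneg fun p _ => ev2 p
  have S0 : 0 ≤ S := by rw [e0]; exact sum_nonneg fun p _ => ev0 p
  refine ⟨Φ0, ?_⟩
  have b1 : (b ^ (2 * r + 1) * -(Matrix.of (Cv E) * Matrix.of (Cv E))).trace ≤ S := by
    have : b ^ (2 * r + 1) * -(Matrix.of (Cv E) * Matrix.of (Cv E)) = -(b ^ (2 * r + 1) + 2 * b ^ (2 * r + 2) + b ^ (2 * r + 3)) := by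
      rw [hA, pow_succ b (2 * r + 2), pow_succ b (2 * r + 1)]; noncomm_ring
    have e2 : (2 : Matrix ι ι ℝ) * b ^ (2 * r + 2) = b ^ (2 * r + 2) + b ^ (2 * r + 2) := two_mul _
    rw [this, e2, Matrix.trace_neg, Matrix.trace_add, Matrix.trace_add, Matrix.trace_add, ← hΦ, e1, tr_pow h1 h2 hd, tr_pow h1 h2 hd, e0,
      ← sum_add_distrib, ← sum_add_distrib, ← sum_add_distrib, ← Finset.sum_neg_distrib]
    refine sum_le_sum fun p _ => ?_
    have := poly1 r (dm p); linarith
  have b2 : S ≤ Φ / δ + Fintype.card ι * δ ^ r := by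
    rw [e0, e1, sum_div]
    calc ∑ p, d p ^ (2 * r) ≤ ∑ p, (d p ^ (2 * r + 2) / δ + δ ^ r) := sum_le_sum fun p _ => poly2 r hδ _
      _ = _ := by rw [sum_add_distrib]; simp
  obtain ⟨p0, -, hp0⟩ := Finset.exists_max_image Finset.univ (fun p => |d p|) Finset.univ_nonempty
  have a3 : (1 + |d p0|) ^ 3 ≤ 8 * (1 + Φ) := by
    refine (poly3 hr (d p0)).trans ?_
    have : d p0 ^ (2 * r + 2) ≤ Φ := by
      rw [e1]; exact single_le_sum (f := fun p => d p ^ (2 * r + 2)) (fun p _ => ev2 p) (Finset.mem_univ p0)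
    linarith
  have th := third hE ht (a := 1 + |d p0|) (by linarith [abs_nonneg (d p0)]) hP (fun v => by
    rw [q v, ← sq_diag h1 v, mul_sum]
    refine sum_le_sum fun p _ => mlR ?_ (sq_nonneg _)
    linarith [le_abs_self (d p), hp0 p (Finset.mem_univ p)])
  have s0 : 0 < √t := sqrt_pos.2 ht
  have b3 : ∑ k, (b ^ (2 * r) * ((Matrix.of fun i j => Tm E i j k) * (Matrix.of fun i j => Tm E i j k))).trace ≤ 64 * (1 + Φ) / √t * S := by
    simp only [tr_pow_mul h1 h2 hd]
    rw [sum_comm, e0, mul_sum]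
    refine sum_le_sum fun p _ => ?_
    rw [← mul_sum, mul_comm]
    refine mlR ?_ (ev0 p)
    have e : ∀ k, (Uᵀ * ((Matrix.of fun i j => Tm E i j k) * (Matrix.of fun i j => Tm E i j k)) * U) p p = ∑ i, (∑ j, U j p * Tm E i k j) ^ 2 := by
      intro k
      have : Uᵀ * ((Matrix.of fun i j => Tm E i j k) * (Matrix.of fun i j => Tm E i j k)) * U =
          ((Matrix.of fun i j => Tm E i j k) * U)ᵀ * ((Matrix.of fun i j => Tm E i j k) * U) := by
        rw [Matrix.transpose_mul, hβ]; simp only [Matrix.mul_assoc]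
      rw [this, Matrix.mul_apply]
      refine sum_congr rfl fun i _ => ?_
      rw [Matrix.transpose_apply, Matrix.mul_apply, ← pow_two]
      congr 1
      refine sum_congr rfl fun j _ => ?_
      simp only [Matrix.of_apply]
      rw [mul_comm]; congr 1; unfold Tm; congr 1; funext x; ring
    simp only [e]
    rw [sum_comm]
    have := th fun j => U j p
    have o : ∑ i, U i p ^ 2 = 1 := by have := ortho h2 p p; simpa [pow_two] using this
    rw [o, mul_one] at this
    refine this.trans ?_
    rw [show 64 * (1 + Φ) / √t = 8 * (8 * (1 + Φ)) / √t by ring]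
    gcongr
  have s1 : √t ≤ 1 := Real.sqrt_le_one.2 ht1
  have R1 : (1:ℝ) ≤ r := by exact_mod_cast hr
  refine main.trans ?_
  push_cast
  have c1 : (2 * (r:ℝ) + 2) * (b ^ (2 * r + 1) * -(Matrix.of (Cv E) * Matrix.of (Cv E))).trace ≤ (2 * (r:ℝ) + 2) * S := mlL b1 (by positivity)
  have c2 := mlL b3 (by nlinarith : 0 ≤ (2 * (r:ℝ) + 2) * (2 * r + 2 - 1) / 2)
  have c3 : (2 * (r:ℝ) + 2) * S + (2 * (r:ℝ) + 2) * (2 * r + 2 - 1) / 2 * (64 * (1 + Φ) / √t * S) ≤ 130 * (r + 1) ^ 2 / √t * (1 + Φ) * S := by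
    have i1 : 1 ≤ (1 + Φ) / √t := by rw [le_div_iff₀ s0]; linarith
    have : (2 * (r:ℝ) + 2) ≤ 2 * (r + 1) ^ 2 * ((1 + Φ) / √t) := by nlinarith [mul_nonneg (sq_nonneg ((r:ℝ) + 1)) (sub_nonneg.2 i1)]
    have e : (2 * (r:ℝ) + 2) * S + (2 * (r:ℝ) + 2) * (2 * r + 2 - 1) / 2 * (64 * (1 + Φ) / √t * S) =
      ((2 * (r:ℝ) + 2) + (2 * (r:ℝ) + 2) * (2 * r + 1) / 2 * 64 * ((1 + Φ) / √t)) * S := by ring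
    rw [e, show 130 * ((r:ℝ) + 1) ^ 2 / √t * (1 + Φ) = 130 * (r + 1) ^ 2 * ((1 + Φ) / √t) by ring]
    refine mlR ?_ S0
    have : (2 * (r:ℝ) + 2) * (2 * r + 1) / 2 * 64 ≤ 128 * (r + 1) ^ 2 := by nlinarith
    have := mlR this (zero_le_one.trans i1)
    linarith
  have c4 : 130 * ((r:ℝ) + 1) ^ 2 / √t * (1 + Φ) * S ≤ 130 * ((r:ℝ) + 1) ^ 2 / √t * (1 + Φ) * (Φ / δ + Fintype.card ι * δ ^ r) :=
    mlL b2 (by positivity)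
  linarith
end
section
variable {ι : Type} [Fintype ι] [DecidableEq ι]
variable (K : Set (ι → ℝ))
def LLh (p : Pt (ι ⊕ ι)) : Jet (ι ⊕ ι) →+ ℝ where
  toFun J := LL K J p
  map_zero' := LL_C 0 p
  map_add' J M := LL_add J M p
def Bj : Matrix ι ι (Jet (ι ⊕ ι)) := Matrix.of (fun i j => Aj K i j) - 1
def evM (p : Pt (ι ⊕ ι)) (X : Matrix ι ι (Jet (ι ⊕ ι))) : Matrix ι ι ℝ := X.map (Jet.ev p)
def dM (k : ι ⊕ ι) (p : Pt (ι ⊕ ι)) (X : Matrix ι ι (Jet (ι ⊕ ι))) : Matrix ι ι ℝ := X.map (Jet.dd k p)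
def LM (p : Pt (ι ⊕ ι)) (X : Matrix ι ι (Jet (ι ⊕ ι))) : Matrix ι ι ℝ := X.map (LLh K p)
lemma dM_mul (k) (p : Pt (ι ⊕ ι)) (X Y : Matrix ι ι (Jet (ι ⊕ ι))) : dM k p (X * Y) = evM p X * dM k p Y + dM k p X * evM p Y := by
  ext i j
  simp only [dM, evM, Matrix.map_apply, Matrix.mul_apply, Matrix.add_apply, map_sum, ← sum_add_distrib]
  exact sum_congr rfl fun l _ => Jet.mul_f1 _ _ _ _
lemma LM_mul (p : Pt (ι ⊕ ι)) (X Y : Matrix ι ι (Jet (ι ⊕ ι))) (hX : ∀ k, dM (Sum.inr k) p X = 0) :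
    LM K p (X * Y) = evM p X * LM K p Y + LM K p X * evM p Y + ∑ k, dM (Sum.inl k) p X * dM (Sum.inl k) p Y := by
  ext i j
  have hX' : ∀ k i j, (X i j).f1 (Sum.inr k) p = 0 := fun k i j => congrFun (congrFun (hX k) i) j
  simp only [LM, dM, evM, Matrix.map_apply, Matrix.mul_apply, Matrix.add_apply, Matrix.sum_apply, map_sum]
  rw [sum_comm (s := (Finset.univ : Finset ι)) (t := (Finset.univ : Finset ι)), ← sum_add_distrib, ← sum_add_distrib]
  refine sum_congr rfl fun l _ => ?_
  have := LL_mul (K := K) (X i l) (Y l j) p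
  simp only [Gam, hX', zero_mul, Finset.sum_const_zero, mul_zero, sub_zero] at this
  change LL K (X i l * Y l j) p = _
  rw [this]
  change _ = (X i l).f p * LL K (Y l j) p + LL K (X i l) p * (Y l j).f p + ∑ k, (X i l).f1 (Sum.inl k) p * (Y l j).f1 (Sum.inl k) p
  ring
lemma evM_pow (p : Pt (ι ⊕ ι)) (X : Matrix ι ι (Jet (ι ⊕ ι))) (m : ℕ) : evM p (X ^ m) = evM p X ^ m :=
  map_pow (Jet.ev p).mapMatrix X m
lemma one_entry (i j : ι) : (1 : Matrix ι ι (Jet (ι ⊕ ι))) i j = Jet.C (if i = j then 1 else 0) := by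
  rw [Matrix.one_apply]; split_ifs <;> rfl
lemma Bj_entry (i j : ι) : Bj K i j = Aj K i j + -(Jet.C (if i = j then 1 else 0)) := by
  rw [← one_entry, ← sub_eq_add_neg]; rfl
lemma dM_one (k) (p : Pt (ι ⊕ ι)) : dM k p (1 : Matrix ι ι (Jet (ι ⊕ ι))) = 0 := by
  ext i j; simp only [dM, Matrix.map_apply, one_entry]; rfl
lemma LM_one (p : Pt (ι ⊕ ι)) : LM K p (1 : Matrix ι ι (Jet (ι ⊕ ι))) = 0 := by
  ext i j; simp only [LM, Matrix.map_apply, one_entry]; exact LL_C _ _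
lemma dM_Br (k) (p) : dM (Sum.inr k) p (Bj K) = 0 := by
  ext i j
  simp only [dM, Matrix.map_apply, Bj_entry]
  change (Aj K i j).f1 (Sum.inr k) p + -0 = 0
  rw [Aj_inr]; simp
lemma dM_Br_pow (k) (p) (m : ℕ) : dM (Sum.inr k) p (Bj K ^ m) = 0 := by
  induction m with
  | zero => rw [pow_zero]; exact dM_one _ _
  | succ m ih => rw [pow_succ, dM_mul, ih, dM_Br]; simp
variable {K}
lemma Bj_pow_ok (hK : IsCompact K) (h0 : 0 < volume.real K) (m : ℕ) (i j) : Ok ((Bj K ^ m) i j) := by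
  have hB : ∀ i j, Ok (Bj K i j) := fun i j => by
    rw [Bj_entry]; exact (Aj_ok hK h0 i j).add (Ok.const _).neg
  induction m generalizing i j with
  | zero => rw [pow_zero, one_entry]; exact Ok.const _
  | succ m ih => rw [pow_succ, Matrix.mul_apply]; exact Ok.sum _ fun l => (ih i l).mul (hB l j)
variable (K) in
def Phi (r : ℕ) : Jet (ι ⊕ ι) := (Bj K ^ (2 * r + 2)).trace
variable (K) in
def Psi (r : ℕ) : Jet (ι ⊕ ι) := 1 - (1 + Phi K r).inv
lemma Phi_ok (hK : IsCompact K) (h0 : 0 < volume.real K) (r) : Ok (Phi K r) := Ok.sum _ fun i => Bj_pow_ok hK h0 _ i i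
lemma evB (hK : IsCompact K) (h0 : 0 < volume.real K) (p) : evM p (Bj K) = Matrix.of (Cv (Ep K p)) - 1 := by
  ext i j
  simp only [evM, Matrix.map_apply, Bj_entry, Matrix.sub_apply, Matrix.of_apply, Matrix.one_apply]
  rw [← Aj_f hK h0]; rfl
lemma Phi_f (hK : IsCompact K) (h0 : 0 < volume.real K) (r p) : (Phi K r).f p = ((Matrix.of (Cv (Ep K p)) - 1) ^ (2 * r + 2)).trace := by
  rw [← evB hK h0, ← evM_pow]
  exact map_sum (Jet.ev p) _ _
lemma Phi_LL (r p) : LL K (Phi K r) p = (LM K p (Bj K ^ (2 * r + 2))).trace := map_sum (LLh K p) _ _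
lemma Phi_inr (r k p) : (Phi K r).f1 (Sum.inr k) p = 0 := by
  have h : (Phi K r).f1 (Sum.inr k) p = (dM (Sum.inr k) p (Bj K ^ (2 * r + 2))).trace := map_sum (Jet.dd (Sum.inr k) p) _ _
  rw [h, dM_Br_pow]; simp
lemma Phi_nonneg (hK : IsCompact K) (h0 : 0 < volume.real K) (r p) : 0 ≤ (Phi K r).f p := by
  rw [Phi_f hK h0]
  set b := Matrix.of (Cv (Ep K p)) - 1 with hb
  have hbT : bᵀ = b := by
    rw [hb, Matrix.transpose_sub, Matrix.transpose_one]; congr 1; ext i j; exact Cv_symm (E := Ep K p) j i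
  obtain ⟨U, d, h1, h2, hd⟩ := spec hbT
  rw [tr_pow h1 h2 hd]
  exact sum_nonneg fun p _ => Even.pow_nonneg ⟨r + 1, by ring⟩ _
lemma Phi_LB (hK : IsCompact K) (h0 : 0 < volume.real K) (r) : LB (1 + Phi K r).f := by
  have h : ∀ p, 1 ≤ (1 + Phi K r).f p := fun p => by
    have := Phi_nonneg hK h0 r p; simp only [Jet.add_f, Jet.one_f]; linarith
  refine ⟨fun p => zero_lt_one.trans_le (h p), fun T => ⟨1, 0, by simp, le_rfl, fun p _ => ?_⟩⟩
  simpa using inv_le_one_of_one_le₀ (h p)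
lemma Psi_ok (hK : IsCompact K) (h0 : 0 < volume.real K) (r) : Ok (Psi K r) :=
  Ok.one.sub ((Ok.one.add (Phi_ok hK h0 r)).inv (Phi_LB hK h0 r))
lemma Psi_f (r p) : (Psi K r).f p = 1 - (1 + (Phi K r).f p)⁻¹ := by
  rw [Psi, sub_eq_add_neg]; rfl
lemma Psi_inr (r k p) : (Psi K r).f1 (Sum.inr k) p = 0 := by
  rw [Psi, sub_eq_add_neg]
  simp [Jet.inv, Jet.comp, Phi_inr]
lemma LPsi [Nonempty ι] (hK : IsCompact K) (hc : Convex ℝ K) (hi : (interior K).Nonempty) (h0 : 0 < volume.real K) {p : Pt (ι ⊕ ι)}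
    (ht : 0 < p.1) (ht1 : p.1 ≤ 1) {r : ℕ} (hr : 1 ≤ r) {δ : ℝ} (hδ : 0 < δ) :
    LL K (Psi K r) p ≤ 130 * (r + 1) ^ 2 / √p.1 * ((Psi K r).f p / δ + Fintype.card ι * δ ^ r) := by
  set b := Matrix.of (Cv (Ep K p)) - 1 with hb
  have eb := evB hK h0 p
  rw [← hb] at eb
  have hdl : ∀ k, dM (Sum.inl k) p (Bj K) = Matrix.of fun i j => Tm (Ep K p) i j k := fun k => by
    ext i j
    simp only [dM, Matrix.map_apply, Bj_entry]
    change (Aj K i j).f1 (Sum.inl k) p + -0 = _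
    rw [Aj_inl hK h0]; simp
  have hl : LM K p (Bj K) = -(Matrix.of (Cv (Ep K p)) * Matrix.of (Cv (Ep K p))) := by
    ext i j
    simp only [LM, Matrix.map_apply, Bj_entry]
    change LL K _ p = _
    rw [LL_add, LL_neg, LL_C, LL_Aj hK h0]
    simp [Matrix.mul_apply]
  obtain ⟨Φ0, hΦ⟩ := core (isExp_Ep hK h0 p) ht ht1 (Ep_PIf hK hc hi h0 p) hb (D := fun k m => dM (Sum.inl k) p (Bj K ^ m)) (Lm := fun m => LM K p (Bj K ^ m))
    (fun k => by simp only [pow_zero]; exact dM_one _ _) (fun k m => by simp only [pow_succ']; rw [dM_mul, evM_pow, eb, hdl])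
    (by simp only [pow_zero]; exact LM_one _ _)
    (fun m => by simp only [pow_succ']; rw [LM_mul K p _ _ (dM_Br K · p), evM_pow, eb, hl]; simp only [hdl]) hr hδ
  rw [← Phi_f hK h0] at hΦ Φ0
  rw [← Phi_LL] at hΦ
  have e : LL K (Psi K r) p = ((1 + (Phi K r).f p)⁻¹ ^ 2) * LL K (Phi K r) p - (1 + (Phi K r).f p)⁻¹ ^ 3 * Gam (Phi K r) (Phi K r) p := by
    have g : Gam (1 + Phi K r) (1 + Phi K r) p = Gam (Phi K r) (Phi K r) p := by simp [Gam]
    have l1 : LL K (1 : Jet (ι ⊕ ι)) p = 0 := LL_C 1 p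
    have f1 : (1 + Phi K r).f p = 1 + (Phi K r).f p := rfl
    rw [Psi, sub_eq_add_neg, LL_add, LL_neg, Jet.inv, comp_LL, LL_add, l1, g, f1]; ring
  have gp : 0 ≤ Gam (Phi K r) (Phi K r) p := by
    simp only [Gam, Phi_inr, mul_zero, Finset.sum_const_zero, sub_zero]
    exact sum_nonneg fun i _ => mul_self_nonneg _
  rw [e, Psi_f]
  generalize (Phi K r).f p = Φ at *
  have P : 0 < 1 + Φ := by linarith
  have g2 : 0 ≤ (1 + Φ)⁻¹ ^ 3 * Gam (Phi K r) (Phi K r) p := mul_nonneg (by positivity) gp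
  have m := mlL hΦ (by positivity : 0 ≤ (1 + Φ)⁻¹ ^ 2)
  have e2 : (1 + Φ)⁻¹ ^ 2 * (130 * (r + 1) ^ 2 / √p.1 * (1 + Φ) * (Φ / δ + Fintype.card ι * δ ^ r)) =
      130 * (r + 1) ^ 2 / √p.1 * ((1 - (1 + Φ)⁻¹) / δ + Fintype.card ι * δ ^ r * (1 + Φ)⁻¹) := by
    have : (1 - (1 + Φ)⁻¹) = Φ * (1 + Φ)⁻¹ := by field_simp; ring
    rw [this]; field_simp
  rw [e2] at m
  have i1 : (1 + Φ)⁻¹ ≤ 1 := inv_le_one_of_one_le₀ (by linarith)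
  have : 130 * ((r:ℝ) + 1) ^ 2 / √p.1 * ((1 - (1 + Φ)⁻¹) / δ + Fintype.card ι * δ ^ r * (1 + Φ)⁻¹) ≤
      130 * (r + 1) ^ 2 / √p.1 * ((1 - (1 + Φ)⁻¹) / δ + Fintype.card ι * δ ^ r) := by
    refine mlL ?_ (by positivity)
    have : Fintype.card ι * δ ^ r * (1 + Φ)⁻¹ ≤ Fintype.card ι * δ ^ r := mul_le_of_le_one_right (by positivity) i1
    linarith
  linarith
lemma EPsi [Nonempty ι] (hK : IsCompact K) (hc : Convex ℝ K) (hi : (interior K).Nonempty) (h0 : 0 < volume.real K)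
    (hiso : ∀ p : Pt (ι ⊕ ι), p.1 = 0 → (∀ i, p.2 (Sum.inl i) = 0) → Matrix.of (Cv (Ep K p)) = 1)
    {r : ℕ} (hr : 1 ≤ r) {δ : ℝ} (hδ : 0 < δ) {T : ℝ} (hT : T ≤ 1) {t : ℝ} (ht : 0 ≤ t) (htT : t ≤ T) :
    EE K T (Psi K r).f t ≤ Fintype.card ι * δ ^ (r + 1) * exp (260 * (r + 1) ^ 2 * √t / δ) := by
  set q := EE K T (Psi K r).f with hq
  set n : ℝ := (Fintype.card ι : ℝ)
  have q0 : q 0 = 0 := by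
    refine EE_zero h0 _ 0 fun p h1 h2 => ?_
    rw [Psi_f, Phi_f hK h0, hiso p h1 h2]; simp
  have hqc : Continuous q := EE_cont hK (Psi_ok hK h0 r).ef
  have hqd : ∀ t, 0 < t → t ≤ T → EE K T (LL K (Psi K r)) t ≤ 130 * (r + 1) ^ 2 / √t * (q t / δ + n * δ ^ r) := by
    intro t h1 h2
    have e : (130 * (r + 1) ^ 2 / √t * (q t / δ + n * δ ^ r)) = EE K T (fun p => (130 * (r + 1) ^ 2 / √t / δ) * (Psi K r).f p + 130 * (r + 1) ^ 2 / √t * (n * δ ^ r)) t := by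
      rw [EE_add hK ((EG.const _).mul (Psi_ok hK h0 r).ef) (EG.const _), EE_mul, EE_one hK h0 h1.le h2, ← hq]; ring
    rw [e]
    refine EE_mono hK h0 ((Psi_ok hK h0 r).ll hK h0) (((EG.const _).mul (Psi_ok hK h0 r).ef).add (EG.const _)) t fun p hp => ?_
    refine (LPsi hK hc hi h0 (by rw [hp]; exact h1) (by rw [hp]; linarith) hr hδ).trans (le_of_eq ?_)
    rw [hp]; ring
  set cc : ℝ := 260 * (r + 1) ^ 2 / δ with hcc
  have key := EE_le (fun t => exp (-(cc * √t)) * (q t + n * δ ^ (r + 1)))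
    (fun t => exp (-(cc * √t)) * (-(cc * (1 / (2 * √t)))) * (q t + n * δ ^ (r + 1)) + exp (-(cc * √t)) * EE K T (LL K (Psi K r)) t)
    (T := T) (by fun_prop) (fun t h1 h2 => by
      have a := (((hasDerivAt_id t).sqrt h1.ne').const_mul cc).neg.exp
      exact a.mul ((EE_deriv hK h0 (Psi_ok hK h0 r) h1 h2).add_const _))
    (g := fun _ => 0) (g' := fun _ => 0) continuous_const (fun t _ _ => hasDerivAt_const _ _)
    (fun t h1 h2 => by
      have s0 := sqrt_pos.2 h1
      have h3 := hqd t h1 h2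
      have e : 130 * ((r:ℝ) + 1) ^ 2 / √t * (q t / δ + n * δ ^ r) = cc * (1 / (2 * √t)) * (q t + n * δ ^ (r + 1)) := by
        rw [hcc]; field_simp; ring
      rw [e] at h3
      have := mlL h3 (exp_pos (-(cc * √t))).le
      linarith) ht htT
  simp only [Real.sqrt_zero, mul_zero, neg_zero, exp_zero, q0, one_mul, zero_add, sub_zero] at key
  have E0 := exp_pos (cc * √t)
  have k2 : exp (-(cc * √t)) * (q t + n * δ ^ (r + 1)) ≤ n * δ ^ (r + 1) := by linarith
  have k3 := mlL k2 E0.le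
  rw [← mul_assoc, ← exp_add, add_neg_cancel, exp_zero, one_mul] at k3
  have : 0 ≤ n * δ ^ (r + 1) := by positivity
  have e : 260 * ((r:ℝ) + 1) ^ 2 * √t / δ = cc * √t := by rw [hcc]; ring
  rw [e]; linarith
end
section
variable {ι : Type} [Fintype ι] [DecidableEq ι]
lemma good {b : Matrix ι ι ℝ} (hb : bᵀ = b) {r : ℕ} (h : (b ^ (2 * r + 2)).trace < (1/4) ^ (r + 1)) (x : ι → ℝ) :
    1 / 4 * ∑ k, x k ^ 2 ≤ ∑ k, (∑ i, x i * (1 + b) k i) ^ 2 := by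
  obtain ⟨U, d, h1, h2, hd⟩ := spec hb
  rw [tr_pow h1 h2 hd] at h
  have hd' : ∀ p, -(1/2) ≤ d p := fun p => by
    have h3 : d p ^ (2 * r + 2) ≤ ∑ p, d p ^ (2 * r + 2) :=
      single_le_sum (f := fun p => d p ^ (2 * r + 2)) (fun p _ => Even.pow_nonneg ⟨r + 1, by ring⟩ _) (Finset.mem_univ p)
    have e : d p ^ (2 * r + 2) = (d p ^ 2) ^ (r + 1) := by rw [← pow_mul]; ring_nf
    have h4 : d p ^ 2 < 1 / 4 := lt_of_pow_lt_pow_left₀ (r + 1) (by norm_num) (by rw [← e]; linarith)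
    nlinarith
  have e1 : 1 + b = U * diagonal (fun p => 1 + d p) * Uᵀ := by
    have : diagonal (fun p => 1 + d p) = 1 + diagonal d := by
      rw [← Matrix.diagonal_one, Matrix.diagonal_add]
    rw [this, Matrix.mul_add, Matrix.add_mul, Matrix.mul_one, h1, hd]
  have e2 : (1 + b)ᵀ * (1 + b) = U * diagonal (fun p => (1 + d p) ^ 2) * Uᵀ := by
    have hs : (1 + b)ᵀ = 1 + b := by rw [Matrix.transpose_add, hb, Matrix.transpose_one]
    have : diagonal (fun p => (1 + d p) ^ 2) = diagonal (fun p => 1 + d p) * diagonal (fun p => 1 + d p) := by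
      rw [Matrix.diagonal_mul_diagonal]; congr 1; funext p; ring
    rw [hs, this, e1]
    calc _ = U * diagonal (fun p => 1 + d p) * (Uᵀ * U) * diagonal (fun p => 1 + d p) * Uᵀ := by simp only [Matrix.mul_assoc]
      _ = _ := by rw [h2]; simp only [Matrix.mul_assoc, Matrix.one_mul]
  have e3 := quad_diag e2 x
  have e4 : ∑ k, (∑ i, x i * (1 + b) k i) ^ 2 = ∑ i, ∑ j, x i * x j * ((1 + b)ᵀ * (1 + b) : Matrix ι ι ℝ) i j := by
    simp only [pow_two, sum_mul_sum]
    simp only [Matrix.mul_apply, Matrix.transpose_apply, mul_sum]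
    rw [sum_comm]; refine sum_congr rfl fun i _ => ?_
    rw [sum_comm]; refine sum_congr rfl fun j _ => sum_congr rfl fun k _ => by ring
  rw [e4, e3, ← sq_diag h1 x, mul_sum]
  refine sum_le_sum fun p _ => mlR ?_ (sq_nonneg _)
  nlinarith [hd' p]
lemma wvar {R : Type} [Fintype R] (e : R → ℝ) {S : ℝ} (hS : S = ∑ r, e r) (S0 : 0 < S) (w : R → ι → ℝ) :
    S⁻¹ * ∑ r, e r * ∑ k, w r k ^ 2 - (S⁻¹) ^ 2 * ∑ k, (∑ r, e r * w r k) ^ 2 =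
      S⁻¹ * ∑ r, e r * ∑ k, (w r k - S⁻¹ * ∑ r, e r * w r k) ^ 2 := by
  have : ∀ k, ∑ r, e r * (w r k - S⁻¹ * ∑ r, e r * w r k) ^ 2 = ∑ r, e r * w r k ^ 2 - S⁻¹ * (∑ r, e r * w r k) ^ 2 := fun k => by
    set q := ∑ r, e r * w r k with hq
    have e1 : ∀ r, e r * (w r k - S⁻¹ * q) ^ 2 = e r * w r k ^ 2 - 2 * (S⁻¹ * q) * (e r * w r k) + (S⁻¹ * q) ^ 2 * e r := fun r => by ring
    simp only [e1, sum_add_distrib, sum_sub_distrib, ← mul_sum, ← hq, ← hS]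
    field_simp; ring
  have c : ∀ f : R → ι → ℝ, ∑ r, e r * ∑ k, f r k = ∑ k, ∑ r, e r * f r k := fun f => by
    simp only [mul_sum]; exact sum_comm
  rw [c, c]; simp only [this, sum_sub_distrib, ← mul_sum]; ring
lemma Ok.f2_zero {κ : Type} [Fintype κ] [DecidableEq κ] {J : Jet κ} (h : Ok J) {i : κ} (h1 : ∀ p, J.f1 i p = 0) (p) : J.f2 i p = 0 := by
  have := h.d2 i p
  simp only [h1] at this
  exact this.unique (hasDerivAt_const _ _)
variable {K : Set (ι → ℝ)}
variable (K) in
def uj (v : ι → ℝ) : Jet (ι ⊕ ι) := ∑ i, Jet.C (v i) * (aj K i + Xj (Sum.inr i))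
lemma uj_ok (hK : IsCompact K) (h0 : 0 < volume.real K) (v) : Ok (uj K v) :=
  Ok.sum _ fun i => (Ok.const _).mul ((aj_ok hK h0 i).add (Xj_ok _))
lemma uj_f (v p) : (uj K v).f p = ∑ i, v i * (mn (Ep K p) i + p.2 (Sum.inr i)) :=
  map_sum (Jet.ev p) _ _
lemma uj_inl (hK : IsCompact K) (h0 : 0 < volume.real K) (v p k) : (uj K v).f1 (Sum.inl k) p = ∑ i, v i * Cv (Ep K p) k i := by
  have : (uj K v).f1 (Sum.inl k) p = _ := map_sum (Jet.dd (Sum.inl k) p) _ _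
  rw [this]
  refine sum_congr rfl fun i _ => ?_
  simp [Jet.dd, Jet.C, aj_inl hK h0, Xj]
lemma uj_inr (v p k) : (uj K v).f1 (Sum.inr k) p = v k := by
  have : (uj K v).f1 (Sum.inr k) p = _ := map_sum (Jet.dd (Sum.inr k) p) _ _
  rw [this]
  have : ∀ i, Jet.dd (Sum.inr k) p (Jet.C (v i) * (aj K i + Xj (Sum.inr i))) = if k = i then v i else 0 := fun i => by
    simp [Jet.dd, Jet.C, aj_inr, Xj]
  simp [this]
lemma uj_LL (hK : IsCompact K) (h0 : 0 < volume.real K) (v p) : LL K (uj K v) p = 0 := by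
  have : LL K (uj K v) p = _ := map_sum (LLh K p) _ _
  rw [this]
  refine Finset.sum_eq_zero fun i _ => ?_
  have e : LL K (Jet.C (v i) * (aj K i + Xj (Sum.inr i))) p = 0 := by
    rw [LL_mul, LL_add, LL_aj hK h0, LL_C]
    simp [LL, HH, Gam, Jet.C, Xj]
  exact e
lemma uj_2 (hK : IsCompact K) (h0 : 0 < volume.real K) (v p k) : (uj K v).f2 (Sum.inr k) p = 0 := by
  have := (uj_ok hK h0 v).d2 (Sum.inr k) p
  simp only [uj_inr] at this
  exact this.unique (hasDerivAt_const _ _)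
lemma mn_le (hK : IsCompact K) (h0 : 0 < volume.real K) {v : ι → ℝ} {β : ℝ} (h : ∀ x ∈ K, ∑ i, v i * x i ≤ β) (p) :
    ∑ i, v i * mn (Ep K p) i ≤ β := by
  have hE := isExp_Ep hK h0 p
  have h1 : 0 ≤ Ep K p (fun x => β * 1 + (-1) * ∑ i, v i * x i) := by
    rw [Ep_eq]
    refine mul_nonneg (setIntegral_nonneg hK.measurableSet fun x hx => mul_nonneg ?_ (exp_pos _).le) (inv_nonneg.2 (Z_pos hK h0 p).le)
    linarith [h x hx]
  rw [hE.add _ _ (by fun_prop) (by fun_prop), hE.mul, hE.mul, hE.one] at h1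
  have h2 : Ep K p (fun x => ∑ i, v i * x i) = ∑ i, v i * mn (Ep K p) i := by
    have : ∀ s : Finset ι, Ep K p (fun x => ∑ i ∈ s, v i * x i) = ∑ i ∈ s, v i * mn (Ep K p) i := by
      intro s
      induction s using Finset.induction_on with
      | empty => simpa using hE.mul 0 (fun _ => 1)
      | insert a s ha ih =>
        simp only [Finset.sum_insert ha]
        rw [hE.add _ _ (by fun_prop) (by fun_prop), hE.mul, ih]; rfl
    exact this _
  linarith
variable {R : Type} [Fintype R] (v : R → ι → ℝ)
variable (K) in
def Sj : Jet (ι ⊕ ι) := ∑ r, (uj K (v r)).exp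
variable (K) in
def Gj : Jet (ι ⊕ ι) := (Sj K v).log
lemma Sj_f (p) : (Sj K v).f p = ∑ r, exp ((uj K (v r)).f p) := map_sum (Jet.ev p) _ _
lemma Sj_1 (k p) : (Sj K v).f1 k p = ∑ r, exp ((uj K (v r)).f p) * (uj K (v r)).f1 k p := map_sum (Jet.dd k p) _ _
lemma sum_f2 {κ : Type} {α : Type} (s : Finset α) (J : α → Jet κ) (k p) : (∑ a ∈ s, J a).f2 k p = ∑ a ∈ s, (J a).f2 k p := by
  classical
  induction s using Finset.induction_on with
  | empty => simp
  | insert a s ha ih => simp [Finset.sum_insert ha, ih]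
variable {v} {β : ℝ}
lemma uj_EG (hK : IsCompact K) (h0 : 0 < volume.real K) {v : ι → ℝ} (h : ∀ x ∈ K, ∑ i, v i * x i ≤ β) : EG fun p => exp ((uj K v).f p) := by
  refine ⟨Real.continuous_exp.comp (uj_ok hK h0 v).ef.1, fun T => ⟨exp β, ∑ i, |v i|, by positivity, by positivity, fun p _ => ?_⟩⟩
  rw [abs_of_pos (exp_pos _), ← exp_add, uj_f]
  refine exp_le_exp.2 ?_
  simp only [mul_add, sum_add_distrib]
  refine add_le_add (mn_le hK h0 h p) ?_
  rw [sum_mul]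
  refine sum_le_sum fun i _ => ?_
  calc v i * p.2 (Sum.inr i) ≤ |v i * p.2 (Sum.inr i)| := le_abs_self _
    _ = |v i| * |p.2 (Sum.inr i)| := abs_mul _ _
    _ ≤ _ := mlL (norm_le_pi_norm p.2 (Sum.inr i)) (abs_nonneg _)
lemma Sj_pos [Nonempty R] (p) : 0 < (Sj K v).f p := by
  rw [Sj_f]; exact Finset.sum_pos (fun r _ => exp_pos _) Finset.univ_nonempty
lemma Gj_ok (hK : IsCompact K) (h0 : 0 < volume.real K) (h : ∀ r, ∀ x ∈ K, ∑ i, v r i * x i ≤ β) {r0 : R} (hr0 : v r0 = 0) : Ok (Gj K v) := by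
  have : Nonempty R := ⟨r0⟩
  refine Ok.log (Ok.sum _ fun r => (uj_ok hK h0 _).exp (uj_EG hK h0 (h r))) ⟨Sj_pos, fun T => ⟨1, 0, by simp, le_rfl, fun p _ => ?_⟩⟩
  have : 1 ≤ (Sj K v).f p := by
    rw [Sj_f]
    have := single_le_sum (f := fun r => exp ((uj K (v r)).f p)) (fun r _ => (exp_pos _).le) (Finset.mem_univ r0)
    simp only [hr0, uj_f] at this
    simpa [uj_f] using this
  simpa using inv_le_one_of_one_le₀ this
lemma Gj_1 (k p) : (Gj K v).f1 (Sum.inr k) p = ((Sj K v).f p)⁻¹ * ∑ r, exp ((uj K (v r)).f p) * v r k := by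
  have : (Gj K v).f1 (Sum.inr k) p = ((Sj K v).f p)⁻¹ * (Sj K v).f1 (Sum.inr k) p := rfl
  rw [this, Sj_1]; simp only [uj_inr]
set_option maxHeartbeats 1000000 in
lemma Gj_LL [Nonempty R] (hK : IsCompact K) (h0 : 0 < volume.real K) (r : ℕ) (p) :
    -(4 ^ (r + 1) / 4 * ((Psi K r).f p * ∑ k, (Gj K v).f2 (Sum.inr k) p)) ≤ LL K (Gj K v) p := by
  set S := (Sj K v).f p with hS
  have S0 : 0 < S := Sj_pos p
  set e : R → ℝ := fun r => exp ((uj K (v r)).f p) with he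
  have e0 : ∀ r, 0 < e r := fun r => exp_pos _
  have hSe : S = ∑ r, e r := Sj_f v p
  set w : R → ι → ℝ := fun r k => ∑ i, v r i * Cv (Ep K p) k i with hw
  have S1l : ∀ k, (Sj K v).f1 (Sum.inl k) p = ∑ r, e r * w r k := fun k => by rw [Sj_1]; simp only [uj_inl hK h0]; rfl
  have S1r : ∀ k, (Sj K v).f1 (Sum.inr k) p = ∑ r, e r * v r k := fun k => by rw [Sj_1]; simp only [uj_inr]; rfl
  have S2 : ∀ k, (Sj K v).f2 (Sum.inr k) p = ∑ r, e r * v r k ^ 2 := fun k => by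
    rw [Sj, sum_f2]; refine sum_congr rfl fun r _ => ?_
    have : (uj K (v r)).exp.f2 (Sum.inr k) p = e r * (uj K (v r)).f1 (Sum.inr k) p ^ 2 + e r * (uj K (v r)).f2 (Sum.inr k) p := rfl
    rw [this, uj_inr, uj_2 hK h0]; ring
  have SL : LL K (Sj K v) p = ∑ r, e r * (1 / 2 * (∑ k, w r k ^ 2 - 1 / 4 * ∑ k, v r k ^ 2)) := by
    have : LL K (Sj K v) p = _ := map_sum (LLh K p) _ _
    rw [this]; refine sum_congr rfl fun r _ => ?_
    have : LL K (uj K (v r)).exp p = _ := comp_LL _ exp exp exp p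
    refine this.trans ?_
    rw [uj_LL hK h0, Gam]; simp only [uj_inl hK h0, uj_inr, ← pow_two]
    simp only [he, hw]; ring
  have D : ∑ k, (Gj K v).f2 (Sum.inr k) p = S⁻¹ * ∑ r, e r * ∑ k, (v r k - S⁻¹ * ∑ r, e r * v r k) ^ 2 := by
    have : ∀ k, (Gj K v).f2 (Sum.inr k) p = -(S⁻¹ ^ 2) * (Sj K v).f1 (Sum.inr k) p ^ 2 + S⁻¹ * (Sj K v).f2 (Sum.inr k) p := fun k => rfl
    rw [← wvar e hSe S0]
    simp only [this, S1r, S2, sum_add_distrib, ← mul_sum]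
    have c : ∑ r, e r * ∑ k, v r k ^ 2 = ∑ k, ∑ r, e r * v r k ^ 2 := by
      simp only [mul_sum]; exact sum_comm
    rw [c]; ring
  have L : LL K (Gj K v) p = 1 / 2 * (S⁻¹ * ∑ r, e r * ∑ k, (w r k - S⁻¹ * ∑ r, e r * w r k) ^ 2 -
      1 / 4 * (S⁻¹ * ∑ r, e r * ∑ k, (v r k - S⁻¹ * ∑ r, e r * v r k) ^ 2)) := by
    have : LL K (Gj K v) p = S⁻¹ * LL K (Sj K v) p + 1 / 2 * (-(S⁻¹ ^ 2)) * Gam (Sj K v) (Sj K v) p :=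
      comp_LL (Sj K v) log (fun x => x⁻¹) (fun x => -(x⁻¹ ^ 2)) p
    rw [this, SL, Gam, ← wvar e hSe S0 w, ← wvar e hSe S0 v]
    simp only [S1l, S1r, ← pow_two]
    have c : ∑ r, e r * (1 / 2 * (∑ k, w r k ^ 2 - 1 / 4 * ∑ k, v r k ^ 2)) = 1 / 2 * (∑ r, e r * ∑ k, w r k ^ 2 - 1 / 4 * ∑ r, e r * ∑ k, v r k ^ 2) := by
      rw [mul_sum, ← sum_sub_distrib, mul_sum]; refine sum_congr rfl fun r _ => by ring
    rw [c]; ring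
  have wb : ∀ r k, w r k - S⁻¹ * ∑ r, e r * w r k = ∑ i, (v r i - S⁻¹ * ∑ r, e r * v r i) * Cv (Ep K p) k i := fun r k => by
    simp only [hw, sub_mul, sum_sub_distrib, mul_sum, sum_mul]
    congr 1
    rw [sum_comm]; refine sum_congr rfl fun i _ => sum_congr rfl fun r _ => by ring
  have PN := Phi_nonneg hK h0 r p
  have Si : 0 < S⁻¹ := inv_pos.2 S0
  set V := S⁻¹ * ∑ r, e r * ∑ k, (v r k - S⁻¹ * ∑ r, e r * v r k) ^ 2 with hV
  have V0 : 0 ≤ V := mul_nonneg Si.le (sum_nonneg fun r _ => mul_nonneg (e0 r).le (sum_nonneg fun k _ => sq_nonneg _))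
  set W := S⁻¹ * ∑ r, e r * ∑ k, (w r k - S⁻¹ * ∑ r, e r * w r k) ^ 2 with hW
  have W0 : 0 ≤ W := mul_nonneg Si.le (sum_nonneg fun r _ => mul_nonneg (e0 r).le (sum_nonneg fun k _ => sq_nonneg _))
  rw [L, D]
  have Ps : 0 ≤ (Psi K r).f p := by
    rw [Psi_f]; have := inv_le_one_of_one_le₀ (show 1 ≤ 1 + (Phi K r).f p by linarith); linarith
  by_cases hg : (Phi K r).f p < (1/4) ^ (r + 1)
  · have : 1 / 4 * V ≤ W := by
      rw [hV, hW, mul_left_comm, mul_sum]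
      refine mlL (sum_le_sum fun r' _ => ?_) Si.le
      rw [mul_left_comm]
      refine mlL ?_ (e0 r').le
      simp only [wb]
      rw [Phi_f hK h0] at hg
      have hbT : (Matrix.of (Cv (Ep K p)) - 1)ᵀ = Matrix.of (Cv (Ep K p)) - 1 := by
        rw [Matrix.transpose_sub, Matrix.transpose_one]; congr 1; ext i j; exact Cv_symm (E := Ep K p) j i
      have := good hbT hg fun i => v r' i - S⁻¹ * ∑ r, e r * v r i
      simpa only [add_sub_cancel, Matrix.of_apply] using this
    have h4 : 0 ≤ (4:ℝ) ^ (r + 1) / 4 * ((Psi K r).f p * V) := by positivity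
    linarith
  · push Not at hg
    have h5 : 1 ≤ 2 * 4 ^ (r + 1) * (Psi K r).f p := by
      rw [Psi_f]
      set q := (Phi K r).f p
      have q4 : (1:ℝ) ≤ 4 ^ (r + 1) * q := by
        have := mlL hg (show (0:ℝ) ≤ 4 ^ (r + 1) by positivity)
        rwa [← mul_pow, show (4:ℝ) * (1/4) = 1 by norm_num, one_pow] at this
      have h41 : (1:ℝ) ≤ 4 ^ (r + 1) := one_le_pow₀ (by norm_num)
      have e : 1 - (1 + q)⁻¹ = q / (1 + q) := by field_simp; ring
      rw [e, mul_div_assoc', le_div_iff₀ (by linarith)]; nlinarith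
    have := mlR h5 V0
    linarith
end
section
variable {ι : Type} [Fintype ι] [DecidableEq ι]
section hm
variable {R : Type} [Fintype R] (v : R → ι → ℝ)
def hm (x : ι → ℝ) : ℝ := ⨆ r, ∑ i, v r i * x i
def gm : ℝ := (∫ y, hm v y * rho y) / ∫ y : ι → ℝ, rho y
variable {v}
lemma le_hm (x : ι → ℝ) (r) : ∑ i, v r i * x i ≤ hm v x := le_ciSup (f := fun r => ∑ i, v r i * x i) (Set.finite_range _).bddAbove r
lemma hm_le [Nonempty R] {x : ι → ℝ} {c : ℝ} (h : ∀ r, ∑ i, v r i * x i ≤ c) : hm v x ≤ c := ciSup_le h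
lemma hm_nonneg {r0 : R} (h : v r0 = 0) (x : ι → ℝ) : 0 ≤ hm v x := by
  have := le_hm (v := v) x r0; simpa [h] using this
lemma hm_smul [Nonempty R] {c : ℝ} (hc : 0 ≤ c) (x : ι → ℝ) : hm v (c • x) = c * hm v x := by
  rw [hm, hm, Real.mul_iSup_of_nonneg hc]; congr 1; funext r
  rw [mul_sum]; refine sum_congr rfl fun i _ => by simp; ring
lemma hm_cont [Nonempty R] : Continuous (hm v) := by
  have : hm v = fun x => Finset.univ.sup' Finset.univ_nonempty fun r => ∑ i, v r i * x i := by
    funext x; rw [Finset.sup'_univ_eq_ciSup]; rfl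
  rw [this]
  exact Continuous.finset_sup'_apply Finset.univ_nonempty fun r _ => by fun_prop
lemma hm_abs {r0 : R} (h : v r0 = 0) (x : ι → ℝ) : |hm v x| ≤ ∑ r, ∑ i, |v r i| * |x i| := by
  have : Nonempty R := ⟨r0⟩
  rw [abs_of_nonneg (hm_nonneg h x)]
  refine hm_le fun r => ?_
  refine le_trans ?_ (single_le_sum (f := fun r => ∑ i, |v r i| * |x i|) (fun r _ => by positivity) (Finset.mem_univ r))
  exact sum_le_sum fun i _ => (le_abs_self _).trans (abs_mul _ _).le
lemma hm_EG {r0 : R} (h : v r0 = 0) : EG fun p : Pt (ι ⊕ ι) => hm v fun i => p.2 (Sum.inr i) := by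
  have : Nonempty R := ⟨r0⟩
  have := EG.sum (κ := ι ⊕ ι) Finset.univ fun r => EG.sum Finset.univ fun i => (EG.const |v r i|).mul (Xj_ok (Sum.inr i : ι ⊕ ι)).ef.abs
  refine this.mono (hm_cont.comp (by fun_prop)) fun p => ?_
  exact (hm_abs h _).trans (le_abs_self _)
lemma gm_nonneg {r0 : R} (h : v r0 = 0) : 0 ≤ gm v :=
  div_nonneg (integral_nonneg fun y => mul_nonneg (hm_nonneg h y) (rho_pos y).le) rho_int_pos.le
end hm
lemma fub (g h : (ι → ℝ) → ℝ) : ∫ y : ι ⊕ ι → ℝ, (g (fun i => y (Sum.inl i)) * h (fun i => y (Sum.inr i))) * rho y =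
    (∫ y, g y * rho y) * ∫ y, h y * rho y := by
  have e := (volume_measurePreserving_sumPiEquivProdPi (fun _ : ι ⊕ ι => ℝ))
  have := e.integral_comp (MeasurableEquiv.measurableEmbedding _) (fun q : (ι → ℝ) × (ι → ℝ) => (g q.1 * rho q.1) * (h q.2 * rho q.2))
  have e2 := integral_prod_mul (μ := (volume : Measure (ι → ℝ))) (ν := (volume : Measure (ι → ℝ))) (fun y => g y * rho y) (fun y => h y * rho y)
  rw [← e2]
  refine Eq.trans ?_ this
  congr 1; funext y
  have : rho y = rho (fun i => y (Sum.inl i)) * rho (fun i => y (Sum.inr i)) := by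
    simp only [rho]; rw [← exp_add, Fintype.sum_sum_type]; congr 1; ring
  rw [this]
  simp only [MeasurableEquiv.coe_sumPiEquivProdPi, Equiv.sumPiEquivProdPi]
  simp; ring
variable {K : Set (ι → ℝ)}
lemma Ep_dep {p q : Pt (ι ⊕ ι)} (h1 : p.1 = q.1) (h2 : ∀ i, p.2 (Sum.inl i) = q.2 (Sum.inl i)) (f) : Im K f p = Im K f q := by
  have : ∀ x, ex x p = ex x q := fun x => by rw [ex_apply, ex_apply, h1]; simp only [h2]
  simp only [Im, this]
variable {R : Type} [Fintype R] {v : R → ι → ℝ} {T : ℝ}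
lemma EE_fub [Nonempty R] (h0 : 0 < volume.real K) {g : Pt (ι ⊕ ι) → ℝ}
    (hg : ∀ p q : Pt (ι ⊕ ι), p.1 = q.1 → (∀ i, p.2 (Sum.inl i) = q.2 (Sum.inl i)) → g p = g q) (t : ℝ) :
    EE K T (fun p => g p * hm v fun i => p.2 (Sum.inr i)) t = √(T / 3 - t / 4) * gm v * EE K T g t := by
  set g1 : (ι → ℝ) → ℝ := fun y => g (t, Sum.elim (√t • y) 0) * (Zj K).f (t, Sum.elim (√t • y) 0) with hg1
  have e1 : ∀ y : ι ⊕ ι → ℝ, g (t, sT T t * y) * (Zj K).f (t, sT T t * y) = g1 fun i => y (Sum.inl i) := fun y => by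
    have hl : ∀ i : ι, (sT T t * y : ι ⊕ ι → ℝ) (Sum.inl i) = (Sum.elim (√t • fun i => y (Sum.inl i)) 0 : ι ⊕ ι → ℝ) (Sum.inl i) := fun i => by simp [sT]
    simp only [hg1]
    exact congrArg₂ (· * ·) (hg _ _ rfl hl) (Ep_dep (K := K) (p := (t, sT T t * y)) (q := (t, Sum.elim (√t • fun i => y (Sum.inl i)) 0)) rfl hl fun _ => 1)
  have e2 : ∀ y : ι ⊕ ι → ℝ, hm v (fun i => (sT T t * y : ι ⊕ ι → ℝ) (Sum.inr i)) = √(T / 3 - t / 4) * hm v fun i => y (Sum.inr i) := fun y => by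
    rw [← hm_smul (Real.sqrt_nonneg _)]; rfl
  have f1 := fub g1 fun y => hm v y
  have f2 := fub g1 fun _ => 1
  have r0 := (rho_int_pos (ι := ι)).ne'
  simp only [mul_one, one_mul] at f2
  unfold EE GI gm
  have : ∀ y : ι ⊕ ι → ℝ, g (t, sT T t * y) * hm v (fun i => (sT T t * y : ι ⊕ ι → ℝ) (Sum.inr i)) * (Zj K).f (t, sT T t * y) * rho y =
      √(T / 3 - t / 4) * ((g1 (fun i => y (Sum.inl i)) * hm v (fun i => y (Sum.inr i))) * rho y) := fun y => by
    rw [e2, ← e1]; ring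
  simp only [this, e1]
  rw [integral_const_mul, f1, f2]
  field_simp
lemma stein' {J : Jet (ι ⊕ ι)} (hJ : Ok J) (t : ℝ) (s) (i) : GI (fun p => J.f1 i p * p.2 i) t s = s i ^ 2 * GI (J.f2 i) t s := by
  rw [pow_two, mul_assoc, ← stein hJ, ← integral_const_mul]
  unfold GI; congr 1; funext y; simp only [Pi.mul_apply]; ring
lemma EE_mono' (hK : IsCompact K) (h0 : 0 < volume.real K) {g h : Pt (ι ⊕ ι) → ℝ} (hg : EG g) (hh : EG h) (t)
    (hle : ∀ y, g (t, sT T t * y) ≤ h (t, sT T t * y)) : EE K T g t ≤ EE K T h t :=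
  mlL (integral_mono ((hg.mul (Z_ok hK).ef).int t _) ((hh.mul (Z_ok hK).ef).int t _) fun y =>
    mlR (mlR (hle y) (Z_pos hK h0 _).le) (rho_pos y).le) (inv_nonneg.2 (cn_pos h0).le)
lemma Psi_nonneg (hK : IsCompact K) (h0 : 0 < volume.real K) (r p) : 0 ≤ (Psi K r).f p := by
  rw [Psi_f]; have := inv_le_one_of_one_le₀ (show 1 ≤ 1 + (Phi K r).f p by linarith [Phi_nonneg hK h0 r p]); linarith
variable {β : ℝ}
lemma EE_stein (hK : IsCompact K) (h0 : 0 < volume.real K) (h : ∀ r, ∀ x ∈ K, ∑ i, v r i * x i ≤ β) {r0 : R} (hr0 : v r0 = 0) (r : ℕ) {t : ℝ}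
    (ht : t ≤ T) (hT : 0 < T) : √(T / 3 - t / 4) * EE K T (fun p => (Psi K r).f p * ∑ k, (Gj K v).f2 (Sum.inr k) p) t ≤ gm v * EE K T (Psi K r).f t := by
  have : Nonempty R := ⟨r0⟩
  have hG := Gj_ok hK h0 h hr0
  have hP := Psi_ok hK h0 r
  have hJ := (hP.mul (Z_ok hK)).mul hG
  set J := Psi K r * Zj K * Gj K v with hJd
  set σ := T / 3 - t / 4 with hσ
  have σ0 : 0 < σ := by rw [hσ]; linarith
  have P2 : ∀ k p, (Psi K r).f2 (Sum.inr k) p = 0 := fun k p => hP.f2_zero (fun p => Psi_inr r k p) p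
  have Z1 : ∀ k p, (Zj K).f1 (Sum.inr k) p = 0 := fun k p => rfl
  have Z2 : ∀ k p, (Zj K).f2 (Sum.inr k) p = 0 := fun k p => rfl
  have J1 : ∀ k p, J.f1 (Sum.inr k) p = (Psi K r).f p * (Zj K).f p * (Gj K v).f1 (Sum.inr k) p := fun k p => by
    simp [hJd, Psi_inr, Z1]
  have J2 : ∀ k p, J.f2 (Sum.inr k) p = (Psi K r).f p * (Zj K).f p * (Gj K v).f2 (Sum.inr k) p := fun k p => by
    simp [hJd, Psi_inr, Z1, P2, Z2]
  have key : σ * EE K T (fun p => (Psi K r).f p * ∑ k, (Gj K v).f2 (Sum.inr k) p) t ≤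
      EE K T (fun p => (Psi K r).f p * hm v fun i => p.2 (Sum.inr i)) t := by
    have e1 : σ * EE K T (fun p => (Psi K r).f p * ∑ k, (Gj K v).f2 (Sum.inr k) p) t =
        (cn K)⁻¹ * GI (fun p => ∑ k, J.f1 (Sum.inr k) p * p.2 (Sum.inr k)) t (sT T t) := by
      rw [GI_sum (g := fun k p => J.f1 (Sum.inr k) p * p.2 (Sum.inr k)) _ fun k => (hJ.e1 (Sum.inr k)).mul (Xj_ok (Sum.inr k)).ef]
      simp only [stein' hJ]
      have s2 : ∀ k : ι, sT T t (Sum.inr k) ^ 2 = σ := fun k => Real.sq_sqrt σ0.le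
      simp only [s2]
      rw [← mul_sum, ← GI_sum _ fun k => hJ.e2 (Sum.inr k), mul_left_comm, EE]
      congr 3; funext p; simp only [J2]; rw [← mul_sum]; ring
    rw [e1, EE]
    refine mlL (GI_mono (EG.sum _ fun k => (hJ.e1 (Sum.inr k)).mul (Xj_ok (Sum.inr k)).ef)
      ((hP.ef.mul (hm_EG hr0)).mul (Z_ok hK).ef) _ _ fun p _ => ?_) (inv_nonneg.2 (cn_pos h0).le)
    have e2 : ∑ k, J.f1 (Sum.inr k) p * p.2 (Sum.inr k) = (Psi K r).f p * (∑ k, (Gj K v).f1 (Sum.inr k) p * p.2 (Sum.inr k)) * (Zj K).f p := by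
      simp only [J1]; rw [mul_sum, sum_mul]; exact sum_congr rfl fun k _ => by ring
    change ∑ k, J.f1 (Sum.inr k) p * p.2 (Sum.inr k) ≤ _
    rw [e2]
    refine mlR (mlL ?_ (Psi_nonneg hK h0 r p)) (Z_pos hK h0 p).le
    simp only [Gj_1]
    have S0 := Sj_pos (K := K) (v := v) p
    have e3 : ∑ k, ((Sj K v).f p)⁻¹ * (∑ r, exp ((uj K (v r)).f p) * v r k) * p.2 (Sum.inr k) =
        ((Sj K v).f p)⁻¹ * ∑ r, exp ((uj K (v r)).f p) * ∑ k, v r k * p.2 (Sum.inr k) := by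
      simp only [mul_sum, sum_mul]; rw [sum_comm]
      exact sum_congr rfl fun k _ => sum_congr rfl fun r _ => by ring
    rw [e3, inv_mul_le_iff₀ S0, Sj_f, sum_mul]
    exact sum_le_sum fun r _ => mlL (le_hm (fun i => p.2 (Sum.inr i)) r) (exp_pos _).le
  rw [EE_fub h0 (fun p q h1 h2 => by
    rw [Psi_f, Psi_f, Phi_f hK h0, Phi_f hK h0]
    have : Ep K p = Ep K q := by funext f; rw [Ep_eq, Ep_eq, Ep_dep h1 h2, Ep_dep h1 h2]
    rw [this]) t] at key
  have s0 := sqrt_pos.2 σ0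
  have ss := Real.mul_self_sqrt σ0.le
  refine le_of_mul_le_mul_left ?_ s0
  rw [← mul_assoc, ss, ← mul_assoc]; exact key
lemma gm_bound (hK : IsCompact K) (h0 : 0 < volume.real K) (h : ∀ r, ∀ x ∈ K, ∑ i, v r i * x i ≤ β) {r0 : R} (hr0 : v r0 = 0)
    (hN : log (Fintype.card R) ≤ β) (hmn : ∀ p : Pt (ι ⊕ ι), p.1 = 0 → (∀ i, p.2 (Sum.inl i) = 0) → ∀ i, mn (Ep K p) i = 0)
    (hT : 0 < T) (r : ℕ) (hP : ∀ t, 0 < t → t ≤ T → 4 ^ (r + 1) * EE K T (Psi K r).f t ≤ 1 / 100) : √T * gm v ≤ 8 * β := by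
  have : Nonempty R := ⟨r0⟩
  have hG := Gj_ok hK h0 h hr0
  have m0 := gm_nonneg hr0
  set m := gm v
  have sT0 := sqrt_pos.2 hT
  have sT2 := Real.mul_self_sqrt hT.le
  have hd : ∀ t, 0 < t → t ≤ T → -(m / (100 * √T)) ≤ EE K T (LL K (Gj K v)) t := by
    intro t h1 h2
    have k1 := EE_stein hK h0 h hr0 r h2 hT
    have hΔ : EG fun p => (Psi K r).f p * ∑ k, (Gj K v).f2 (Sum.inr k) p :=
      (Psi_ok hK h0 r).ef.mul (EG.sum _ fun k => hG.e2 (Sum.inr k))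
    have k2 := EE_mono (T := T) hK h0 ((EG.const (-(4 ^ (r + 1) / 4))).mul hΔ) (hG.ll hK h0) t fun p _ => by
      have := Gj_LL (v := v) hK h0 r p; linarith
    rw [EE_mul] at k2
    set X := EE K T (fun p => (Psi K r).f p * ∑ k, (Gj K v).f2 (Sum.inr k) p) t
    have k3 := mlR (hP t h1 h2) m0
    have k4 : √T / 4 ≤ √(T / 3 - t / 4) := Real.le_sqrt_of_sq_le (by nlinarith)
    refine le_trans ?_ k2
    have k5 : (4 ^ (r + 1) / 4) * X ≤ m / (100 * √T) := by
      by_cases hX : X ≤ 0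
      · exact (mul_nonpos_of_nonneg_of_nonpos (by positivity) hX).trans (by positivity)
      · push Not at hX
        rw [le_div_iff₀ (by positivity)]
        have k6 := mlR k4 hX.le
        have k7 := mlL (k6.trans k1) (show (0:ℝ) ≤ 4 ^ (r + 1) by positivity)
        nlinarith
    linarith
  have k := EE_le (fun t => -(m / (100 * √T)) * t) (fun _ => -(m / (100 * √T))) (by fun_prop)
    (fun t _ _ => by simpa using (hasDerivAt_id t).const_mul (-(m / (100 * √T)))) (EE_cont (K := K) (T := T) hK hG.ef)
    (fun t h1 h2 => EE_deriv hK h0 hG h1 h2) hd hT.le le_rfl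
  have hone : ∀ t, 0 ≤ t → t ≤ T → EE K T (fun p => hm v fun i => p.2 (Sum.inr i)) t = √(T / 3 - t / 4) * m := fun t h1 h2 => by
    have := EE_fub (K := K) (T := T) (v := v) h0 (g := fun _ => 1) (fun _ _ _ _ => rfl) t
    simpa [EE_one hK h0 h1 h2] using this
  have up : EE K T (Gj K v).f T ≤ 2 * β + √(T / 3 - T / 4) * m := by
    rw [← hone T hT.le le_rfl, ← EE_one hK h0 hT.le le_rfl (2 * β), ← EE_add hK (EG.const _) (hm_EG hr0)]
    refine EE_mono hK h0 hG.ef ((EG.const _).add (hm_EG hr0)) T fun p _ => ?_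
    have : (Gj K v).f p = log ((Sj K v).f p) := rfl
    rw [this, Sj_f]
    have : ∑ r, exp ((uj K (v r)).f p) ≤ Fintype.card R * exp (β + hm v fun i => p.2 (Sum.inr i)) := by
      have := Finset.sum_le_card_nsmul Finset.univ (fun r => exp ((uj K (v r)).f p)) (exp (β + hm v fun i => p.2 (Sum.inr i))) fun r _ => by
        refine exp_le_exp.2 ?_
        rw [uj_f]; simp only [mul_add, sum_add_distrib]
        exact add_le_add (mn_le hK h0 (h r) p) (le_hm (fun i => p.2 (Sum.inr i)) r)
      simpa using this
    refine (Real.log_le_log (Finset.sum_pos (fun r _ => exp_pos _) Finset.univ_nonempty) this).trans ?_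
    rw [Real.log_mul (by simp) (exp_pos _).ne', Real.log_exp]; linarith
  have lo : √(T / 3 - 0 / 4) * m ≤ EE K T (Gj K v).f 0 := by
    rw [← hone 0 le_rfl hT.le]
    refine EE_mono' hK h0 (hm_EG hr0) hG.ef 0 fun y => hm_le fun r => ?_
    have : (Gj K v).f (0, sT T 0 * y) = log ((Sj K v).f (0, sT T 0 * y)) := rfl
    rw [this, Real.le_log_iff_exp_le (Sj_pos _), Sj_f]
    have := single_le_sum (f := fun r => exp ((uj K (v r)).f (0, sT T 0 * y))) (fun r _ => (exp_pos _).le) (Finset.mem_univ r)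
    refine le_trans (le_of_eq ?_) this
    simp only [uj_f]
    congr 1; refine sum_congr rfl fun i _ => ?_
    rw [hmn _ rfl (fun i => by simp [sT])]; simp
  have s1 : √(T / 3 - T / 4) ≤ 3 / 10 * √T := by
    rw [Real.sqrt_le_left (by positivity)]; nlinarith
  have s2 : 57 / 100 * √T ≤ √(T / 3 - 0 / 4) := Real.le_sqrt_of_sq_le (by nlinarith)
  have s3 := mlR s1 m0
  have s4 := mlR s2 m0
  have e5 : m / (100 * √T) * T = √T * m / 100 := by
    rw [div_mul_eq_mul_div, div_eq_div_iff (by positivity) (by norm_num)]; nlinarith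
  simp only [neg_mul, e5, mul_zero, neg_zero, sub_zero] at k
  nlinarith [mul_nonneg sT0.le m0]
lemma gm_final [Nonempty ι] (hK : IsCompact K) (hc : Convex ℝ K) (hi : (interior K).Nonempty) (h0 : 0 < volume.real K)
    (hiso : ∀ p : Pt (ι ⊕ ι), p.1 = 0 → (∀ i, p.2 (Sum.inl i) = 0) → Matrix.of (Cv (Ep K p)) = 1)
    (hmn : ∀ p : Pt (ι ⊕ ι), p.1 = 0 → (∀ i, p.2 (Sum.inl i) = 0) → ∀ i, mn (Ep K p) i = 0)
    (h : ∀ r, ∀ x ∈ K, ∑ i, v r i * x i ≤ β) {r0 : R} (hr0 : v r0 = 0) (hN : log (Fintype.card R) ≤ β)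
    {r : ℕ} (hr : log (Fintype.card ι) + 3 ≤ r + 1) : gm v ≤ 208000 * (r + 1) * β := by
  have n1 : (1:ℝ) ≤ Fintype.card ι := by exact_mod_cast Fintype.card_pos
  have l0 := Real.log_nonneg n1
  have hr1 : 1 ≤ r := by
    have : (2:ℝ) ≤ r := by linarith
    have : 2 ≤ r := by exact_mod_cast this
    omega
  set k : ℝ := r + 1 with hk
  have k0 : 0 < k := by positivity
  set T : ℝ := (1 / (26000 * k)) ^ 2 with hT
  have T0 : 0 < T := by positivity
  have sT : √T = 1 / (26000 * k) := Real.sqrt_sq (by positivity)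
  have T1 : T ≤ 1 := by
    rw [hT]; refine pow_le_one₀ (by positivity) ?_
    rw [div_le_one (by positivity)]; linarith
  have := gm_bound hK h0 h hr0 hN hmn T0 r fun t h1 h2 => by
    have e := EPsi hK hc hi h0 hiso hr1 (δ := 1 / 100) (by norm_num) T1 h1.le h2
    have e1 : 260 * (k) ^ 2 * √t / (1 / 100) ≤ k := by
      have : √t ≤ 1 / (26000 * k) := by rw [← sT]; exact Real.sqrt_le_sqrt h2
      rw [le_div_iff₀ (by positivity)] at this
      nlinarith
    have e2 := exp_le_exp.2 e1
    have e3 : EE K T (Psi K r).f t ≤ Fintype.card ι * (1 / 100) ^ (r + 1) * exp k :=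
      e.trans (mlL e2 (by positivity))
    have e4 : (Fintype.card ι : ℝ) ≤ exp (k - 3) := by
      rw [← Real.log_le_iff_le_exp (by linarith)]; linarith
    have ek : ∀ c : ℝ, exp (c * k) = exp c ^ (r + 1) := fun c => by
      rw [← Real.exp_nat_mul]; congr 1; rw [hk]; push_cast; ring
    have x1 : exp 1 < 2.7182818286 := Real.exp_one_lt_d9
    have x2 := Real.exp_one_gt_d9
    have e5 : 4 * (1 / 100) * exp 1 * exp 1 ≤ 3 / 10 := by nlinarith
    have e6 : exp (-3) ≤ 1 / 10 := by
      rw [Real.exp_neg, show (3:ℝ) = (3:ℕ) * 1 by norm_num, Real.exp_nat_mul, one_div]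
      exact inv_anti₀ (by norm_num) (by nlinarith [pow_le_pow_left₀ (by norm_num) (show (2.5:ℝ) ≤ exp 1 by linarith) 3])
    calc 4 ^ (r + 1) * EE K T (Psi K r).f t ≤ 4 ^ (r + 1) * (exp (k - 3) * (1 / 100) ^ (r + 1) * exp k) := by
          refine mlL (e3.trans ?_) (by positivity)
          gcongr
      _ = (4 * (1 / 100) * exp 1 * exp 1) ^ (r + 1) * exp (-3) := by
          have := ek 1
          rw [one_mul] at this
          rw [sub_eq_add_neg, exp_add, this]; simp only [mul_pow]; ring
      _ ≤ (3 / 10) ^ 2 * (1 / 10) := by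
          refine mul_le_mul ?_ e6 (exp_pos _).le (by norm_num)
          exact (pow_le_pow_of_le_one (by positivity) (by linarith) (by omega : 2 ≤ r + 1)).trans (pow_le_pow_left₀ (by positivity) e5 2)
      _ ≤ _ := by norm_num
  rw [sT, one_div, inv_mul_le_iff₀ (by positivity)] at this
  linarith
end
section
variable {ι : Type} [Fintype ι] [DecidableEq ι]
structure Sn (q : (ι → ℝ) → ℝ) : Prop where
  add : ∀ x y, q (x + y) ≤ q x + q y
  neg : ∀ x, q (-x) = q x
  smul : ∀ (c : ℝ) x, 0 ≤ c → q (c • x) = c * q x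
  cont : Continuous q
def n2 (x : ι → ℝ) : ℝ := ∑ i, x i ^ 2
variable {q : (ι → ℝ) → ℝ} {b : ℝ}
lemma Sn.nonneg (h : Sn q) (x) : 0 ≤ q x := by
  have h1 := h.add x (-x)
  have h2 := h.smul 0 0 le_rfl
  rw [add_neg_cancel, h.neg] at h1
  simp at h2; linarith
lemma Sn.sub (h : Sn q) (x y) : q (x - y) ≤ q x + q y := by
  rw [sub_eq_add_neg]; exact (h.add _ _).trans (by rw [h.neg])
variable (hq : Sn q) (b0 : 0 < b) (hi : Integrable fun y => q y * rho y) (hb : ∫ y, q y * rho y ≤ b * ∫ y : ι → ℝ, rho y)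
def ind (q : (ι → ℝ) → ℝ) (b : ℝ) : (ι → ℝ) → ℝ := Set.indicator {y | q y ≤ 2 * b} 1
lemma ind_int (hq : Sn q) {f : (ι → ℝ) → ℝ} (hf : Integrable f) (w) : Integrable fun y => ind q b (y - w) * f y := by
  have m : Measurable fun y => ind q b (y - w) :=
    (measurable_one.indicator (isClosed_le hq.cont continuous_const).measurableSet).comp (measurable_id.sub_const w)
  refine hf.bdd_mul (c := 1) m.aestronglyMeasurable (Eventually.of_forall fun y => ?_)
  unfold ind Set.indicator; split_ifs <;> simp
lemma ind_shift (hq : Sn q) (w) : exp (-n2 w / 2) * ∫ y, ind q b y * rho y ≤ ∫ y, ind q b (y - w) * rho y := by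
  have e1 : ∫ y, ind q b (y - w) * rho y = ∫ y, ind q b y * rho (y + w) := by
    rw [← integral_sub_right_eq_self (fun y => ind q b y * rho (y + w)) w]; simp
  have hs : ∀ y, ind q b (-y) = ind q b y := fun y => by simp [ind, Set.indicator, hq.neg]
  have e2 : ∫ y, ind q b y * rho (y + w) = ∫ y, ind q b y * rho (y - w) := by
    rw [← integral_neg_eq_self]
    congr 1; funext y; rw [hs]; congr 1
    rw [rho, rho]; congr 3; refine sum_congr rfl fun i _ => ?_
    simp; ring
  have i1 : Integrable fun y => ind q b y * rho (y + w) := by simpa using ind_int (b := b) hq (rho_int.comp_add_right w) 0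
  have i2 : Integrable fun y => ind q b y * rho (y - w) := by simpa using ind_int (b := b) hq (rho_int.comp_sub_right w) 0
  have i3 : Integrable fun y => ind q b y * rho y := by simpa using ind_int (b := b) hq rho_int 0
  have e3 : ∫ y, ind q b y * rho (y + w) = ∫ y, 1 / 2 * (ind q b y * rho (y + w) + ind q b y * rho (y - w)) := by
    rw [integral_const_mul, integral_add i1 i2, ← e2]; ring
  rw [e1, e3, ← integral_const_mul]
  refine integral_mono (i3.const_mul _) ((i1.add i2).const_mul _) fun y => ?_
  have k : 2 * (exp (-n2 w / 2) * rho y) ≤ rho (y + w) + rho (y - w) := by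
    set c := ∑ i, y i * w i
    have f1 : rho (y + w) = exp (-n2 w / 2) * rho y * exp (-c) := by
      simp only [rho, n2, c]; rw [← exp_add, ← exp_add]; congr 1
      simp only [Pi.add_apply, add_sq, sum_add_distrib, mul_assoc, ← mul_sum]; ring
    have f2 : rho (y - w) = exp (-n2 w / 2) * rho y * exp c := by
      simp only [rho, n2, c]; rw [← exp_add, ← exp_add]; congr 1
      simp only [Pi.sub_apply, sub_sq, sum_add_distrib, sum_sub_distrib, mul_assoc, ← mul_sum]; ring
    have a1 := Real.add_one_le_exp c
    have a2 := Real.add_one_le_exp (-c)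
    have := mul_pos (exp_pos (-n2 w / 2)) (rho_pos y)
    rw [f1, f2]; nlinarith
  have i0 : 0 ≤ ind q b y := Set.indicator_nonneg (fun _ _ => zero_le_one) _
  have := mlL k i0
  simp only [] at *
  linarith
include hq b0 hi hb in
lemma ind_half : 1 / 2 * ∫ y : ι → ℝ, rho y ≤ ∫ y, ind q b y * rho y := by
  have i3 : Integrable fun y => ind q b y * rho y := by simpa using ind_int (b := b) hq rho_int 0
  have : ∫ y : ι → ℝ, rho y ≤ ∫ y, (ind q b y * rho y + 1 / (2 * b) * (q y * rho y)) := by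
    refine integral_mono rho_int (i3.add (hi.const_mul _)) fun y => ?_
    have r0 := rho_pos y
    by_cases h : q y ≤ 2 * b
    · have : ind q b y = 1 := by simp [ind, h]
      have q0 := hq.nonneg y
      simp only [this, one_mul]
      have : 0 ≤ 1 / (2 * b) * (q y * rho y) := by positivity
      linarith
    · have : ind q b y = 0 := by simp [ind, h]
      push Not at h
      simp only [this, zero_mul, zero_add]
      rw [← mul_assoc]
      refine le_mul_of_one_le_left r0.le ?_
      rw [one_div, ← div_eq_inv_mul, one_le_div (by positivity)]; exact h.le
  rw [integral_add i3 (hi.const_mul _), integral_const_mul] at this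
  have k : 1 / (2 * b) * ∫ y, q y * rho y ≤ 1 / 2 * ∫ y : ι → ℝ, rho y := by
    refine (mlL hb (by positivity)).trans (le_of_eq ?_)
    field_simp
  linarith
include hq b0 hi hb in
lemma sepbound {A : Finset (ι → ℝ)} {ρ s : ℝ} (s0 : 0 < s) (hA : ∀ x ∈ A, n2 x ≤ ρ ^ 2)
    (hs : ∀ x ∈ A, ∀ y ∈ A, x ≠ y → s < q (x - y)) : (#A : ℝ) ≤ 2 * exp (8 * b ^ 2 * ρ ^ 2 / s ^ 2) := by
  set l := 4 * b / s with hl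
  have l0 : 0 < l := by positivity
  have h1 : ∑ x ∈ A, ∫ y, ind q b (y - l • x) * rho y ≤ ∫ y : ι → ℝ, rho y := by
    rw [← integral_finsetSum _ fun x _ => ind_int hq rho_int _]
    refine integral_mono (integrable_finsetSum _ fun x _ => ind_int hq rho_int _) rho_int fun y => ?_
    simp only
    rw [← sum_mul]
    refine mul_le_of_le_one_left (rho_pos y).le ?_
    by_cases h : ∃ x ∈ A, q (y - l • x) ≤ 2 * b
    · obtain ⟨x, hx, hxq⟩ := h
      rw [Finset.sum_eq_single_of_mem x hx]
      · unfold ind Set.indicator; split_ifs <;> simp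
      · intro z hz hzx
        have : ¬ q (y - l • z) ≤ 2 * b := fun h => by
          have h2 := hq.sub (y - l • z) (y - l • x)
          have e : (y - l • z) - (y - l • x) = l • (x - z) := by rw [smul_sub]; abel
          rw [e, hq.smul _ _ l0.le] at h2
          have h3 := mul_lt_mul_of_pos_left (hs x hx z hz hzx.symm) l0
          have e : l * s = 4 * b := by rw [hl]; field_simp
          linarith
        simp [ind, this]
    · push Not at h
      rw [Finset.sum_eq_zero fun x hx => ?_]
      · exact zero_le_one
      · have := h x hx
        simp [ind, this]
  have h2 : ∀ x ∈ A, exp (-(8 * b ^ 2 * ρ ^ 2 / s ^ 2)) * (1 / 2 * ∫ y : ι → ℝ, rho y) ≤ ∫ y, ind q b (y - l • x) * rho y := fun x hx => by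
    refine le_trans ?_ (ind_shift hq (l • x))
    refine mul_le_mul (exp_le_exp.2 ?_) (ind_half hq b0 hi hb) (mul_nonneg (by norm_num) rho_int_pos.le) (exp_pos _).le
    have : n2 (l • x) = l ^ 2 * n2 x := by simp [n2, mul_pow, mul_sum]
    have e : l ^ 2 * ρ ^ 2 / 2 = 8 * b ^ 2 * ρ ^ 2 / s ^ 2 := by rw [hl]; field_simp; ring
    rw [this, ← e]
    nlinarith [hA x hx, sq_nonneg l, mlL (hA x hx) (sq_nonneg l)]
  have h3 := (Finset.card_nsmul_le_sum A _ _ h2).trans h1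
  rw [nsmul_eq_mul] at h3
  have r0 := rho_int_pos (ι := ι)
  have E0 := exp_pos (8 * b ^ 2 * ρ ^ 2 / s ^ 2)
  rw [Real.exp_neg] at h3
  set E := exp (8 * b ^ 2 * ρ ^ 2 / s ^ 2)
  have : (#A : ℝ) * (E⁻¹ * (1 / 2 * ∫ y : ι → ℝ, rho y)) = (#A / (2 * E)) * ∫ y : ι → ℝ, rho y := by field_simp
  rw [this] at h3
  have : (#A : ℝ) / (2 * E) ≤ 1 := le_of_mul_le_mul_right (by linarith) r0
  rwa [div_le_one (by positivity)] at this
lemma max_sep {α : Type} [DecidableEq α] (X : Set α) (r : α → α → Prop) (hr : ∀ x y, r x y → r y x) (M : ℝ)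
    (h : ∀ A : Finset α, (∀ x ∈ A, x ∈ X) → (∀ x ∈ A, ∀ y ∈ A, x ≠ y → r x y) → (#A : ℝ) ≤ M) :
    ∃ A : Finset α, (∀ x ∈ A, x ∈ X) ∧ (#A : ℝ) ≤ M ∧ ∀ x ∈ X, ∃ a ∈ A, x = a ∨ ¬ r x a := by
  classical
  let Q : ℕ → Prop := fun n => ∃ A : Finset α, #A = n ∧ (∀ x ∈ A, x ∈ X) ∧ (∀ x ∈ A, ∀ y ∈ A, x ≠ y → r x y)
  have hb : ∀ n, Q n → n ≤ ⌊M⌋₊ := fun n ⟨A, h1, h2, h3⟩ => Nat.le_floor (by rw [← h1]; exact h A h2 h3)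
  have h0 : Q 0 := ⟨∅, by simp⟩
  obtain ⟨A, h1, h2, h3⟩ := Nat.findGreatest_spec (hb 0 h0) h0
  refine ⟨A, h2, h A h2 h3, fun x hx => ?_⟩
  by_contra hc
  push Not at hc
  have hxA : x ∉ A := fun hxA => (hc x hxA).1 rfl
  have : Q (#A + 1) := by
    refine ⟨insert x A, Finset.card_insert_of_notMem hxA, ?_, ?_⟩
    · intro y hy; rcases Finset.mem_insert.1 hy with rfl | hy
      · exact hx
      · exact h2 y hy
    · intro y hy z hz hyz
      rcases Finset.mem_insert.1 hy with ey | ey <;> rcases Finset.mem_insert.1 hz with ez | ez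
      · exact absurd (ey.trans ez.symm) hyz
      · rw [ey]; exact (hc z ez).2
      · rw [ez]; exact hr _ _ (hc y ey).2
      · exact h3 y ey z ez hyz
  have := Nat.le_findGreatest (hb _ this) this
  omega
include hq b0 hi hb in
lemma dualSud {ρ s : ℝ} (s0 : 0 < s) : ∃ A : Finset (ι → ℝ), (#A : ℝ) ≤ exp (24 * b ^ 2 * ρ ^ 2 / s ^ 2) ∧
    ∀ x, n2 x ≤ ρ ^ 2 → ∃ a ∈ A, q (x - a) ≤ s := by
  classical
  by_cases h : ∀ x, n2 x ≤ ρ ^ 2 → q x ≤ s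
  · exact ⟨{0}, by simpa using by positivity, fun x hx => ⟨0, by simp, by simpa using h x hx⟩⟩
  push Not at h
  obtain ⟨x, hx, hxs⟩ := h
  have q0 : q 0 = 0 := by have := hq.smul 0 0 le_rfl; simpa using this
  have x0 : x ≠ 0 := fun h => by rw [h, q0] at hxs; linarith
  have hxn : x ≠ -x := fun h => x0 (self_eq_neg.1 h)
  have h2x : s < q (x - -x) := by
    rw [sub_neg_eq_add, ← two_smul ℝ x, hq.smul _ _ (by norm_num)]; linarith
  have hc := sepbound hq b0 hi hb (A := {x, 0, -x}) (ρ := ρ) s0 (by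
    intro y hy; simp only [Finset.mem_insert, Finset.mem_singleton] at hy
    rcases hy with rfl | rfl | rfl
    · exact hx
    · simp [n2]; positivity
    · simpa [n2] using hx) (by
    intro y hy z hz hyz; simp only [Finset.mem_insert, Finset.mem_singleton] at hy hz
    have e : -x - x = -(x - -x) := by abel
    rcases hy with rfl | rfl | rfl <;> rcases hz with rfl | rfl | rfl <;>
      first | exact absurd rfl hyz | simpa [hq.neg] using hxs | exact h2x | (rw [e, hq.neg]; exact h2x))
  have c3 : #({x, 0, -x} : Finset (ι → ℝ)) = 3 := by
    rw [Finset.card_insert_of_notMem, Finset.card_insert_of_notMem, Finset.card_singleton]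
    · simpa using x0
    · simp [x0, hxn]
  rw [c3] at hc
  set E := 8 * b ^ 2 * ρ ^ 2 / s ^ 2 with hE
  have e3 : 24 * b ^ 2 * ρ ^ 2 / s ^ 2 = E + (E + E) := by rw [hE]; ring
  obtain ⟨A, h1, h2, h3⟩ := max_sep {x | n2 x ≤ ρ ^ 2} (fun x y => s < q (x - y)) (fun x y h => by
    rw [← hq.neg]; simpa using h) _ fun A h1 h2 => sepbound hq b0 hi hb s0 h1 h2
  refine ⟨A, h2.trans ?_, fun y hy => ?_⟩
  · rw [e3, exp_add, exp_add]
    push_cast at hc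
    nlinarith [exp_pos E]
  · obtain ⟨a, ha, h⟩ := h3 y hy
    refine ⟨a, ha, ?_⟩
    rcases h with rfl | h
    · rw [sub_self, q0]; exact s0.le
    · exact not_lt.1 h
include hq b0 hi hb in
lemma sud_step {W : Set (ι → ℝ)} (hW : ∀ y ∈ W, ∀ x, ∑ i, y i * x i ≤ q x) {τ M : ℝ} (t0 : 0 < τ)
    (h : ∃ A : Finset (ι → ℝ), (∀ a ∈ A, a ∈ W) ∧ (#A : ℝ) ≤ M ∧ ∀ y ∈ W, ∃ a ∈ A, n2 (y - a) ≤ (2 * τ) ^ 2) :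
    ∃ A : Finset (ι → ℝ), (∀ a ∈ A, a ∈ W) ∧ (#A : ℝ) ≤ M * exp (1536 * b ^ 2 / τ ^ 2) ∧ ∀ y ∈ W, ∃ a ∈ A, n2 (y - a) ≤ τ ^ 2 := by
  classical
  obtain ⟨A, hAW, hAM, hA⟩ := h
  obtain ⟨C, hCM, hC⟩ := dualSud hq b0 hi hb (ρ := 2 * τ) (s := τ ^ 2 / 4) (by positivity)
  let Q : (ι → ℝ) × (ι → ℝ) → Prop := fun p => ∃ y ∈ W, q (y - p.1 - p.2) ≤ τ ^ 2 / 4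
  let f : (ι → ℝ) × (ι → ℝ) → (ι → ℝ) := fun p => if h : Q p then h.choose else 0
  have hf : ∀ p, Q p → f p ∈ W ∧ q (f p - p.1 - p.2) ≤ τ ^ 2 / 4 := fun p h => by
    simp only [f, dif_pos h]; exact h.choose_spec
  refine ⟨((A ×ˢ C).filter Q).image f, ?_, ?_, ?_⟩
  · intro a ha
    obtain ⟨p, hp, rfl⟩ := Finset.mem_image.1 ha
    exact (hf p (Finset.mem_filter.1 hp).2).1
  · have c1 : #(((A ×ˢ C).filter Q).image f) ≤ #A * #C :=
      Finset.card_image_le.trans ((Finset.card_filter_le _ _).trans (Finset.card_product _ _).le)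
    have c2 : (#(((A ×ˢ C).filter Q).image f) : ℝ) ≤ #A * #C := by exact_mod_cast c1
    refine c2.trans (mul_le_mul hAM (hCM.trans (le_of_eq ?_)) (by positivity) ((Nat.cast_nonneg _).trans hAM))
    congr 1; field_simp; ring
  · intro y hy
    obtain ⟨a, ha, hya⟩ := hA y hy
    obtain ⟨c, hc, hyc⟩ := hC (y - a) hya
    have hQ : Q (a, c) := ⟨y, hy, hyc⟩
    obtain ⟨g1, g2⟩ := hf _ hQ
    refine ⟨f (a, c), Finset.mem_image_of_mem _ (Finset.mem_filter.2 ⟨Finset.mem_product.2 ⟨ha, hc⟩, hQ⟩), ?_⟩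
    set z := f (a, c)
    have k1 := hq.sub (y - a - c) (z - a - c)
    have e : (y - a - c) - (z - a - c) = y - z := by abel
    rw [e] at k1
    have k2 := hW y hy (y - z)
    have k3 := hW z g1 (-(y - z))
    rw [hq.neg] at k3
    have e2 : n2 (y - z) = ∑ i, y i * (y - z) i + ∑ i, z i * (-(y - z)) i := by
      rw [n2, ← sum_add_distrib]; refine sum_congr rfl fun i _ => ?_
      simp; ring
    rw [e2]; linarith
include hq b0 hi hb in
lemma sud {W : Set (ι → ℝ)} (hW : ∀ y ∈ W, ∀ x, ∑ i, y i * x i ≤ q x) (hW0 : 0 ∈ W) {D : ℝ} (hD : ∀ y ∈ W, n2 y ≤ D ^ 2) {τ : ℝ} (t0 : 0 < τ) :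
    ∃ A : Finset (ι → ℝ), (∀ a ∈ A, a ∈ W) ∧ (#A : ℝ) ≤ exp (2048 * b ^ 2 / τ ^ 2) ∧ ∀ y ∈ W, ∃ a ∈ A, n2 (y - a) ≤ τ ^ 2 := by
  have key : ∀ (j : ℕ) (τ : ℝ), 0 < τ → |D| ≤ 2 ^ j * τ → ∃ A : Finset (ι → ℝ), (∀ a ∈ A, a ∈ W) ∧
      (#A : ℝ) ≤ exp (2048 * b ^ 2 / τ ^ 2) ∧ ∀ y ∈ W, ∃ a ∈ A, n2 (y - a) ≤ τ ^ 2 := by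
    intro j
    induction j with
    | zero =>
      intro τ t0 h
      refine ⟨{0}, by simpa using hW0, by simpa using by positivity, fun y hy => ⟨0, by simp, ?_⟩⟩
      rw [sub_zero]; refine (hD y hy).trans ?_
      rw [← sq_abs D]; exact pow_le_pow_left₀ (abs_nonneg _) (by simpa using h) 2
    | succ j ih =>
      intro τ t0 h
      obtain ⟨A, h1, h2, h3⟩ := sud_step hq b0 hi hb hW t0 (ih (2 * τ) (by positivity) (by rw [pow_succ] at h; linarith))
      refine ⟨A, h1, h2.trans (le_of_eq ?_), h3⟩
      rw [← exp_add]; congr 1; field_simp; ring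
  obtain ⟨j, hj⟩ := pow_unbounded_of_one_lt (|D| / τ) (one_lt_two)
  exact key j τ t0 (by rw [div_lt_iff₀ t0] at hj; exact hj.le)
end
section
variable {ι : Type} [Fintype ι] [DecidableEq ι] {K : Set (ι → ℝ)}
lemma exF (hK : IsCompact K) (hc : Convex ℝ K) (h0 : (0 : ι → ℝ) ∈ interior K) : ∃ F : Finset (ι → ℝ), 0 ∈ F ∧
    (∀ v ∈ F, ∀ x ∈ K, ∑ i, v i * x i ≤ 1) ∧ ∀ x, (∀ v ∈ F, ∑ i, v i * x i ≤ 1) → x ∈ (2:ℝ) • K := by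
  classical
  have h0K := interior_subset h0
  have hS : IsCompact (frontier ((2:ℝ) • K)) := (hK.smul 2).of_isClosed_subset isClosed_frontier (hK.smul 2).isClosed.frontier_subset
  have hv : ∀ x, ∃ v : ι → ℝ, x ∈ frontier ((2:ℝ) • K) → (∀ y ∈ K, ∑ i, v i * y i ≤ 1) ∧ 1 < ∑ i, v i * x i := by
    intro x
    by_cases hx : x ∈ frontier ((2:ℝ) • K)
    · have hxK : x ∉ K := by
        intro hxK
        have := hc.combo_self_interior_mem_interior hxK h0 (a := 1/2) (b := 1/2) (by norm_num) (by norm_num) (by norm_num)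
        have h2 := Set.smul_mem_smul_set (a := (2:ℝ)) this
        rw [← interior_smul₀ two_ne_zero] at h2
        refine hx.2 (by simpa [smul_smul] using h2)
      obtain ⟨f, u, h1, h2⟩ := geometric_hahn_banach_closed_point hc hK.isClosed hxK
      have u0 : 0 < u := by simpa using h1 0 h0K
      have e : ∀ y, ∑ i, (f (Pi.single i 1) / u) * y i = f y / u := fun y => by
        have h3 := LinearMap.pi_apply_eq_sum_univ f.toLinearMap y
        rw [show f y = f.toLinearMap y from rfl, h3, sum_div]
        refine sum_congr rfl fun i _ => ?_
        simp only [ContinuousLinearMap.coe_coe, smul_eq_mul]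
        rw [show (fun j => if i = j then (1:ℝ) else 0) = Pi.single i 1 from by ext j; simp [Pi.single_apply, eq_comm]]
        ring
      refine ⟨fun i => f (Pi.single i 1) / u, fun _ => ⟨fun y hy => ?_, ?_⟩⟩
      · rw [e, div_le_one u0]; exact (h1 y hy).le
      · rw [e, one_lt_div u0]; exact h2
    · exact ⟨0, fun h => absurd h hx⟩
  choose v hv using hv
  obtain ⟨T, hT, hcov⟩ := hS.elim_nhds_subcover (fun x => {y | 1 < ∑ i, v x i * y i}) fun x hx =>
    (isOpen_lt continuous_const (by fun_prop)).mem_nhds (hv x hx).2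
  refine ⟨insert 0 (T.image v), by simp, fun w hw x hx => ?_, fun x hx => ?_⟩
  · rcases Finset.mem_insert.1 hw with rfl | hw
    · simp
    · obtain ⟨z, hz, rfl⟩ := Finset.mem_image.1 hw
      exact (hv z (hT z hz)).1 x hx
  · by_contra hn
    have hcl := (hK.smul (2:ℝ)).isClosed
    obtain ⟨z, hz, hzf⟩ : ∃ z ∈ segment ℝ 0 x, z ∈ frontier ((2:ℝ) • K) := by
      by_contra! hne
      obtain ⟨z, -, hz1, hz2⟩ := (convex_segment (𝕜 := ℝ) (0 : ι → ℝ) x).isPreconnected _ _ (isOpen_interior (s := (2:ℝ) • K)) hcl.isOpen_compl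
        (fun z hz => by
          by_contra hzz
          simp only [Set.mem_union, Set.mem_compl_iff, not_or, not_not] at hzz
          exact hne z hz ⟨subset_closure hzz.2, hzz.1⟩)
        ⟨0, left_mem_segment ℝ _ _, by rw [interior_smul₀ two_ne_zero]; exact ⟨0, h0, by simp⟩⟩ ⟨x, right_mem_segment ℝ _ _, hn⟩
      exact hz2 (interior_subset hz1)
    rw [segment_eq_image'] at hz
    obtain ⟨s, ⟨s0, s1⟩, rfl⟩ := hz
    have h3 := hcov hzf
    simp only [Set.mem_iUnion] at h3
    obtain ⟨y, hy, h4⟩ := h3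
    have h5 := hx (v y) (Finset.mem_insert_of_mem (Finset.mem_image_of_mem _ hy))
    have h6 : ∑ i, v y i * (0 + s • (x - 0)) i = s * ∑ i, v y i * x i := by
      rw [mul_sum]; refine sum_congr rfl fun i _ => by simp; ring
    simp only [Set.mem_setOf_eq, h6] at h4
    nlinarith
lemma exq [Nonempty ι] (hK : IsCompact K) (hc : Convex ℝ K) (h00 : (0 : ι → ℝ) ∈ interior K) (h0 : 0 < volume.real K)
    (hiso : ∀ p : Pt (ι ⊕ ι), p.1 = 0 → (∀ i, p.2 (Sum.inl i) = 0) → Matrix.of (Cv (Ep K p)) = 1)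
    (hmn : ∀ p : Pt (ι ⊕ ι), p.1 = 0 → (∀ i, p.2 (Sum.inl i) = 0) → ∀ i, mn (Ep K p) i = 0)
    {r : ℕ} (hr : log (Fintype.card ι) + 3 ≤ r + 1) : ∃ q : (ι → ℝ) → ℝ, Sn q ∧ (Integrable fun y => q y * rho y) ∧
      (∫ y, q y * rho y ≤ (416000 * (r + 1)) * ∫ y : ι → ℝ, rho y) ∧ (∀ x, q x ≤ 1 → x ∈ (2:ℝ) • K) ∧ ∃ C, 0 ≤ C ∧ ∀ x, q x ≤ C * ∑ i, |x i| := by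
  obtain ⟨F, hF0, hF1, hF2⟩ := exF hK hc h00
  let v : F → ι → ℝ := fun w => w
  have hr0 : v ⟨0, hF0⟩ = 0 := rfl
  have : Nonempty F := ⟨⟨0, hF0⟩⟩
  set C := ∑ r, ∑ i, |v r i| with hC
  have C0 : 0 ≤ C := by positivity
  have hbd : ∀ x, hm v x ≤ C * ∑ i, |x i| := fun x => by
    refine (le_abs_self _).trans ((hm_abs hr0 x).trans ?_)
    rw [hC, sum_mul]; refine sum_le_sum fun r _ => ?_
    rw [sum_mul]; refine sum_le_sum fun i _ => ?_
    exact mlL (single_le_sum (f := fun i => |x i|) (fun i _ => abs_nonneg _) (Finset.mem_univ i)) (abs_nonneg _)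
  have hint : Integrable fun y => hm v y * rho y := by
    refine gint (C := C * Fintype.card ι) (R := 1) hm_cont fun y => ?_
    rw [abs_of_nonneg (hm_nonneg hr0 y)]
    refine (hbd y).trans ?_
    have : ∑ i, |y i| ≤ Fintype.card ι * ‖y‖ := by
      rw [← nsmul_eq_mul, ← Finset.card_univ]
      exact Finset.sum_le_card_nsmul _ _ _ fun i _ => norm_le_pi_norm y i
    rw [mul_assoc]; refine mlL (this.trans ?_) C0
    refine mlL ?_ (by positivity)
    have := Real.add_one_le_exp (1 * ‖y‖); linarith
  have hneg : ∀ y : ι → ℝ, rho (-y) = rho y := fun y => by simp [rho]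
  have hint' : Integrable fun y => hm v (-y) * rho y := by
    have := hint.comp_neg; simpa only [hneg] using this
  have ei : ∫ y, hm v (-y) * rho y = ∫ y, hm v y * rho y := by
    rw [← integral_neg_eq_self (fun y => hm v y * rho y)]; simp only [hneg]
  have hgm : gm v ≤ 208000 * (r + 1) := by
    set β := max 1 (log (Fintype.card F))
    have b1 : 1 ≤ β := le_max_left _ _
    have h1 := gm_final (v := fun r => β • v r) (β := β) (r0 := ⟨0, hF0⟩) hK hc ⟨0, h00⟩ h0 hiso hmn (fun w x hx => by
      have := hF1 w w.2 x hx
      calc ∑ i, (β • v w) i * x i = β * ∑ i, v w i * x i := by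
            rw [mul_sum]; refine sum_congr rfl fun i _ => by simp; ring
        _ ≤ β * 1 := mlL this (by linarith)
        _ = β := mul_one β) (by simp [hr0]) (le_max_right _ _) hr
    have h2 : gm (fun r => β • v r) = β * gm v := by
      have : ∀ x, hm (fun r => β • v r) x = β * hm v x := fun x => by
        rw [← hm_smul (by linarith)]; unfold hm; congr 1; funext r
        refine sum_congr rfl fun i _ => by simp; ring
      simp only [gm, this, mul_assoc]
      rw [integral_const_mul, mul_div_assoc]
    rw [h2] at h1
    exact le_of_mul_le_mul_left (by linarith) (by linarith : 0 < β)
  refine ⟨fun x => hm v x + hm v (-x), ⟨fun x y => ?_, fun x => ?_, fun c x c0 => ?_, ?_⟩, ?_, ?_, fun x hx => ?_, 2 * C, by positivity, fun x => ?_⟩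
  · have ha : ∀ x y, hm v (x + y) ≤ hm v x + hm v y := fun x y => hm_le fun r => by
      have := add_le_add (le_hm (v := v) x r) (le_hm (v := v) y r)
      rw [← sum_add_distrib] at this
      simpa [mul_add] using this
    have := ha x y; have := ha (-x) (-y)
    rw [neg_add]; linarith
  · simp only [neg_neg]; ring
  · simp only [← smul_neg, hm_smul c0]; ring
  · exact hm_cont.add (hm_cont.comp continuous_neg)
  · simp only [add_mul]; exact hint.add hint'
  · simp only [add_mul]
    rw [integral_add hint hint', ei]
    rw [gm, div_le_iff₀ rho_int_pos] at hgm
    linarith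
  · refine hF2 x fun w hw => ?_
    have := le_hm (v := v) x ⟨w, hw⟩
    have := hm_nonneg hr0 (-x)
    simp only at hx
    exact (le_hm (v := v) x ⟨w, hw⟩).trans (by linarith)
  · have := hbd x; have := hbd (-x)
    simp only [Pi.neg_apply, abs_neg] at this
    simp only; linarith
lemma cov2 [Nonempty ι] (hK : IsCompact K) (hc : Convex ℝ K) (h00 : (0 : ι → ℝ) ∈ interior K) (h0 : 0 < volume.real K)
    (hiso : ∀ p : Pt (ι ⊕ ι), p.1 = 0 → (∀ i, p.2 (Sum.inl i) = 0) → Matrix.of (Cv (Ep K p)) = 1)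
    (hmn : ∀ p : Pt (ι ⊕ ι), p.1 = 0 → (∀ i, p.2 (Sum.inl i) = 0) → ∀ i, mn (Ep K p) i = 0)
    {r : ℕ} (hr : log (Fintype.card ι) + 3 ≤ r + 1) {ρ s : ℝ} (s0 : 0 < s) (hρ : 0 < ρ) :
    (∃ A : Finset (ι → ℝ), (#A : ℝ) ≤ exp (8192 * (416000 * (r + 1)) ^ 2 * ρ ^ 2 / s ^ 2) ∧
      ∀ x, n2 x ≤ ρ ^ 2 → ∃ a ∈ A, x - a ∈ s • K) ∧
    (∃ A : Finset (ι → ℝ), (#A : ℝ) ≤ exp (8192 * (416000 * (r + 1)) ^ 2 * ρ ^ 2 / s ^ 2) ∧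
      ∀ y : ι → ℝ, (∀ x ∈ K, ∑ i, y i * x i ≤ 1) → ∃ a ∈ A, n2 (y - a) ≤ (s / ρ) ^ 2) := by
  classical
  obtain ⟨q, hq, hi, hb, hqK, C, C0, hC⟩ := exq hK hc h00 h0 hiso hmn hr
  set b : ℝ := 416000 * (r + 1)
  have b0 : 0 < b := by positivity
  constructor
  · obtain ⟨A, h1, h2⟩ := dualSud hq b0 hi hb (ρ := ρ) (s := s / 2) (by positivity)
    refine ⟨A, h1.trans (exp_le_exp.2 ?_), fun x hx => ?_⟩
    · rw [show 24 * b ^ 2 * ρ ^ 2 / (s / 2) ^ 2 = 96 * b ^ 2 * ρ ^ 2 / s ^ 2 by field_simp; ring]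
      gcongr; norm_num
    · obtain ⟨a, ha, h3⟩ := h2 x hx
      refine ⟨a, ha, ?_⟩
      have h4 := hqK ((2 / s) • (x - a)) (by
        rw [hq.smul _ _ (by positivity)]
        calc 2 / s * q (x - a) ≤ 2 / s * (s / 2) := by gcongr
          _ = 1 := by field_simp)
      obtain ⟨k, hk, e⟩ := h4
      refine ⟨k, hk, ?_⟩
      have := congrArg (fun z => (s / 2) • z) e
      simp only [smul_smul] at this
      rw [show s / 2 * (2 / s) = 1 by field_simp, one_smul, div_mul_cancel₀ _ (two_ne_zero)] at this
      exact this
  · set W : Set (ι → ℝ) := {y | ∀ x, ∑ i, y i * x i ≤ q x}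
    obtain ⟨A, h0, h1, h2⟩ := sud hq b0 hi hb (W := W) (fun y hy => hy) (fun x => by simpa using hq.nonneg x)
      (D := Fintype.card ι * C) (fun y hy => by
        have h1 := (hy y).trans (hC y)
        have h2 : C * ∑ i, |y i| ≤ n2 y / 2 + Fintype.card ι * C ^ 2 / 2 := by
          rw [mul_sum, n2, sum_div, ← nsmul_eq_mul, ← Finset.card_univ, ← Finset.sum_const, sum_div, ← sum_add_distrib]
          refine sum_le_sum fun i _ => ?_
          rw [← sq_abs (y i)]; nlinarith [sq_nonneg (|y i| - C)]
        have h3 : ∑ i, y i * y i = n2 y := by simp only [n2, sq]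
        have n1 : (1:ℝ) ≤ Fintype.card ι := by exact_mod_cast Fintype.card_pos
        have h4 : (Fintype.card ι : ℝ) * C ^ 2 ≤ (Fintype.card ι * C) ^ 2 := by
          rw [mul_pow]; refine mlR ?_ (sq_nonneg C); nlinarith
        linarith) (τ := s / (2 * ρ)) (by positivity)
    refine ⟨A.image fun a => (2:ℝ) • a, (Nat.cast_le.2 Finset.card_image_le).trans (h1.trans (le_of_eq ?_)), fun y hy => ?_⟩
    · congr 1; field_simp; ring
    · have hyW : (1/2 : ℝ) • y ∈ W := by
        intro x
        have e : ∀ (a b : ℝ) (z : ι → ℝ), ∑ i, (a • y) i * (b • z) i = a * b * ∑ i, y i * z i := fun a b z => by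
          rw [mul_sum]; refine sum_congr rfl fun i _ => by simp; ring
        have key : ∀ l : ℝ, 0 < l → q x < l → ∑ i, y i * x i ≤ 2 * l := by
          intro l l0 hl
          obtain ⟨k, hk, ek⟩ := hqK ((1 / l) • x) (by
            rw [hq.smul _ _ (by positivity), one_div, inv_mul_le_iff₀ l0]; linarith)
          have h3 := hy k hk
          have h4 := e 1 (1 / l) x
          rw [← ek, show (fun x => (2:ℝ) • x) k = (2:ℝ) • k from rfl, e 1 2 k] at h4
          have h5 : 2 * ∑ i, y i * k i = (∑ i, y i * x i) / l := by rw [← one_mul 2, h4]; ring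
          have h6 : (∑ i, y i * x i) / l ≤ 2 := by linarith
          rwa [div_le_iff₀ l0] at h6
        have h1 := e (1/2) 1 x
        rw [one_smul] at h1
        rw [h1]
        refine le_of_forall_pos_le_add fun ε ε0 => ?_
        have := key (q x + ε) (by have := hq.nonneg x; linarith) (by linarith)
        linarith
      obtain ⟨a, ha, h3⟩ := h2 _ hyW
      refine ⟨(2:ℝ) • a, Finset.mem_image_of_mem _ ha, ?_⟩
      have e : n2 (y - (2:ℝ) • a) = 4 * n2 ((1/2 : ℝ) • y - a) := by
        rw [n2, n2, mul_sum]; refine sum_congr rfl fun i _ => by simp; ring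
      rw [e]; calc _ ≤ 4 * (s / (2 * ρ)) ^ 2 := by linarith
        _ = _ := by field_simp; ring
end
section
variable {n : ℕ} {K : Set (EuclideanSpace ℝ (Fin n))}
lemma intOn (hK : IsCompact K) {f : EuclideanSpace ℝ (Fin n) → ℝ} (hf : Continuous f) : IntegrableOn f K := hf.continuousOn.integrableOn_compact hK
lemma bar0 (hK : IsCompact K) (hb : (∫ x in K, x) = 0) (f : EuclideanSpace ℝ (Fin n) →L[ℝ] ℝ) : ∫ x in K, f x = 0 := by
  have : IntegrableOn (fun x => x) K := (continuous_id (X := EuclideanSpace ℝ (Fin n))).continuousOn.integrableOn_compact hK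
  rw [f.integral_comp_comm this, hb, map_zero]
lemma zero_int (hK : IsCompact K) (hc : Convex ℝ K) (hi : (interior K).Nonempty) (hb : (∫ x in K, x) = 0) : 0 ∈ interior K := by
  by_contra h
  obtain ⟨f, hf⟩ := geometric_hahn_banach_open_point hc.interior isOpen_interior h
  rw [map_zero] at hf
  have h1 : ∀ x ∈ K, f x ≤ 0 := by
    intro x hx
    have : x ∈ closure (interior K) := by
      rw [hc.closure_interior_eq_closure_of_nonempty_interior hi]; exact subset_closure hx
    exact closure_minimal (fun a ha => (hf a ha).le) (isClosed_le f.continuous continuous_const) this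
  have h2 := (setIntegral_pos_iff_support_of_nonneg_ae (μ := volume) (s := K) (f := fun x => -f x)
    ((ae_restrict_iff' hK.measurableSet).2 (Eventually.of_forall fun x hx => by simpa using h1 x hx)) (intOn hK (by fun_prop))).2
    ((isOpen_interior.measure_pos volume hi).trans_le (measure_mono fun x hx => ⟨by simpa using (hf x hx).ne, interior_subset hx⟩))
  rw [integral_neg, bar0 hK hb f] at h2
  simp at h2
variable {L : ℝ}
lemma mom (hK : IsCompact K) (hL : ∀ ξ : EuclideanSpace ℝ (Fin n), ‖ξ‖ = 1 → (∫ x in K, (⟪x, ξ⟫) ^ 2) = L ^ 2) (i j : Fin n) :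
    ∫ x in K, x i * x j = if i = j then L ^ 2 else 0 := by
  have h1 : ∀ i, ∫ x in K, x i * x i = L ^ 2 := fun i => by
    have := hL (EuclideanSpace.single i 1) (by simp)
    simpa [sq, EuclideanSpace.inner_single_right] using this
  split_ifs with h
  · rw [← h, h1]
  · set a : ℝ := (√2)⁻¹
    have ha : a ^ 2 = 1 / 2 := by simp [a]
    have hx : ∀ x : EuclideanSpace ℝ (Fin n), ⟪x, EuclideanSpace.single i a + EuclideanSpace.single j a⟫ = a * (x i + x j) := fun x => by
      rw [inner_add_right]; simp [EuclideanSpace.inner_single_right]; ring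
    have := hL (EuclideanSpace.single i a + EuclideanSpace.single j a) (by
      rw [← sq_eq_sq₀ (norm_nonneg _) zero_le_one, ← real_inner_self_eq_norm_sq, hx]
      simp [h, Ne.symm h]; nlinarith)
    simp only [hx] at this
    have e : ∀ x : EuclideanSpace ℝ (Fin n), (a * (x i + x j)) ^ 2 = (1/2) * (x i * x i) + (1/2) * (x j * x j) + x i * x j := fun x => by
      rw [mul_pow, ha]; ring
    simp only [e] at this
    rw [integral_add, integral_add, integral_const_mul, integral_const_mul, h1, h1] at this
    · linarith
    all_goals exact intOn hK (by fun_prop)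
lemma rn_le (hK : IsCompact K) (hn : 2 ≤ n) (hv : volume K = 1) (L0 : 0 < L) (hL : ∀ ξ : EuclideanSpace ℝ (Fin n), ‖ξ‖ = 1 → (∫ x in K, (⟪x, ξ⟫) ^ 2) = L ^ 2)
    {R : ℝ} (R0 : 0 < R) (hR : R ^ n * volume.real (Metric.closedBall (0 : EuclideanSpace ℝ (Fin n)) 1) = 1) : R ^ 2 ≤ 4 * n * L ^ 2 := by
  have h1 : ∫ x in K, ‖x‖ ^ 2 = n * L ^ 2 := by
    simp only [EuclideanSpace.real_norm_sq_eq]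
    rw [integral_finset_sum _ fun i _ => intOn hK (by fun_prop)]
    simp only [sq, mom hK hL]; simp [sq]
  have h2 := mul_meas_ge_le_integral_of_nonneg (μ := volume.restrict K) (f := fun x => ‖x‖ ^ 2) (Eventually.of_forall fun x => by positivity)
    (intOn hK (by fun_prop)) (2 * n * L ^ 2)
  rw [h1] at h2
  have n0 : (0:ℝ) < n := by positivity
  set μ := (volume : Measure (EuclideanSpace ℝ (Fin n))).restrict K
  have : IsProbabilityMeasure μ := ⟨by simp [μ, hv]⟩
  have h3 : μ.real {x | 2 * n * L ^ 2 ≤ ‖x‖ ^ 2} ≤ 1 / 2 := by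
    have : 0 < n * L ^ 2 := by positivity
    nlinarith
  set a := √(2 * n * L ^ 2)
  have ha : a ^ 2 = 2 * n * L ^ 2 := Real.sq_sqrt (by positivity)
  have h4 : 1 / 2 ≤ volume.real (Metric.closedBall (0 : EuclideanSpace ℝ (Fin n)) a) := by
    have h5 : μ.real Set.univ ≤ μ.real (Metric.closedBall 0 a) + μ.real {x | 2 * n * L ^ 2 ≤ ‖x‖ ^ 2} := by
      refine (measureReal_mono fun x _ => ?_).trans (measureReal_union_le _ _)
      by_cases h : 2 * n * L ^ 2 ≤ ‖x‖ ^ 2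
      · exact Or.inr h
      · left; rw [mem_closedBall_zero_iff]; exact Real.le_sqrt_of_sq_le (by linarith)
    have h6 : μ.real (Metric.closedBall 0 a) ≤ volume.real (Metric.closedBall (0 : EuclideanSpace ℝ (Fin n)) a) :=
      ENNReal.toReal_mono (measure_closedBall_lt_top).ne (Measure.restrict_apply_le _ _)
    rw [probReal_univ] at h5; linarith
  rw [Measure.addHaar_real_closedBall' _ _ (Real.sqrt_nonneg _), finrank_euclideanSpace_fin] at h4
  by_contra hcon
  push Not at hcon
  set V := volume.real (Metric.closedBall (0 : EuclideanSpace ℝ (Fin n)) 1)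
  have V0 : 0 < V := by by_contra hV; nlinarith [pow_pos R0 n]
  have h7 : 4 * (a ^ n * V) ^ 2 < 1 := by
    have e1 : (a ^ n * V) ^ 2 = (a ^ 2) ^ n * V ^ 2 := by ring
    have e2 : (a ^ 2) ^ n < (R ^ 2 / 2) ^ n := pow_lt_pow_left₀ (by rw [ha]; linarith) (by positivity) (by omega)
    have e3 : (R ^ 2 / 2) ^ n * V ^ 2 = (R ^ n * V) ^ 2 / 2 ^ n := by rw [div_pow]; ring
    have e4 : (4:ℝ) ≤ 2 ^ n := by calc (4:ℝ) = 2 ^ 2 := by norm_num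
                                    _ ≤ _ := pow_le_pow_right₀ (by norm_num) hn
    have e5 : (1:ℝ) / 2 ^ n ≤ 1 / 4 := by gcongr
    have e6 := mul_lt_mul_of_pos_right e2 (pow_pos V0 2)
    rw [e3, hR, one_pow] at e6
    rw [e1]; linarith
  nlinarith
def Kn (L : ℝ) (K : Set (EuclideanSpace ℝ (Fin n))) : Set (Fin n → ℝ) := L⁻¹ • (WithLp.toLp 2 ⁻¹' K)
lemma Kn_int (L0 : 0 < L) (f : (Fin n → ℝ) → ℝ) : ∫ x in Kn L K, f x = (L ^ n)⁻¹ * ∫ x in K, f (L⁻¹ • x.ofLp) := by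
  have h1 := Measure.setIntegral_comp_smul_of_pos (volume : Measure (Fin n → ℝ)) (fun x => f (L⁻¹ • x)) (Kn L K) L0
  have h2 := (PiLp.volume_preserving_toLp (Fin n)).setIntegral_preimage_emb (MeasurableEquiv.toLp 2 (Fin n → ℝ)).measurableEmbedding
    (fun x => f (L⁻¹ • x.ofLp)) K
  simp only [smul_smul, inv_mul_cancel₀ L0.ne', one_smul] at h1
  rw [h1, ← h2, Kn, smul_inv_smul₀ L0.ne']; simp
lemma Kn_Ep (L0 : 0 < L) (hv : volume K = 1) {p : Pt (Fin n ⊕ Fin n)} (h1 : p.1 = 0) (h2 : ∀ i, p.2 (Sum.inl i) = 0) (f) :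
    Ep (Kn L K) p f = ∫ x in K, f (L⁻¹ • x.ofLp) := by
  rw [Ep_eq]; simp only [Im, ex_apply, h1, h2]
  simp only [mul_zero, Finset.sum_const_zero, add_zero, exp_zero, mul_one]
  rw [Kn_int L0, Kn_int L0]
  have : L ^ n ≠ 0 := (pow_pos L0 n).ne'
  simp [measureReal_def, hv]; field_simp
lemma main8 (hn : 2 ≤ n) (hK : IsCompact K) (hc : Convex ℝ K) (hi : (interior K).Nonempty) (hv : volume K = 1) (hb : (∫ x in K, x) = 0)
    (L0 : 0 < L) (hL : ∀ ξ : EuclideanSpace ℝ (Fin n), ‖ξ‖ = 1 → (∫ x in K, (⟪x, ξ⟫) ^ 2) = L ^ 2)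
    {R : ℝ} (R0 : 0 < R) (hR : R ^ n * volume.real (Metric.closedBall (0 : EuclideanSpace ℝ (Fin n)) 1) = 1) {t : ℝ} (t0 : 0 < t) :
    (∃ A : Finset (EuclideanSpace ℝ (Fin n)), (#A : ℝ) ≤ exp ((182 * (416000 * 7)) ^ 2 * log n ^ 2 * n / t ^ 2) ∧
      R • Metric.closedBall 0 1 ⊆ ⋃ x ∈ A, (fun b => x + b) '' (t • K)) ∧
    (∃ A : Finset (EuclideanSpace ℝ (Fin n)), (#A : ℝ) ≤ exp ((182 * (416000 * 7)) ^ 2 * log n ^ 2 * n / t ^ 2) ∧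
      R • {x | ∀ y ∈ K, ⟪x, y⟫ ≤ (1:ℝ)} ⊆ ⋃ x ∈ A, (fun b => x + b) '' (t • Metric.closedBall 0 1)) := by
  classical
  have : Nonempty (Fin n) := ⟨⟨0, by omega⟩⟩
  have hcE : (WithLp.toLp 2 ⁻¹' K : Set (Fin n → ℝ)) = (WithLp.ofLp : EuclideanSpace ℝ (Fin n) → _) '' K := by
    ext x; constructor
    · exact fun h => ⟨_, h, rfl⟩
    · rintro ⟨y, hy, rfl⟩; exact hy
  have hK' : IsCompact (Kn L K) := by
    rw [Kn, hcE]; exact (hK.image (PiLp.continuous_ofLp 2 _)).smul _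
  have hc' : Convex ℝ (Kn L K) := (hc.is_linear_preimage (f := fun x => (WithLp.toLp 2 x : EuclideanSpace ℝ (Fin n))) ⟨fun _ _ => rfl, fun _ _ => rfl⟩).smul _
  have h00 : (0 : Fin n → ℝ) ∈ interior (Kn L K) := by
    rw [Kn, interior_smul₀ (inv_ne_zero L0.ne')]
    refine ⟨0, ?_, by simp⟩
    exact preimage_interior_subset_interior_preimage (PiLp.continuous_toLp 2 _) (zero_int hK hc hi hb)
  have hv' : 0 < volume.real (Kn L K) := by
    have := Kn_int (K := K) L0 fun _ => 1
    simp [measureReal_def, hv] at this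
    rw [measureReal_def, this]; positivity
  have hm0 : ∀ p : Pt (Fin n ⊕ Fin n), p.1 = 0 → (∀ i, p.2 (Sum.inl i) = 0) → ∀ i, mn (Ep (Kn L K) p) i = 0 := fun p h1 h2 i => by
    rw [mn, Kn_Ep L0 hv h1 h2]
    simp only [Pi.smul_apply, smul_eq_mul]
    have : ∫ x in K, x i = 0 := bar0 hK hb (EuclideanSpace.proj i)
    rw [integral_const_mul, this, mul_zero]
  have hcv : ∀ p : Pt (Fin n ⊕ Fin n), p.1 = 0 → (∀ i, p.2 (Sum.inl i) = 0) → Matrix.of (Cv (Ep (Kn L K) p)) = 1 := fun p h1 h2 => by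
    ext i j
    rw [Matrix.of_apply, Cv_eq (isExp_Ep hK' hv' p), hm0 p h1 h2, Kn_Ep L0 hv h1 h2]
    have e : ∀ x : EuclideanSpace ℝ (Fin n), (L⁻¹ • x.ofLp) i * (L⁻¹ • x.ofLp) j = (L ^ 2)⁻¹ * (x i * x j) := fun x => by
      simp; ring
    simp only [e]
    rw [integral_const_mul, mom hK hL, Matrix.one_apply]
    split_ifs
    · field_simp; ring
    · ring
  have l2 : log 2 ≤ log n := Real.log_le_log (by norm_num) (by exact_mod_cast hn)
  have l3 := Real.log_two_gt_d9
  have hr1 := Nat.le_ceil (log n)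
  have hr2 := Nat.ceil_lt_add_one (a := log n) (by linarith)
  have hex : 8192 * (416000 * ((⌈log n⌉₊ + 2 : ℕ) + 1 : ℝ)) ^ 2 * (R / L) ^ 2 / t ^ 2 ≤ (182 * (416000 * 7)) ^ 2 * log n ^ 2 * n / t ^ 2 := by
    have h1 : ((⌈log n⌉₊ + 2 : ℕ) + 1 : ℝ) ≤ 7 * log n := by push_cast; linarith
    have h2 : (R / L) ^ 2 ≤ 4 * n := by
      rw [div_pow, div_le_iff₀ (by positivity)]; exact rn_le hK hn hv L0 hL R0 hR
    refine div_le_div_of_nonneg_right ?_ (by positivity)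
    calc _ ≤ 8192 * (416000 * (7 * log n)) ^ 2 * (4 * n) := by gcongr
      _ = 32768 * ((416000 * 7) ^ 2 * log n ^ 2 * n) := by ring
      _ ≤ 182 ^ 2 * ((416000 * 7) ^ 2 * log n ^ 2 * n) := by gcongr; norm_num
      _ = _ := by ring
  obtain ⟨⟨A, hA1, hA2⟩, B, hB1, hB2⟩ := cov2 hK' hc' h00 hv' hcv hm0 (r := ⌈log n⌉₊ + 2) (by
    rw [Fintype.card_fin]; push_cast; linarith) (ρ := R / L) t0 (by positivity)
  have hn2 : ∀ x : Fin n → ℝ, n2 x = ‖(WithLp.toLp 2 x : EuclideanSpace ℝ (Fin n))‖ ^ 2 := fun x => by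
    rw [EuclideanSpace.real_norm_sq_eq]; rfl
  constructor
  · refine ⟨A.image fun a => WithLp.toLp 2 (L • a), (Nat.cast_le.2 Finset.card_image_le).trans (hA1.trans (exp_le_exp.2 hex)), fun x hx => ?_⟩
    rw [smul_unitClosedBall, mem_closedBall_zero_iff, Real.norm_of_nonneg R0.le] at hx
    obtain ⟨a, ha, k, ⟨k0, hk0, rfl⟩, e⟩ := hA2 (L⁻¹ • x.ofLp) (by
      rw [hn2, WithLp.toLp_smul, norm_smul, mul_pow, div_pow, div_eq_inv_mul, Real.norm_of_nonneg (by positivity), inv_pow]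
      gcongr)
    simp only [Set.mem_iUnion]
    refine ⟨_, Finset.mem_image_of_mem _ ha, t • WithLp.toLp 2 k0, ⟨_, hk0, rfl⟩, ?_⟩
    ext i
    have e' := congrFun e i
    simp at e' ⊢
    field_simp at e'
    linarith
  · refine ⟨B.image fun a => (R / L) • WithLp.toLp 2 a, (Nat.cast_le.2 Finset.card_image_le).trans (hB1.trans (exp_le_exp.2 hex)), ?_⟩
    rintro _ ⟨w, hw, rfl⟩
    obtain ⟨a, ha, h⟩ := hB2 (L • w.ofLp) (by
      rintro _ ⟨k, hk, rfl⟩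
      have := hw _ hk
      rw [PiLp.inner_apply] at this
      refine le_trans (le_of_eq (sum_congr rfl fun i _ => ?_)) this
      simp; field_simp)
    simp only [Set.mem_iUnion]
    refine ⟨_, Finset.mem_image_of_mem _ ha, R • w - (R / L) • WithLp.toLp 2 a, ?_, by simp⟩
    rw [smul_unitClosedBall, mem_closedBall_zero_iff, Real.norm_of_nonneg t0.le]
    rw [hn2, sq_le_sq₀ (norm_nonneg _) (by positivity)] at h
    have e : R • w - (R / L) • WithLp.toLp 2 a = (R / L) • (WithLp.toLp 2 (L • w.ofLp - a) : EuclideanSpace ℝ (Fin n)) := by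
      ext i; simp; field_simp
    rw [e, norm_smul, Real.norm_of_nonneg (by positivity)]
    calc _ ≤ R / L * (t / (R / L)) := by gcongr
      _ = t := by field_simp
end
end GridB

/-- Theorem (regular covering estimates, inner part): for an isotropic convex body `K`,
`max{N(r_n·B₂ⁿ, t·K), N(r_n·K°, t·B₂ⁿ)} ≤ exp(c₂²·(log n)²·n / t²)` for every `t > 0`. -/
theorem stmt9 :
    ∃ c₂ : ℝ, 0 < c₂ ∧ ∀ (n : ℕ), 2 ≤ n →
      ∀ K : Set (EuclideanSpace ℝ (Fin n)),
        IsCompact K → Convex ℝ K → (interior K).Nonempty → IsIsotropic K →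
        ∀ t : ℝ, 0 < t →
          max ((covN (rn n • closedBall (0 : EuclideanSpace ℝ (Fin n)) 1) (t • K) : ℝ≥0∞))
              ((covN (rn n • polarBody K)
                  (t • closedBall (0 : EuclideanSpace ℝ (Fin n)) 1) : ℝ≥0∞)) ≤
            ENNReal.ofReal (Real.exp (c₂ ^ 2 * (Real.log n) ^ 2 * n / t ^ 2)) := by
  refine ⟨182 * (416000 * 7), by norm_num, fun n hn K hK hc hi hiso t t0 => ?_⟩
  obtain ⟨hv, hb, L, L0, hL⟩ := hiso
  have V0 : 0 < volume.real (closedBall (0 : EuclideanSpace ℝ (Fin n)) 1) :=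
    ENNReal.toReal_pos (measure_closedBall_pos volume _ one_pos).ne' measure_closedBall_lt_top.ne
  have R0 : 0 < rn n := Real.rpow_pos_of_pos V0 _
  have hR : rn n ^ n * volume.real (closedBall (0 : EuclideanSpace ℝ (Fin n)) 1) = 1 := by
    have n0 : (n : ℝ) ≠ 0 := by positivity
    unfold rn
    rw [← Real.rpow_natCast, ← measureReal_def, ← Real.rpow_mul V0.le, div_mul_cancel₀ _ n0, Real.rpow_neg_one]
    exact inv_mul_cancel₀ V0.ne'
  have key : ∀ (A B : Set (EuclideanSpace ℝ (Fin n))) (S : Finset (EuclideanSpace ℝ (Fin n))) (M : ℝ), (S.card : ℝ) ≤ M →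
      A ⊆ (⋃ x ∈ S, (fun b => x + b) '' B) → (covN A B : ℝ≥0∞) ≤ ENNReal.ofReal M := by
    intro A B S M h1 h2
    have h3 : covN A B ≤ (S.card : ℕ∞) := sInf_le ⟨S, h2, rfl⟩
    refine (ENat.toENNReal_le.2 h3).trans ?_
    rw [ENat.toENNReal_coe, ← ENNReal.ofReal_natCast]
    exact ENNReal.ofReal_le_ofReal h1
  obtain ⟨⟨A, hA1, hA2⟩, B, hB1, hB2⟩ := GridB.main8 hn hK hc hi hv hb L0 hL R0 hR t0
  exact max_le (key _ _ A _ hA1 hA2) (key _ _ B _ hB1 hB2)
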